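/- Let f be a loxodromic automorphism of ℂ² and let γ : 𝔻 → ℂ² be a transversal to J⁺, with associated Julia slice E_γ = 𝔻 ∩ ∂(γ⁻¹(K⁺)). Then E_γ is not a rectifiable curve: there is no injective Lipschitz map η : [0,1] → ℂ such that η([0,1]) = E_γ. -/

import Mathlib

open Function Set Filter Topology

noncomputable section

/-- A polynomial map of `ℂ²`. -/
def IsPolyMap (F : ℂ × ℂ → ℂ × ℂ) : Prop :=
  ∃ P Q : MvPolynomial (Fin 2) ℂ, ∀ z : ℂ × ℂ,
    F z = (MvPolynomial.eval ![z.1, z.2] P, MvPolynomial.eval ![z.1, z.2] Q)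

/-- A polynomial automorphism of `ℂ²`. -/
def IsPolyAuto (F : ℂ × ℂ → ℂ × ℂ) : Prop :=
  IsPolyMap F ∧ ∃ G : ℂ × ℂ → ℂ × ℂ, IsPolyMap G ∧
    (∀ z, G (F z) = z) ∧ (∀ z, F (G z) = z)

/-- A generalized Hénon map. -/
def IsHenon (h : ℂ × ℂ → ℂ × ℂ) : Prop :=
  ∃ (p : Polynomial ℂ) (a : ℂ), a ≠ 0 ∧ 2 ≤ p.natDegree ∧
    ∀ z : ℂ × ℂ, h z = (Polynomial.eval z.1 p - a * z.2, z.1)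

/-- A loxodromic automorphism of `ℂ²`. -/
def IsLoxodromic (f : ℂ × ℂ → ℂ × ℂ) : Prop :=
  IsPolyAuto f ∧
  ∃ (u uinv : ℂ × ℂ → ℂ × ℂ) (hs : List (ℂ × ℂ → ℂ × ℂ)),
    IsPolyAuto u ∧ (∀ z, uinv (u z) = z) ∧ (∀ z, u (uinv z) = z) ∧
    hs ≠ [] ∧ (∀ h ∈ hs, IsHenon h) ∧
    ∀ z, f z = uinv (hs.foldr (fun h acc => h ∘ acc) id (u z))

/-- The set of points with bounded forward orbit. -/
def Kplus (f : ℂ × ℂ → ℂ × ℂ) : Set (ℂ × ℂ) :=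
  {z | ∃ C : ℝ, ∀ n : ℕ, ‖f^[n] z‖ ≤ C}

/-- `lam` is an eigenvalue of the continuous linear map `T`. -/
def IsEigenvalue (T : (ℂ × ℂ) →L[ℂ] ℂ × ℂ) (lam : ℂ) : Prop :=
  ∃ v : ℂ × ℂ, v ≠ 0 ∧ T v = lam • v

/-- `p` is a saddle periodic point of period `n` with stable multiplier `ls`
and unstable multiplier `lu`. -/
def IsSaddle (f : ℂ × ℂ → ℂ × ℂ) (p : ℂ × ℂ) (n : ℕ) (ls lu : ℂ) : Prop :=
  1 ≤ n ∧ f^[n] p = p ∧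
  IsEigenvalue (fderiv ℂ (f^[n]) p) ls ∧ IsEigenvalue (fderiv ℂ (f^[n]) p) lu ∧
  ‖ls‖ < 1 ∧ 1 < ‖lu‖

/-- Coordinatewise complex conjugation `σ(x,y) = (x̄, ȳ)`. -/
def conjMap (z : ℂ × ℂ) : ℂ × ℂ := (starRingEnd ℂ z.1, starRingEnd ℂ z.2)

/-- The open unit disk in `ℂ`. -/
def unitDisk : Set ℂ := Metric.ball 0 1

/-- `γ` is a transversal to `J⁺`. -/
def IsTransversal (f : ℂ × ℂ → ℂ × ℂ) (γ : ℂ → ℂ × ℂ) : Prop :=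
  Set.InjOn γ unitDisk ∧ DifferentiableOn ℂ γ unitDisk ∧
  (∃ z ∈ unitDisk, γ z ∈ Kplus f) ∧ ¬ (∀ z ∈ unitDisk, γ z ∈ Kplus f)

/-- The Julia slice associated to a transversal. -/
def juliaSlice (f : ℂ × ℂ → ℂ × ℂ) (γ : ℂ → ℂ × ℂ) : Set ℂ :=
  unitDisk ∩ frontier {z | z ∈ unitDisk ∧ γ z ∈ Kplus f}

/-- An unstable parametrization of a saddle periodic point. -/
def IsUnstableParam (f : ℂ × ℂ → ℂ × ℂ) (n : ℕ) (lu : ℂ) (p : ℂ × ℂ) (ψ : ℂ → ℂ × ℂ) : Prop :=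
  Function.Injective ψ ∧ Differentiable ℂ ψ ∧ ψ 0 = p ∧
  ∀ ζ : ℂ, f^[n] (ψ ζ) = ψ (lu * ζ)

/-- `S` is contained in a proper real-analytic subvariety of `ℂ²`. -/
def ContainedInProperRealAnalyticSubvariety (S : Set (ℂ × ℂ)) : Prop :=
  ∃ V : Set (ℂ × ℂ), IsClosed V ∧ V ≠ Set.univ ∧ S ⊆ V ∧
    ∀ x ∈ V, ∃ (U : Set (ℂ × ℂ)) (g : ℂ × ℂ → ℝ),
      IsOpen U ∧ x ∈ U ∧ (∀ y ∈ U, AnalyticAt ℝ g y) ∧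
      (∃ y ∈ U, g y ≠ 0) ∧ ∀ y ∈ V ∩ U, g y = 0

namespace JS
open Metric ComplexConjugate

lemma exists_log_ball {h : ℂ → ℂ} {c : ℂ} {ρ : ℝ} (hρ : 0 < ρ)
    (hd : DifferentiableOn ℂ h (ball c ρ)) (hne : ∀ z ∈ ball c ρ, h z ≠ 0) :
    ∃ L : ℂ → ℂ, (∀ z ∈ ball c ρ, HasDerivAt L (deriv h z / h z) z) ∧
      ∀ z ∈ ball c ρ, h z = Complex.exp (L z) := by
  have hq : DifferentiableOn ℂ (fun z => deriv h z / h z) (ball c ρ) :=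
    (hd.deriv isOpen_ball).div hd hne
  obtain ⟨L, hLc, hL⟩ := hq.isExactOn_ball.with_val_at c (Complex.log (h c))
  refine ⟨L, hL, fun z hz => ?_⟩
  have hcm : c ∈ ball c ρ := mem_ball_self hρ
  have key : ∀ z ∈ ball c ρ, HasDerivAt (fun z => h z * Complex.exp (-(L z))) 0 z := by
    intro z hz
    have h1 : HasDerivAt h (deriv h z) z :=
      (hd.differentiableAt (isOpen_ball.mem_nhds hz)).hasDerivAt
    have h2 := h1.mul ((hL z hz).neg.cexp)
    refine HasDerivAt.congr_deriv h2 ?_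
    have e : h z * (deriv h z / h z) = deriv h z := mul_div_cancel₀ _ (hne z hz)
    simp only [Pi.neg_apply]
    linear_combination (-Complex.exp (-(L z))) * e
  have hconst := isOpen_ball.is_const_of_deriv_eq_zero (𝕜 := ℂ)
    (convex_ball c ρ).isPreconnected
    (fun z hz => (key z hz).differentiableAt.differentiableWithinAt)
    (fun z hz => (key z hz).deriv) hz hcm
  rw [hLc, Complex.exp_neg (Complex.log _), Complex.exp_log (hne c hcm),
    mul_inv_cancel₀ (hne c hcm), Complex.exp_neg] at hconst
  field_simp at hconst
  exact hconst

lemma schwarz_core {h : ℂ → ℂ} {c : ℂ} {ρ : ℝ} (hρ : 0 < ρ)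
    (hd : DifferentiableOn ℂ h (ball c ρ)) (h1 : ∀ z ∈ ball c ρ, 1 < ‖h z‖) :
    (∀ w ∈ ball c ρ, (ρ - dist w c) * Real.log ‖h w‖ ≤ (ρ + dist w c) * Real.log ‖h c‖ ∧
      (ρ - dist w c) * Real.log ‖h c‖ ≤ (ρ + dist w c) * Real.log ‖h w‖) ∧
    ‖deriv h c / h c‖ * ρ ≤ 2 * Real.log ‖h c‖ := by
  have hne : ∀ z ∈ ball c ρ, h z ≠ 0 := fun z hz h0 => by
    have := h1 z hz; rw [h0, norm_zero] at this; linarith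
  obtain ⟨L, hL, hexp⟩ := exists_log_ball hρ hd hne
  have hcm : c ∈ ball c ρ := mem_ball_self hρ
  have hre : ∀ z ∈ ball c ρ, Real.log ‖h z‖ = (L z).re := fun z hz => by
    rw [hexp z hz, Complex.norm_exp, Real.log_exp]
  have hpos : ∀ z ∈ ball c ρ, 0 < (L z).re := fun z hz => by
    rw [← hre z hz]; exact Real.log_pos (h1 z hz)
  set a := L c with ha
  have hden : ∀ z ∈ ball c ρ, L z + conj a ≠ 0 := fun z hz h0 => by
    have := congrArg Complex.re h0
    simp at this
    have := hpos z hz; have := hpos c hcm; linarith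
  set φ : ℂ → ℂ := fun z => (L z - a) / (L z + conj a) with hφ
  have hφd : ∀ z ∈ ball c ρ, HasDerivAt φ
      (((deriv h z / h z) * (L z + conj a) - (L z - a) * (deriv h z / h z)) /
        (L z + conj a) ^ 2) z := fun z hz =>
    ((hL z hz).sub_const a).div ((hL z hz).add_const _) (hden z hz)
  have hφc : φ c = 0 := by simp [hφ, ha]
  have hsq : ∀ z : ℂ, ‖z‖ ^ 2 = z.re ^ 2 + z.im ^ 2 := fun z => by
    rw [← Complex.normSq_eq_norm_sq, Complex.normSq_apply]; ring
  have hmaps : MapsTo φ (ball c ρ) (closedBall (φ c) 1) := by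
    intro z hz
    rw [hφc, mem_closedBall_zero_iff, hφ]
    simp only [norm_div]
    apply div_le_one_of_le₀ _ (norm_nonneg _)
    apply le_of_sq_le_sq _ (norm_nonneg _)
    rw [hsq, hsq]
    simp
    nlinarith [hpos z hz, hpos c hcm, mul_pos (hpos z hz) (hpos c hcm)]
  have hdiff : DifferentiableOn ℂ φ (ball c ρ) :=
    fun z hz => (hφd z hz).differentiableAt.differentiableWithinAt
  constructor
  · intro w hw
    have h2 := Complex.dist_le_div_mul_dist_of_mapsTo_ball hdiff hmaps hw
    rw [hφc, dist_zero_right] at h2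
    have hs : dist w c < ρ := hw
    have hs0 : 0 ≤ dist w c := dist_nonneg
    set s := dist w c
    have h3 : ρ * ‖L w - a‖ ≤ s * ‖L w + conj a‖ := by
      have hp : 0 < ‖L w + conj a‖ := norm_pos_iff.mpr (hden w hw)
      simp only [hφ, norm_div] at h2
      rw [div_le_iff₀ hp] at h2
      calc ρ * ‖L w - a‖ ≤ ρ * (1 / ρ * s * ‖L w + conj a‖) := by gcongr
        _ = s * ‖L w + conj a‖ := by field_simp
    have h4 : (ρ * ‖L w - a‖) ^ 2 ≤ (s * ‖L w + conj a‖) ^ 2 := by gcongr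
    rw [mul_pow, mul_pow, hsq, hsq] at h4
    simp at h4
    have hp := hpos w hw
    have hq := hpos c hcm
    rw [hre w hw, hre c hcm, ← ha]
    rw [← ha] at hq
    have h5 : (ρ * ((L w).re - a.re)) ^ 2 ≤ (s * ((L w).re + a.re)) ^ 2 := by
      have : s ^ 2 * ((L w).im - a.im) ^ 2 ≤ ρ ^ 2 * ((L w).im - a.im) ^ 2 := by gcongr
      have e : (L w).im + -a.im = (L w).im - a.im := by ring
      rw [e] at h4
      nlinarith
    have h6 := abs_le_of_sq_le_sq' h5 (by positivity)
    constructor <;> nlinarith [h6.1, h6.2]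
  · have h2 := Complex.norm_deriv_le_div_of_mapsTo_ball hdiff hmaps hρ
    rw [(hφd c hcm).deriv, ← ha] at h2
    have e : a + conj a = ((2 * a.re : ℝ) : ℂ) := Complex.add_conj a
    have hq := hpos c hcm
    rw [← ha] at hq
    rw [e, sub_self, zero_mul, sub_zero, norm_div, norm_mul, norm_pow, Complex.norm_real,
      Real.norm_of_nonneg (by positivity), div_le_div_iff₀ (by positivity) hρ] at h2
    rw [hre c hcm, ← ha]
    have : (‖deriv h c / h c‖ * ρ) * (2 * a.re) ≤ (2 * a.re) * (2 * a.re) := by nlinarith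
    exact le_of_mul_le_mul_right this (by positivity)

end JS

namespace JS
open Metric ComplexConjugate

/-- product of degrees -/
def Dg (d : ℕ → ℕ) (m : ℕ) : ℝ := ∏ i ∈ Finset.range m, (d i : ℝ)

structure Par (d : ℕ → ℕ) (R C : ℝ) : Prop where
  hd : ∀ m, 2 ≤ d m
  hC : 0 ≤ C
  hR : Real.exp (2 * C + 1) ≤ R

structure Adm (d : ℕ → ℕ) (R C : ℝ) (x : ℕ → ℂ) : Prop where
  up : ∀ m, ‖x (m + 1)‖ ≤ Real.exp C * (max ‖x m‖ R) ^ (d m)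
  low : ∀ m, R < ‖x m‖ → Real.exp (-C) * ‖x m‖ ^ (d m) ≤ ‖x (m + 1)‖

def bb (R : ℝ) (x : ℕ → ℂ) (m : ℕ) : ℝ := Real.log (max ‖x m‖ R)

def gr (d : ℕ → ℕ) (R : ℝ) (x : ℕ → ℂ) : ℝ :=
  limUnder atTop (fun m => bb R x m / Dg d m)

section seq
variable {d : ℕ → ℕ} {R C : ℝ} {x : ℕ → ℂ}

lemma Dg_succ (d : ℕ → ℕ) (m : ℕ) : Dg d (m + 1) = Dg d m * d m := by
  simp [Dg, Finset.prod_range_succ]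

lemma Par.two_le (hp : Par d R C) (m : ℕ) : (2 : ℝ) ≤ d m := by exact_mod_cast hp.hd m

lemma Par.Dg_pos (hp : Par d R C) (m : ℕ) : 0 < Dg d m :=
  Finset.prod_pos fun i _ => by have := hp.two_le i; linarith

lemma Par.Dg_ge (hp : Par d R C) (m : ℕ) : (2 : ℝ) ^ m ≤ Dg d m := by
  induction m with
  | zero => simp [Dg]
  | succ m ih =>
    rw [Dg_succ, pow_succ]
    have := hp.two_le m
    have := (hp.Dg_pos m).le
    gcongr

lemma Par.Dg_tendsto (hp : Par d R C) : Tendsto (Dg d) atTop atTop :=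
  tendsto_atTop_mono hp.Dg_ge (tendsto_pow_atTop_atTop_of_one_lt (by norm_num))

lemma Par.Rpos (hp : Par d R C) : 0 < R := (Real.exp_pos _).trans_le hp.hR

lemma Par.logR (hp : Par d R C) : 2 * C + 1 ≤ Real.log R :=
  (Real.le_log_iff_exp_le hp.Rpos).mpr hp.hR

lemma Par.R_gt_one (hp : Par d R C) : 2 < R := by
  have h1 := hp.hR
  have h2 : (2 : ℝ) < Real.exp 1 := by have := Real.exp_one_gt_d9; linarith
  have h3 : Real.exp 1 ≤ Real.exp (2 * C + 1) := Real.exp_le_exp.mpr (by have := hp.hC; linarith)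
  linarith

lemma Adm.double (hp : Par d R C) (hx : Adm d R C x) {m : ℕ} (h : R < ‖x m‖) :
    2 * ‖x m‖ ≤ ‖x (m + 1)‖ := by
  refine le_trans ?_ (hx.low m h)
  have hx1 : 1 ≤ ‖x m‖ := by have := hp.R_gt_one; linarith
  have h2 : ‖x m‖ ^ 2 ≤ ‖x m‖ ^ d m := pow_le_pow_right₀ hx1 (hp.hd m)
  have h3 : 2 ≤ Real.exp (-C) * ‖x m‖ := by
    have h4 : Real.exp (-C) * Real.exp (2 * C + 1) ≤ Real.exp (-C) * ‖x m‖ := by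
      have := hp.hR
      gcongr; linarith
    rw [← Real.exp_add] at h4
    have h5 := Real.add_one_le_exp (-C + (2 * C + 1))
    have := hp.hC
    linarith
  calc 2 * ‖x m‖ ≤ Real.exp (-C) * ‖x m‖ * ‖x m‖ := by gcongr
    _ = Real.exp (-C) * ‖x m‖ ^ 2 := by ring
    _ ≤ _ := by gcongr

lemma Adm.esc_mono (hp : Par d R C) (hx : Adm d R C x) {m n : ℕ} (hmn : m ≤ n)
    (h : R < ‖x m‖) : R < ‖x n‖ := by
  induction n, hmn using Nat.le_induction with
  | base => exact h
  | succ n _ ih =>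
    have := hx.double hp ih
    have := hp.Rpos
    linarith

lemma bb_of_esc {m : ℕ} (h : R < ‖x m‖) : bb R x m = Real.log ‖x m‖ := by
  rw [bb, max_eq_left h.le]

lemma bb_ge (hp : Par d R C) (m : ℕ) : Real.log R ≤ bb R x m :=
  Real.log_le_log hp.Rpos (le_max_right _ _)

lemma bb_pos (hp : Par d R C) (m : ℕ) : 0 < bb R x m := by
  have := bb_ge (x := x) hp m
  have := hp.logR; have := hp.hC; linarith

lemma Adm.bb_up (hp : Par d R C) (hx : Adm d R C x) (m : ℕ) :
    bb R x (m + 1) ≤ d m * bb R x m + C := by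
  have hM : 0 < max ‖x m‖ R := lt_max_of_lt_right hp.Rpos
  have hM1 : 1 ≤ max ‖x m‖ R := le_max_of_le_right (by have := hp.R_gt_one; linarith)
  have h1 : max ‖x (m + 1)‖ R ≤ Real.exp C * (max ‖x m‖ R) ^ (d m) := by
    apply max_le (hx.up m)
    calc R ≤ max ‖x m‖ R := le_max_right _ _
      _ ≤ (max ‖x m‖ R) ^ d m := le_self_pow₀ hM1 (by have := hp.hd m; omega)
      _ ≤ _ := le_mul_of_one_le_left (by positivity) (Real.one_le_exp hp.hC)
  have h2 := Real.log_le_log (lt_max_of_lt_right hp.Rpos) h1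
  rw [Real.log_mul (Real.exp_pos _).ne' (by positivity), Real.log_exp, Real.log_pow] at h2
  unfold bb
  linarith

lemma Adm.bb_low (hp : Par d R C) (hx : Adm d R C x) {m : ℕ} (h : R < ‖x m‖) :
    d m * bb R x m - C ≤ bb R x (m + 1) := by
  have h0 : 0 < ‖x m‖ := hp.Rpos.trans h
  rw [bb_of_esc h, bb_of_esc (hx.esc_mono hp (Nat.le_succ m) h)]
  have h2 := Real.log_le_log (by positivity) (hx.low m h)
  rw [Real.log_mul (Real.exp_pos _).ne' (by positivity), Real.log_exp, Real.log_pow] at h2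
  linarith

lemma Adm.anti (hp : Par d R C) (hx : Adm d R C x) :
    Antitone (fun m => (bb R x m + C) / Dg d m) := by
  apply antitone_nat_of_succ_le
  intro m
  have := hp.Dg_pos m
  have h2 := hp.two_le m
  rw [Dg_succ, div_le_div_iff₀ (by positivity) this]
  have h3 : bb R x (m + 1) + C ≤ d m * (bb R x m + C) := by
    have := hx.bb_up hp m
    have := hp.hC
    nlinarith
  calc _ ≤ d m * (bb R x m + C) * Dg d m := by gcongr
    _ = _ := by ring

lemma Adm.tendsto (hp : Par d R C) (hx : Adm d R C x) :
    Tendsto (fun m => bb R x m / Dg d m) atTop (𝓝 (gr d R x)) := by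
  have h1 : BddBelow (range fun m => (bb R x m + C) / Dg d m) := by
    refine ⟨0, ?_⟩
    rintro _ ⟨m, rfl⟩
    have := bb_pos (x := x) hp m
    have := hp.hC
    have := hp.Dg_pos m
    simp only
    positivity
  have h2 := tendsto_atTop_ciInf (hx.anti hp) h1
  have h3 : Tendsto (fun m => C / Dg d m) atTop (𝓝 0) :=
    hp.Dg_tendsto.const_div_atTop C
  have h4 := h2.sub h3
  have h5 : Tendsto (fun m => bb R x m / Dg d m) atTop
      (𝓝 ((⨅ m, (bb R x m + C) / Dg d m) - 0)) := by
    refine h4.congr fun m => ?_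
    ring
  exact tendsto_nhds_limUnder ⟨_, h5⟩

lemma Adm.gr_le (hp : Par d R C) (hx : Adm d R C x) (m : ℕ) :
    Dg d m * gr d R x ≤ bb R x m + C := by
  have h0 := hp.Dg_pos m
  rw [mul_comm, ← le_div_iff₀ h0]
  have h3 : Tendsto (fun m => C / Dg d m) atTop (𝓝 0) :=
    hp.Dg_tendsto.const_div_atTop C
  have h4 := (hx.tendsto hp).add h3
  rw [add_zero] at h4
  refine le_of_tendsto h4 ?_
  filter_upwards [eventually_ge_atTop m] with n hn
  rw [← add_div]
  exact hx.anti hp hn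

lemma Adm.growth (hp : Par d R C) (hx : Adm d R C x) {m n : ℕ} (h : m ≤ n) :
    bb R x n + C ≤ Dg d n / Dg d m * (bb R x m + C) := by
  have h1 := hx.anti hp h
  have := hp.Dg_pos m
  have := hp.Dg_pos n
  simp only at h1
  rw [div_le_iff₀ (by positivity)] at h1
  calc _ ≤ _ := h1
    _ = _ := by ring

lemma Adm.le_gr (hp : Par d R C) (hx : Adm d R C x) {m : ℕ} (h : R < ‖x m‖) :
    Real.log ‖x m‖ - C ≤ Dg d m * gr d R x := by
  have h0 := hp.Dg_pos m
  rw [← bb_of_esc h, mul_comm, ← div_le_iff₀ h0]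
  have h3 : Tendsto (fun m => C / Dg d m) atTop (𝓝 0) :=
    hp.Dg_tendsto.const_div_atTop C
  have h4 := (hx.tendsto hp).sub h3
  rw [sub_zero] at h4
  refine ge_of_tendsto h4 ?_
  filter_upwards [eventually_ge_atTop m] with n hn
  rw [← sub_div]
  induction n, hn using Nat.le_induction with
  | base => exact le_rfl
  | succ n hn ih =>
    refine ih.trans ?_
    have := hp.Dg_pos n
    have h2 := hp.two_le n
    rw [Dg_succ, div_le_div_iff₀ this (by positivity)]
    have h3 : d n * (bb R x n - C) ≤ bb R x (n + 1) - C := by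
      have := hx.bb_low hp (hx.esc_mono hp hn h)
      have := hp.hC
      nlinarith
    calc _ = d n * (bb R x n - C) * Dg d n := by ring
      _ ≤ _ := by gcongr

lemma Adm.gr_nonneg (hp : Par d R C) (hx : Adm d R C x) : 0 ≤ gr d R x := by
  refine ge_of_tendsto (hx.tendsto hp) (Eventually.of_forall fun m => ?_)
  have := bb_pos (x := x) hp m
  have := hp.Dg_pos m
  positivity

lemma Adm.gr_pos (hp : Par d R C) (hx : Adm d R C x) {m : ℕ} (h : R < ‖x m‖) :
    0 < gr d R x := by
  have h1 := hx.le_gr hp h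
  have h2 := Real.log_lt_log hp.Rpos h
  have := hp.logR
  have := hp.hC
  exact pos_of_mul_pos_right (by linarith : 0 < Dg d m * gr d R x) (hp.Dg_pos m).le

/-- upper bound for log -/
lemma Adm.bb_le_gr (hp : Par d R C) (hx : Adm d R C x) (m : ℕ) :
    bb R x m ≤ Dg d m * gr d R x + C + Real.log R := by
  have h0 : 0 < Real.log R := by have := hp.logR; have := hp.hC; linarith
  have := hp.hC
  by_cases h : R < ‖x m‖
  · have := hx.le_gr hp h
    rw [bb_of_esc h]; linarith
  · rw [bb, max_eq_right (not_lt.mp h)]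
    have := mul_nonneg (hp.Dg_pos m).le (hx.gr_nonneg hp)
    linarith

lemma Adm.tendsto_log (hp : Par d R C) (hx : Adm d R C x) (h : ∃ m, R < ‖x m‖) :
    Tendsto (fun m => Real.log ‖x m‖ / Dg d m) atTop (𝓝 (gr d R x)) := by
  obtain ⟨m, hm⟩ := h
  refine (hx.tendsto hp).congr' ?_
  filter_upwards [eventually_ge_atTop m] with n hn
  rw [bb_of_esc (hx.esc_mono hp hn hm)]

end seq

lemma harnack_lim {h : ℕ → ℂ → ℂ} {D : ℕ → ℝ} (hD : ∀ m, 0 < D m) {u : ℂ → ℝ} {c : ℂ} {ρ : ℝ}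
    (hd : ∀ ρ' < ρ, ∀ᶠ m in atTop, DifferentiableOn ℂ (h m) (ball c ρ'))
    (h1 : ∀ ρ' < ρ, ∀ᶠ m in atTop, ∀ z ∈ ball c ρ', 1 < ‖h m z‖)
    (hu : ∀ z ∈ ball c ρ, Tendsto (fun m => Real.log ‖h m z‖ / D m) atTop (𝓝 (u z)))
    {w : ℂ} (hw : w ∈ ball c ρ) :
    (ρ - dist w c) * u w ≤ (ρ + dist w c) * u c ∧
      (ρ - dist w c) * u c ≤ (ρ + dist w c) * u w := by
  have hw' : dist w c < ρ := hw
  have hρ : 0 < ρ := dist_nonneg.trans_lt hw'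
  have hc : c ∈ ball c ρ := mem_ball_self hρ
  have key : ∀ ρ' ∈ Ioo (dist w c) ρ, (ρ' - dist w c) * u w ≤ (ρ' + dist w c) * u c ∧
      (ρ' - dist w c) * u c ≤ (ρ' + dist w c) * u w := by
    intro ρ' hρ'
    have ev : ∀ᶠ m in atTop,
      (ρ' - dist w c) * (Real.log ‖h m w‖ / D m) ≤ (ρ' + dist w c) * (Real.log ‖h m c‖ / D m) ∧
      (ρ' - dist w c) * (Real.log ‖h m c‖ / D m) ≤ (ρ' + dist w c) * (Real.log ‖h m w‖ / D m) := by
      filter_upwards [hd ρ' hρ'.2, h1 ρ' hρ'.2] with m hm1 hm2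
      have := (schwarz_core (dist_nonneg.trans_lt hρ'.1) hm1 hm2).1 w hρ'.1
      have hDm := hD m
      simp only [← mul_div_assoc]
      exact ⟨div_le_div_of_nonneg_right this.1 hDm.le, div_le_div_of_nonneg_right this.2 hDm.le⟩
    exact ⟨le_of_tendsto_of_tendsto ((hu w hw).const_mul _) ((hu c hc).const_mul _)
        (ev.mono fun m hm => hm.1),
      le_of_tendsto_of_tendsto ((hu c hc).const_mul _) ((hu w hw).const_mul _)
        (ev.mono fun m hm => hm.2)⟩
  have hne : (𝓝[<] ρ).NeBot := inferInstance
  have hmem : ∀ᶠ ρ' in 𝓝[<] ρ, ρ' ∈ Ioo (dist w c) ρ := Ioo_mem_nhdsLT hw'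
  have hlim : ∀ a b : ℝ, Tendsto (fun r : ℝ => (r + a) * b) (𝓝[<] ρ) (𝓝 ((ρ + a) * b)) := by
    intro a b
    exact Tendsto.mono_left (Continuous.tendsto (by fun_prop) ρ) nhdsWithin_le_nhds
  constructor
  · exact le_of_tendsto_of_tendsto (hlim (-dist w c) _) (hlim _ _)
      (hmem.mono fun r hr => (key r hr).1)
  · exact le_of_tendsto_of_tendsto (hlim (-dist w c) _) (hlim _ _)
      (hmem.mono fun r hr => (key r hr).2)

lemma unif_escape {d : ℕ → ℕ} {R C : ℝ} (hp : Par d R C) {Z : ℕ → ℂ → ℂ} {U K : Set ℂ}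
    (hU : IsOpen U) (hK : IsCompact K) (hKU : K ⊆ U) (hc : ∀ m, ContinuousOn (Z m) U)
    (ha : ∀ z ∈ U, Adm d R C (fun m => Z m z)) (he : ∀ z ∈ K, ∃ m, R < ‖Z m z‖) :
    ∃ m₀, ∀ m ≥ m₀, ∀ z ∈ K, R < ‖Z m z‖ := by
  have ho : ∀ m, IsOpen {z | z ∈ U ∧ R < ‖Z m z‖} := fun m =>
    (hc m).norm.isOpen_inter_preimage hU isOpen_Ioi
  obtain ⟨m, hm⟩ := hK.elim_directed_cover (fun m => {z | z ∈ U ∧ R < ‖Z m z‖}) ho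
    (fun z hz => by
      obtain ⟨m, hm⟩ := he z hz
      exact mem_iUnion.mpr ⟨m, hKU hz, hm⟩)
    (fun m n => ⟨max m n,
      fun z hz => ⟨hz.1, (ha z hz.1).esc_mono hp (le_max_left m n) hz.2⟩,
      fun z hz => ⟨hz.1, (ha z hz.1).esc_mono hp (le_max_right m n) hz.2⟩⟩)
  exact ⟨m, fun n hn z hz => (ha z (hKU hz)).esc_mono hp hn (hm hz).2⟩

lemma harnack_adm {d : ℕ → ℕ} {R C : ℝ} (hp : Par d R C) {Z : ℕ → ℂ → ℂ} {c : ℂ} {ρ : ℝ}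
    (hZ : ∀ m, DifferentiableOn ℂ (Z m) (ball c ρ))
    (ha : ∀ z ∈ ball c ρ, Adm d R C (fun m => Z m z))
    (he : ∀ z ∈ ball c ρ, ∃ m, R < ‖Z m z‖) {w : ℂ} (hw : w ∈ ball c ρ) :
    (ρ - dist w c) * gr d R (fun m => Z m w) ≤ (ρ + dist w c) * gr d R (fun m => Z m c) ∧
      (ρ - dist w c) * gr d R (fun m => Z m c) ≤ (ρ + dist w c) * gr d R (fun m => Z m w) := by
  refine harnack_lim (h := Z) (D := Dg d) hp.Dg_pos
    (u := fun z => gr d R (fun m => Z m z)) ?_ ?_ ?_ hw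
  · intro ρ' hρ'
    exact Eventually.of_forall fun m => (hZ m).mono (ball_subset_ball hρ'.le)
  · intro ρ' hρ'
    obtain ⟨m₀, hm₀⟩ := unif_escape hp (U := ball c ρ) (K := closedBall c ρ') isOpen_ball
      (isCompact_closedBall _ _) (closedBall_subset_ball hρ') (fun m => (hZ m).continuousOn) ha
      (fun z hz => he z (closedBall_subset_ball hρ' hz))
    filter_upwards [eventually_ge_atTop m₀] with m hm z hz
    have := hm₀ m hm z (ball_subset_closedBall hz)
    have := hp.R_gt_one
    linarith
  · intro z hz
    exact (ha z hz).tendsto_log hp (he z hz)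

end JS

namespace JS
open Metric ComplexConjugate

/-- upper half plane -/
def HH : Set ℂ := {z | 0 < z.im}

lemma isOpen_HH : IsOpen HH := isOpen_lt continuous_const Complex.continuous_im

def mob (p t : ℂ) : ℂ := p.re + Complex.I * p.im * ((1 + t) / (1 - t))

lemma one_sub_ne {t : ℂ} (ht : t ∈ ball (0 : ℂ) 1) : 1 - t ≠ 0 := by
  intro h
  have : t = 1 := (sub_eq_zero.mp h).symm
  simp [this] at ht

lemma mob_zero (p : ℂ) : mob p 0 = p := by
  simp [mob, mul_comm Complex.I, Complex.re_add_im]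

lemma mob_mem {p t : ℂ} (hp : p ∈ HH) (ht : t ∈ ball (0 : ℂ) 1) : mob p t ∈ HH := by
  have h1 := one_sub_ne ht
  have h2 : 0 < Complex.normSq (1 - t) := Complex.normSq_pos.mpr h1
  have h3 : Complex.normSq t < 1 := by
    rw [Complex.normSq_eq_norm_sq]
    have : ‖t‖ < 1 := by simpa using ht
    have := norm_nonneg t
    nlinarith
  have h4 : ((1 + t) / (1 - t)).re = (1 - Complex.normSq t) / Complex.normSq (1 - t) := by
    rw [Complex.div_re, ← add_div]
    congr 1
    simp [Complex.normSq_apply]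
    ring
  have h5 : (mob p t).im = p.im * ((1 + t) / (1 - t)).re := by
    simp [mob]
  have hp' : 0 < p.im := hp
  change 0 < (mob p t).im
  rw [h5, h4]
  have : 0 < 1 - Complex.normSq t := by linarith
  positivity

lemma mob_diff (p : ℂ) : DifferentiableOn ℂ (mob p) (ball 0 1) := by
  unfold mob
  intro t ht
  have h1 := one_sub_ne ht
  apply DifferentiableAt.differentiableWithinAt
  fun_prop (disch := assumption)

/-- the inverse of mob -/
def mobi (p w : ℂ) : ℂ := (w - p) / (w - conj p)

lemma sub_conj_ne {p w : ℂ} (hp : p ∈ HH) (hw : w ∈ HH) : w - conj p ≠ 0 := by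
  intro h
  have := congrArg Complex.im h
  have hp' : 0 < p.im := hp
  have hw' : 0 < w.im := hw
  simp at this
  linarith

lemma mob_mobi {p w : ℂ} (hp : p ∈ HH) (hw : w ∈ HH) : mob p (mobi p w) = w := by
  have h1 := sub_conj_ne hp hw
  have h2 : conj p = p - 2 * p.im * Complex.I := by
    apply Complex.ext <;> simp
    ring
  have h4 : (p.re : ℂ) = p - p.im * Complex.I := by
    apply Complex.ext <;> simp
  have hp' : (p.im : ℂ) ≠ 0 := by
    have : 0 < p.im := hp
    exact_mod_cast this.ne'
  have h5 : 1 - mobi p w = 2 * p.im * Complex.I / (w - conj p) := by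
    rw [mobi, eq_div_iff h1, sub_mul, div_mul_cancel₀ _ h1, h2]; ring
  have h6 : 1 + mobi p w = (2 * w - p - conj p) / (w - conj p) := by
    rw [mobi, eq_div_iff h1, add_mul, div_mul_cancel₀ _ h1]; ring
  rw [mob, h5, h6, div_div_div_cancel_right₀ h1, h4, h2]
  field_simp
  ring

lemma mobi_mem {p w : ℂ} (hp : p ∈ HH) (hw : w ∈ HH) : mobi p w ∈ ball (0 : ℂ) 1 := by
  have h1 := sub_conj_ne hp hw
  have hp' : 0 < p.im := hp
  have hw' : 0 < w.im := hw
  rw [mem_ball_zero_iff, mobi, norm_div, div_lt_one (norm_pos_iff.mpr h1), Complex.norm_def,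
    Complex.norm_def]
  apply Real.sqrt_lt_sqrt (Complex.normSq_nonneg _)
  simp only [Complex.normSq_apply, Complex.sub_re, Complex.sub_im, Complex.conj_re,
    Complex.conj_im]
  nlinarith [mul_pos hp' hw']

lemma norm_mobi_vert {x y k : ℝ} (hy : 0 < y) (hk : 1 ≤ k) :
    ‖mobi (x + y * Complex.I) (x + (k * y : ℝ) * Complex.I)‖ = (k - 1) / (k + 1) := by
  have h0 : (y : ℂ) ≠ 0 := by exact_mod_cast hy.ne'
  have h2 : ((k : ℂ) + 1) ≠ 0 := by exact_mod_cast (by linarith : k + 1 ≠ 0)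
  have h1 : mobi (x + y * Complex.I) (x + (k * y : ℝ) * Complex.I) = (((k - 1) / (k + 1) : ℝ) : ℂ) := by
    simp only [mobi, map_add, map_mul, Complex.conj_ofReal, Complex.conj_I]
    push_cast
    have : (x : ℂ) + k * y * Complex.I - (x + y * -Complex.I) = (k + 1) * (y * Complex.I) := by ring
    rw [this]
    have h3 : (x : ℂ) + k * y * Complex.I - (x + y * Complex.I) = (k - 1) * (y * Complex.I) := by ring
    rw [h3, mul_div_mul_right]
    simp [h0]
  rw [h1, Complex.norm_real, Real.norm_of_nonneg]
  apply div_nonneg <;> linarith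

/-- Harnack in the half plane -/
lemma harnack_HH {h : ℕ → ℂ → ℂ} {D : ℕ → ℝ} (hD : ∀ m, 0 < D m) {u : ℂ → ℝ}
    (hd : ∀ K ⊆ HH, IsCompact K → ∀ᶠ m in atTop, ∀ z ∈ K, DifferentiableAt ℂ (h m) z ∧ 1 < ‖h m z‖)
    (hu : ∀ z ∈ HH, Tendsto (fun m => Real.log ‖h m z‖ / D m) atTop (𝓝 (u z)))
    {x y k : ℝ} (hy : 0 < y) (hk : 1 ≤ k) :
    u (x + (k * y : ℝ) * Complex.I) ≤ k * u (x + y * Complex.I) := by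
  set p : ℂ := x + y * Complex.I with hp
  set w : ℂ := x + (k * y : ℝ) * Complex.I with hw
  have hpH : p ∈ HH := by simp [HH, hp, hy]
  have hwH : w ∈ HH := by
    have : 0 < k * y := mul_pos (by linarith) hy
    simpa [HH, hw] using this
  have comp : ∀ ρ' < (1 : ℝ), IsCompact (mob p '' closedBall 0 ρ') ∧ mob p '' closedBall 0 ρ' ⊆ HH := by
    intro ρ' hρ'
    constructor
    · exact (isCompact_closedBall _ _).image_of_continuousOn
        ((mob_diff p).continuousOn.mono (closedBall_subset_ball hρ'))
    · rintro _ ⟨t, ht, rfl⟩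
      exact mob_mem hpH (closedBall_subset_ball hρ' ht)
  have := (harnack_lim (h := fun m t => h m (mob p t)) (c := 0) (ρ := 1) hD
    (u := fun t => u (mob p t)) ?_ ?_ ?_ (mobi_mem hpH hwH)).1
  · rw [mob_mobi hpH hwH, mob_zero, dist_zero_right, norm_mobi_vert hy hk] at this
    have hk1 : 0 < k + 1 := by linarith
    have e1 : 1 - (k - 1) / (k + 1) = 2 / (k + 1) := by field_simp; ring
    have e2 : 1 + (k - 1) / (k + 1) = 2 * k / (k + 1) := by field_simp; ring
    rw [e1, e2, div_mul_eq_mul_div, div_mul_eq_mul_div, div_le_div_iff_of_pos_right hk1] at this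
    linarith
  · intro ρ' hρ'
    filter_upwards [hd _ (comp ρ' hρ').2 (comp ρ' hρ').1] with m hm t ht
    have ht' : t ∈ ball (0 : ℂ) 1 := ball_subset_ball hρ'.le ht
    have := (hm _ ⟨t, ball_subset_closedBall ht, rfl⟩).1
    exact (this.comp t ((mob_diff p).differentiableAt (isOpen_ball.mem_nhds ht'))).differentiableWithinAt
  · intro ρ' hρ'
    filter_upwards [hd _ (comp ρ' hρ').2 (comp ρ' hρ').1] with m hm t ht
    exact (hm _ ⟨t, ball_subset_closedBall ht, rfl⟩).2
  · intro t ht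
    exact hu _ (mob_mem hpH ht)

end JS

namespace JS
open Metric ComplexConjugate

structure Fam (d : ℕ → ℕ) (R C C1 : ℝ) (q : ℕ → Polynomial ℂ) (a : ℕ → ℂ) (Y : ℕ → ℂ → ℂ) :
    Prop where
  par : Par d R C
  hC1 : 0 ≤ C1
  diff : ∀ j, Differentiable ℂ (Y j)
  recu : ∀ j ζ, Y (j + 2) ζ = (q (j + 1)).eval (Y (j + 1) ζ) - a (j + 1) * Y j ζ
  adm : ∀ ζ, Adm d R C (fun j => Y j ζ)
  real : ∀ (s : ℝ) (j : ℕ), ‖Y j s‖ ≤ R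
  order : ∀ j, ∃ B : ℝ, ∀ ζ, ‖Y j ζ‖ ≤ Real.exp (B * (1 + ‖ζ‖) ^ (7 / 4 : ℝ))
  hq : ∀ j x, R < ‖x‖ → ‖x * (q j).derivative.eval x - d j * (q j).eval x‖ ≤ C1 * ‖x‖ ^ (d j - 1)
  ha : ∀ j, a j ≠ 0 ∧ ‖a j‖ ≤ C1

section
variable {d : ℕ → ℕ} {R C C1 : ℝ} {q : ℕ → Polynomial ℂ} {a : ℕ → ℂ} {Y : ℕ → ℂ → ℂ}

/-- the Green function -/
def GG (d : ℕ → ℕ) (R : ℝ) (Y : ℕ → ℂ → ℂ) (ζ : ℂ) : ℝ := gr d R (fun j => Y j ζ)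

lemma Fam.unif (F : Fam d R C C1 q a Y) (he : ∀ ζ ∈ HH, ∃ m, R < ‖Y m ζ‖)
    {K : Set ℂ} (hK : K ⊆ HH) (hc : IsCompact K) :
    ∀ᶠ m in atTop, ∀ z ∈ K, R < ‖Y m z‖ := by
  obtain ⟨m₀, hm₀⟩ := unif_escape F.par (Z := Y) isOpen_univ hc (subset_univ _)
    (fun m => (F.diff m).continuous.continuousOn) (fun z _ => F.adm z) (fun z hz => he z (hK hz))
  filter_upwards [eventually_ge_atTop m₀] with m hm
  exact hm₀ m hm

lemma Fam.E3 (F : Fam d R C C1 q a Y) (he : ∀ ζ ∈ HH, ∃ m, R < ‖Y m ζ‖)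
    {x y k : ℝ} (hy : 0 < y) (hk : 1 ≤ k) :
    GG d R Y (x + (k * y : ℝ) * Complex.I) ≤ k * GG d R Y (x + y * Complex.I) := by
  refine harnack_HH (h := Y) F.par.Dg_pos ?_ ?_ hy hk
  · intro K hK hc
    filter_upwards [F.unif he hK hc] with m hm z hz
    have := hm z hz
    have := F.par.R_gt_one
    exact ⟨(F.diff m) z, by linarith⟩
  · intro z hz
    exact (F.adm z).tendsto_log F.par (he z hz)

lemma Fam.norm_le (F : Fam d R C C1 q a Y) (m : ℕ) (ζ : ℂ) :
    ‖Y m ζ‖ ≤ Real.exp (Dg d m * GG d R Y ζ + C + Real.log R) := by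
  have h := (F.adm ζ).bb_le_gr F.par m
  have h2 : 0 < max ‖Y m ζ‖ R := lt_max_of_lt_right F.par.Rpos
  calc ‖Y m ζ‖ ≤ max ‖Y m ζ‖ R := le_max_left _ _
    _ = Real.exp (bb R (fun j => Y j ζ) m) := (Real.exp_log h2).symm
    _ ≤ _ := Real.exp_le_exp.mpr h

lemma Fam.E4 (F : Fam d R C C1 q a Y) (he : ∀ ζ ∈ HH, ∃ m, R < ‖Y m ζ‖) (m : ℕ)
    {ζ : ℂ} (hζ : 0 ≤ ζ.im) :
    ‖Y m ζ‖ ≤ R * Real.exp (Dg d m * GG d R Y Complex.I * ζ.im) := by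
  set c := Dg d m * GG d R Y Complex.I with hc
  have hc0 : 0 ≤ c := mul_nonneg (F.par.Dg_pos m).le ((F.adm _).gr_nonneg F.par)
  have hdiff : Differentiable ℂ (fun z : ℂ => Y m (Complex.I * z) * Complex.exp (-c * z)) := by
    have := F.diff m
    fun_prop
  have hexpn : ∀ z : ℂ, ‖Complex.exp (-c * z)‖ = Real.exp (-(c * z.re)) := by
    intro z; rw [Complex.norm_exp]; simp
  obtain ⟨B, hB⟩ := F.order m
  have key := PhragmenLindelof.right_half_plane_of_bounded_on_real (C := R)
    (f := fun z : ℂ => Y m (Complex.I * z) * Complex.exp (-c * z)) (z := -Complex.I * ζ)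
    hdiff.diffContOnCl ⟨15 / 8, by norm_num, |B| * 4, ?_⟩ ?_ ?_ (by simpa using hζ)
  · have e1 : Complex.I * (-Complex.I * ζ) = ζ := by
      rw [← mul_assoc]; simp
    simp only [norm_mul, hexpn, e1] at key
    have e2 : (-Complex.I * ζ).re = ζ.im := by simp
    rw [e2, Real.exp_neg] at key
    rwa [← div_eq_mul_inv, div_le_iff₀ (Real.exp_pos _)] at key
  · -- growth
    have ev : ∀ᶠ z : ℂ in Bornology.cobounded ℂ ⊓ 𝓟 {z | 0 < z.re}, 1 ≤ ‖z‖ ∧ 0 < z.re :=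
      ((tendsto_norm_cobounded_atTop.eventually_ge_atTop 1).filter_mono inf_le_left).and
        (mem_inf_of_right (mem_principal_self _))
    refine Asymptotics.IsBigO.of_bound 1 ?_
    filter_upwards [ev] with z hz
    rw [norm_mul, hexpn, Real.norm_of_nonneg (Real.exp_pos _).le, one_mul]
    have h1 : Real.exp (-(c * z.re)) ≤ 1 := Real.exp_le_one_iff.mpr (by nlinarith [hz.2])
    have h2 := hB (Complex.I * z)
    rw [norm_mul, Complex.norm_I, one_mul] at h2
    calc _ ≤ Real.exp (B * (1 + ‖z‖) ^ (7 / 4 : ℝ)) * 1 := by gcongr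
      _ ≤ _ := by
        rw [mul_one]
        apply Real.exp_le_exp.mpr
        have h3 : (1 + ‖z‖) ^ (7 / 4 : ℝ) ≤ 4 * ‖z‖ ^ (15 / 8 : ℝ) := by
          calc (1 + ‖z‖) ^ (7 / 4 : ℝ) ≤ (2 * ‖z‖) ^ (7 / 4 : ℝ) := by
                gcongr; linarith [hz.1]
            _ = 2 ^ (7 / 4 : ℝ) * ‖z‖ ^ (7 / 4 : ℝ) := Real.mul_rpow (by norm_num) (norm_nonneg _)
            _ ≤ 2 ^ (2 : ℝ) * ‖z‖ ^ (15 / 8 : ℝ) := by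
                exact mul_le_mul (Real.rpow_le_rpow_of_exponent_le (by norm_num) (by norm_num))
                  (Real.rpow_le_rpow_of_exponent_le hz.1 (by norm_num)) (by positivity)
                  (by positivity)
            _ = _ := by norm_num
        calc B * (1 + ‖z‖) ^ (7 / 4 : ℝ) ≤ |B| * (1 + ‖z‖) ^ (7 / 4 : ℝ) := by
              gcongr; exact le_abs_self B
          _ ≤ |B| * (4 * ‖z‖ ^ (15 / 8 : ℝ)) := by gcongr
          _ = _ := by ring
  · -- bounded on the ray
    refine isBoundedUnder_of_eventually_le (a := Real.exp (C + Real.log R)) ?_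
    filter_upwards [eventually_ge_atTop 1] with y hy
    rw [norm_mul, hexpn]
    have h1 := F.E3 he (x := 0) (y := 1) (k := y) one_pos hy
    simp only [Complex.ofReal_zero, zero_add, mul_one, Complex.ofReal_one, one_mul] at h1
    have h2 := F.norm_le m (Complex.I * y)
    rw [mul_comm Complex.I] at h2 ⊢
    calc _ ≤ _ := mul_le_mul_of_nonneg_right h2 (Real.exp_pos _).le
      _ ≤ _ := by
        rw [← Real.exp_add]
        apply Real.exp_le_exp.mpr
        have := mul_le_mul_of_nonneg_left h1 (F.par.Dg_pos m).le
        have e : c * y = Dg d m * (y * GG d R Y Complex.I) := by rw [hc]; ring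
        simp only [Complex.ofReal_re, e]
        linarith
  · intro y
    rw [norm_mul, hexpn]
    have e : Complex.I * (y * Complex.I) = ((-y : ℝ) : ℂ) := by
      rw [mul_left_comm, Complex.I_mul_I]; push_cast; ring
    rw [e]
    simp
    have := F.real (-y) m
    push_cast at this
    exact this

end
end JS

namespace JS
open Metric ComplexConjugate

section
variable {d : ℕ → ℕ} {R C C1 : ℝ} {q : ℕ → Polynomial ℂ} {a : ℕ → ℂ} {Y : ℕ → ℂ → ℂ}

lemma norm_exp_I (s : ℝ) (z : ℂ) : ‖Complex.exp (-Complex.I * s * z)‖ = Real.exp (s * z.im) := by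
  rw [Complex.norm_exp]; simp

lemma Fam.E6a (F : Fam d R C C1 q a Y) (he : ∀ ζ ∈ HH, ∃ m, R < ‖Y m ζ‖)
    {x y k : ℝ} (hy : 0 < y) (hk : 1 ≤ k) :
    GG d R Y (x + (k * y : ℝ) * Complex.I) = k * GG d R Y (x + y * Complex.I) := by
  refine le_antisymm (F.E3 he hy hk) ?_
  set c := GG d R Y Complex.I with hc
  have hR := F.par.Rpos
  have hR1 := F.par.R_gt_one
  have := harnack_HH (h := fun m ζ => 2 * R * Complex.exp (-Complex.I * (Dg d m * c : ℝ) * ζ) / Y m ζ)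
    (D := Dg d) (u := fun ζ => c * ζ.im - GG d R Y ζ) F.par.Dg_pos ?_ ?_ (x := x) hy hk
  · simp at this
    push_cast
    linarith
  · intro K hK hcK
    filter_upwards [F.unif he hK hcK] with m hm z hz
    have h1 := hm z hz
    have h0 : Y m z ≠ 0 := by
      intro h; rw [h, norm_zero] at h1; linarith
    refine ⟨?_, ?_⟩
    · have := (F.diff m) z
      fun_prop (disch := assumption)
    · have h2 := F.E4 he m (le_of_lt (hK hz))
      rw [norm_div, norm_mul, norm_exp_I, norm_mul, Complex.norm_real, Real.norm_of_nonneg hR.le,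
        lt_div_iff₀ (by linarith)]
      have h3 := Real.exp_pos (Dg d m * c * z.im)
      simp
      nlinarith
  · intro z hz
    have h1 := (F.adm z).tendsto_log F.par (he z hz)
    have h3 : Tendsto (fun m => Real.log (2 * R) / Dg d m) atTop (𝓝 0) :=
      F.par.Dg_tendsto.const_div_atTop _
    have h4 := (h3.add_const (c * z.im)).sub h1
    rw [zero_add] at h4
    refine h4.congr' ?_
    obtain ⟨m₀, hm₀⟩ := he z hz
    filter_upwards [eventually_ge_atTop m₀] with m hm
    have h5 := (F.adm z).esc_mono F.par hm hm₀
    have h6 := F.par.Dg_pos m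
    have h7 : 0 < ‖Y m z‖ := by linarith
    rw [norm_div, norm_mul, norm_exp_I, norm_mul, Complex.norm_real, Real.norm_of_nonneg hR.le,
      Real.log_div (by simp [hR.ne']) h7.ne', Real.log_mul (by simp [hR.ne']) (Real.exp_pos _).ne',
      Real.log_exp]
    simp
    field_simp

lemma Fam.E6 (F : Fam d R C C1 q a Y) (he : ∀ ζ ∈ HH, ∃ m, R < ‖Y m ζ‖) :
    ∀ ζ ∈ HH, GG d R Y ζ = GG d R Y Complex.I * ζ.im := by
  set g : ℝ → ℝ := fun x => GG d R Y (x + Complex.I) with hg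
  have h1 : ∀ x y : ℝ, 0 < y → GG d R Y (x + y * Complex.I) = y * g x := by
    intro x y hy
    by_cases h : 1 ≤ y
    · have := F.E6a he (x := x) one_pos h
      simpa using this
    · have := F.E6a he (x := x) hy (k := 1 / y) (by rw [le_div_iff₀ hy]; linarith)
      rw [one_div_mul_cancel hy.ne'] at this
      simp only [Complex.ofReal_one, one_mul] at this
      rw [hg]; simp only
      rw [this]
      field_simp
  have h2 : ∀ x x' : ℝ, g x' ≤ g x := by
    intro x x'
    set s := |x' - x|
    have hs : 0 ≤ s := abs_nonneg _
    have ev : ∀ᶠ y : ℝ in atTop, (1 - s / y) * g x' ≤ (1 + s / y) * g x := by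
      filter_upwards [eventually_gt_atTop s] with y hy
      have hy0 : 0 < y := hs.trans_lt hy
      have hb : ball ((x : ℂ) + y * Complex.I) y ⊆ HH := by
        intro z hz
        have h3 : |(z - (x + y * Complex.I)).im| ≤ dist z (x + y * Complex.I) := by
          rw [Complex.dist_eq]; exact Complex.abs_im_le_norm _
        rw [mem_ball] at hz
        have h4 := abs_lt.mp (h3.trans_lt hz)
        simp at h4
        exact h4.1
      have hd : dist ((x' : ℂ) + y * Complex.I) ((x : ℂ) + y * Complex.I) = s := by
        rw [Complex.dist_eq, add_sub_add_right_eq_sub, ← Complex.ofReal_sub, Complex.norm_real,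
          Real.norm_eq_abs]
      have := (harnack_adm F.par (Z := Y) (c := (x : ℂ) + y * Complex.I) (ρ := y)
        (fun m => (F.diff m).differentiableOn) (fun z _ => F.adm z) (fun z hz => he z (hb hz))
        (w := (x' : ℂ) + y * Complex.I) (by rw [mem_ball, hd]; exact hy)).1
      rw [hd] at this
      change (y - s) * GG d R Y _ ≤ (y + s) * GG d R Y _ at this
      rw [h1 _ _ hy0, h1 _ _ hy0] at this
      have e1 : 1 - s / y = (y - s) / y := by field_simp
      have e2 : 1 + s / y = (y + s) / y := by field_simp
      rw [e1, e2, div_mul_eq_mul_div, div_mul_eq_mul_div, div_le_div_iff_of_pos_right hy0]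
      nlinarith
    have t0 : Tendsto (fun y : ℝ => s / y) atTop (𝓝 0) := tendsto_id.const_div_atTop s
    have t1 : Tendsto (fun y : ℝ => (1 - s / y) * g x') atTop (𝓝 ((1 - 0) * g x')) :=
      (t0.const_sub 1).mul_const _
    have t2 : Tendsto (fun y : ℝ => (1 + s / y) * g x) atTop (𝓝 ((1 + 0) * g x)) :=
      (t0.const_add 1).mul_const _
    have := le_of_tendsto_of_tendsto t1 t2 ev
    linarith
  intro ζ hζ
  have h3 := h1 ζ.re ζ.im hζ
  rw [Complex.re_add_im] at h3
  have h4 : g ζ.re = g 0 := le_antisymm (h2 _ _) (h2 _ _)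
  rw [h3, h4, hg]
  simp [mul_comm]

/-- E7a: the basic estimates on a high half plane -/
lemma Fam.E7a (F : Fam d R C C1 q a Y) (he : ∀ ζ ∈ HH, ∃ m, R < ‖Y m ζ‖) :
    ∃ c L : ℝ, 0 < c ∧ 0 < L ∧ (∀ (j : ℕ) (ζ : ℂ), 0 ≤ ζ.im → ‖Y j ζ‖ ≤ R * Real.exp (Dg d j * c * ζ.im)) ∧
      (∀ (j : ℕ) (ζ : ℂ), L ≤ ζ.im → R < ‖Y j ζ‖ ∧ Dg d j * c * ζ.im - C ≤ Real.log ‖Y j ζ‖ ∧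
        ‖deriv (Y j) ζ / Y j ζ + Complex.I * (Dg d j * c : ℝ)‖ ≤ 4 * C + 2) := by
  set c := GG d R Y Complex.I with hc
  have hIH : Complex.I ∈ HH := by simp [HH]
  have hG := F.E6 he
  have hc0 : 0 < c := by
    obtain ⟨m, hm⟩ := he Complex.I hIH
    exact (F.adm _).gr_pos F.par hm
  have hD1 : ∀ j, 1 ≤ Dg d j := fun j => (one_le_pow₀ (by norm_num)).trans (F.par.Dg_ge j)
  have hC := F.par.hC
  have hlR : 0 < Real.log R := by have := F.par.logR; linarith
  set L0 := (Real.log R + C + 1) / c with hL0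
  have hL0p : 0 < L0 := by positivity
  have hR1 := F.par.R_gt_one
  have est : ∀ (j : ℕ) (ζ : ℂ), L0 ≤ ζ.im → R < ‖Y j ζ‖ ∧ Dg d j * c * ζ.im - C ≤ Real.log ‖Y j ζ‖ ∧
      Real.log ‖Y j ζ‖ ≤ Dg d j * c * ζ.im + C := by
    intro j ζ hζ
    have h1 := (F.adm ζ).gr_le F.par j
    have h2 : gr d R (fun j => Y j ζ) = c * ζ.im := hG ζ (hL0p.trans_le hζ)
    rw [h2] at h1
    have h3 : Real.log R + C + 1 ≤ c * ζ.im := by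
      rw [hL0, div_le_iff₀ hc0] at hζ; linarith
    have h4 : c * ζ.im ≤ Dg d j * (c * ζ.im) := by
      have := hD1 j
      nlinarith
    have h5 : R < ‖Y j ζ‖ := by
      by_contra h
      rw [bb, max_eq_right (not_lt.mp h)] at h1
      linarith
    have h6 := (F.adm ζ).le_gr F.par h5
    rw [h2] at h6
    rw [bb_of_esc h5] at h1
    refine ⟨h5, by linarith, by linarith⟩
  refine ⟨c, L0 + 1, hc0, by linarith, fun j ζ h => F.E4 he j h, fun j ζ hζ => ?_⟩
  obtain ⟨e1, e2, -⟩ := est j ζ (by linarith)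
  refine ⟨e1, e2, ?_⟩
  set μ : ℝ := Dg d j * c with hμ
  set h : ℂ → ℂ := fun z => Real.exp (C + 1) * Y j z * Complex.exp (Complex.I * μ * z) with hh
  have hn : ∀ z, ‖h z‖ = Real.exp (C + 1) * ‖Y j z‖ * Real.exp (-(μ * z.im)) := by
    intro z
    rw [hh]; simp only
    rw [norm_mul, norm_mul, Complex.norm_real, Real.norm_of_nonneg (Real.exp_pos _).le,
      Complex.norm_exp]
    simp
  have hlog : ∀ z, L0 ≤ z.im → Real.log ‖h z‖ = C + 1 + Real.log ‖Y j z‖ - μ * z.im := by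
    intro z hz
    have h5 := (est j z hz).1
    have : ‖Y j z‖ ≠ 0 := by linarith
    rw [hn, Real.log_mul (by positivity) (Real.exp_pos _).ne', Real.log_mul (Real.exp_pos _).ne' this,
      Real.log_exp, Real.log_exp]
    ring
  have hball : ∀ z ∈ ball ζ 1, L0 ≤ z.im := by
    intro z hz
    have h3 : |(z - ζ).im| ≤ dist z ζ := by
      rw [Complex.dist_eq]; exact Complex.abs_im_le_norm _
    rw [mem_ball] at hz
    have h4 := abs_lt.mp (h3.trans_lt hz)
    simp at h4
    linarith [h4.1]
  have hYd := F.diff j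
  have hdiff : Differentiable ℂ h := by
    rw [hh]; fun_prop
  have hS := (schwarz_core (h := h) (c := ζ) one_pos hdiff.differentiableOn ?_).2
  · rw [hlog ζ (by linarith)] at hS
    have hY0 : Y j ζ ≠ 0 := by
      intro h0; rw [h0, norm_zero] at e1; linarith
    have hder : deriv h ζ = Real.exp (C + 1) * deriv (Y j) ζ * Complex.exp (Complex.I * μ * ζ) +
        Real.exp (C + 1) * Y j ζ * (Complex.exp (Complex.I * μ * ζ) * (Complex.I * μ)) := by
      have d1 : HasDerivAt (Y j) (deriv (Y j) ζ) ζ := (hYd ζ).hasDerivAt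
      have d2 : HasDerivAt (fun z : ℂ => Complex.I * μ * z) (Complex.I * μ) ζ := by
        simpa using (hasDerivAt_id ζ).const_mul (Complex.I * (μ : ℂ))
      exact ((d1.const_mul _).mul d2.cexp).deriv
    have hq : deriv h ζ / h ζ = deriv (Y j) ζ / Y j ζ + Complex.I * μ := by
      rw [hder, hh]
      have := Complex.exp_ne_zero (Complex.I * μ * ζ)
      have h3 : (Real.exp (C + 1) : ℂ) ≠ 0 := by exact_mod_cast (Real.exp_pos _).ne'
      field_simp
    rw [hq] at hS
    have := (est j ζ (by linarith)).2.2
    linarith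
  · intro z hz
    have h1 := hlog z (hball z hz)
    have h2 := (est j z (hball z hz)).2.1
    have h3 : 0 < Real.log ‖h z‖ := by rw [h1]; linarith
    by_contra h4
    exact absurd (Real.log_nonpos (norm_nonneg _) (not_lt.mp h4)) (not_le.mpr h3)

/-- E7: boundedness of W -/
lemma Fam.E7 (F : Fam d R C C1 q a Y) (he : ∀ ζ ∈ HH, ∃ m, R < ‖Y m ζ‖) :
    ∃ c L : ℝ, 0 < c ∧ 0 < L ∧ (∀ (j : ℕ) (ζ : ℂ), 0 ≤ ζ.im → ‖Y j ζ‖ ≤ R * Real.exp (Dg d j * c * ζ.im)) ∧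
      (∀ (j : ℕ) (ζ : ℂ), L ≤ ζ.im → R < ‖Y j ζ‖ ∧ Dg d j * c * ζ.im - C ≤ Real.log ‖Y j ζ‖) ∧
      (∀ j ≥ 1, ∃ B, ∀ ζ : ℂ, L ≤ ζ.im → ‖deriv (Y j) ζ + Complex.I * (Dg d j * c : ℝ) * Y j ζ‖ ≤ B) := by
  obtain ⟨c, L, hc, hL, h1, h2⟩ := F.E7a he
  refine ⟨c, L, hc, hL, h1, fun j ζ h => ⟨(h2 j ζ h).1, (h2 j ζ h).2.1⟩, ?_⟩
  have hC := F.par.hC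
  have hC1 := F.hC1
  set M : ℝ := 4 * C + 2 with hM
  have hM0 : 0 ≤ M := by positivity
  set M2 : ℝ := Real.exp C * C1 * (c + M) * 3 with hM2
  have hM20 : 0 ≤ M2 := by positivity
  have hD1 : ∀ j, 1 ≤ Dg d j := fun j => (one_le_pow₀ (by norm_num)).trans (F.par.Dg_ge j)
  suffices H : ∀ (ζ : ℂ), L ≤ ζ.im → ∀ j ≥ 1,
      ‖deriv (Y j) ζ / Y j ζ + Complex.I * (Dg d j * c : ℝ)‖ / Dg d j ≤ 2 * M2 / ‖Y j ζ‖ by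
    intro j hj
    refine ⟨2 * M2 * Dg d j, fun ζ hζ => ?_⟩
    have h3 := H ζ hζ j hj
    have h4 : 0 < ‖Y j ζ‖ := F.par.Rpos.trans (h2 j ζ hζ).1
    have h5 : Y j ζ ≠ 0 := norm_pos_iff.mp h4
    have h6 := hD1 j
    rw [div_le_div_iff₀ (by linarith) h4] at h3
    calc _ = ‖(deriv (Y j) ζ / Y j ζ + Complex.I * (Dg d j * c : ℝ)) * Y j ζ‖ := by
          congr 1; field_simp
      _ ≤ _ := by rw [norm_mul]; exact h3
  intro ζ hζ
  set y : ℕ → ℂ := fun j => Y j ζ with hy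
  set θ : ℕ → ℂ := fun j => deriv (Y j) ζ / Y j ζ with hθ
  set φ : ℕ → ℂ := fun j => (θ j + Complex.I * (Dg d j * c : ℝ)) / Dg d j with hφ
  have hRy : ∀ j, R < ‖y j‖ := fun j => (h2 j ζ hζ).1
  have hR1 := F.par.R_gt_one
  have hy0 : ∀ j, y j ≠ 0 := fun j => by
    have := hRy j
    intro h; rw [h, norm_zero] at this; linarith
  have hθM : ∀ j, ‖θ j‖ ≤ (c + M) * Dg d j := by
    intro j
    have e1 := (h2 j ζ hζ).2.2
    have e2 := norm_sub_le (θ j + Complex.I * (Dg d j * c : ℝ)) (Complex.I * (Dg d j * c : ℝ))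
    rw [add_sub_cancel_right, norm_mul, Complex.norm_I, one_mul, Complex.norm_real,
      Real.norm_of_nonneg (mul_nonneg (by linarith [hD1 j]) hc.le)] at e2
    have e3 := hD1 j
    nlinarith
  have hdoub : ∀ j, 2 * ‖y j‖ ≤ ‖y (j + 1)‖ := fun j => (F.adm ζ).double F.par (hRy j)
  have step : ∀ j ≥ 1, ‖φ (j + 1) - φ j‖ ≤ M2 / ‖y j‖ := by
    intro j hj
    obtain ⟨i, rfl⟩ : ∃ i, j = i + 1 := ⟨j - 1, by omega⟩
    have hder : deriv (Y (i + 2)) ζ = (q (i + 1)).derivative.eval (y (i + 1)) * deriv (Y (i + 1)) ζ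
        - a (i + 1) * deriv (Y i) ζ := by
      have e0 : Y (i + 2) = fun z => (q (i + 1)).eval (Y (i + 1) z) - a (i + 1) * Y i z :=
        funext fun z => F.recu i z
      rw [e0]
      have d1 : HasDerivAt (Y (i + 1)) (deriv (Y (i + 1)) ζ) ζ := (F.diff _ ζ).hasDerivAt
      have d2 : HasDerivAt (Y i) (deriv (Y i) ζ) ζ := (F.diff _ ζ).hasDerivAt
      have d3 := ((q (i + 1)).hasDerivAt (Y (i + 1) ζ)).comp ζ d1
      exact (d3.sub (d2.const_mul (a (i + 1)))).deriv
    have hθe : ∀ j, deriv (Y j) ζ = θ j * y j := fun j => (div_mul_cancel₀ _ (hy0 j)).symm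
    rw [hθe, hθe, hθe] at hder
    have hrec : y (i + 2) = (q (i + 1)).eval (y (i + 1)) - a (i + 1) * y i := F.recu i ζ
    set D := (d (i + 1) : ℂ) with hD
    set x := y (i + 1) with hx
    have key : (θ (i + 2) - D * θ (i + 1)) * y (i + 2) =
        (x * (q (i + 1)).derivative.eval x - D * (q (i + 1)).eval x) * θ (i + 1)
        + D * a (i + 1) * y i * θ (i + 1) - a (i + 1) * θ i * y i := by
      have : D * θ (i + 1) * y (i + 2) = D * θ (i + 1) * ((q (i + 1)).eval x - a (i + 1) * y i) := by
        rw [hrec]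
      rw [sub_mul, hder, this]
      ring
    have hdd : 2 ≤ d (i + 1) := F.par.hd _
    have hx1 : 1 ≤ ‖x‖ := by linarith [hRy (i + 1)]
    set P := ‖x‖ ^ (d (i + 1) - 1) with hP
    have hyP : ‖y i‖ ≤ P := by
      have := hdoub i
      have h4 : ‖x‖ ≤ P := le_self_pow₀ hx1 (by omega)
      have := norm_nonneg (y i)
      linarith
    have hPp : P * ‖x‖ = ‖x‖ ^ d (i + 1) := by
      rw [hP, ← pow_succ]; congr 1; omega
    have hlow : Real.exp (-C) * (P * ‖x‖) ≤ ‖y (i + 2)‖ := by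
      rw [hPp]; exact (F.adm ζ).low (i + 1) (hRy (i + 1))
    have hDs : Dg d (i + 2) = Dg d (i + 1) * d (i + 1) := Dg_succ d (i + 1)
    have hDs' : Dg d (i + 1) = Dg d i * d i := Dg_succ d i
    have h2d : (2 : ℝ) ≤ d (i + 1) := F.par.two_le _
    have h2d' : (2 : ℝ) ≤ d i := F.par.two_le _
    have hDi := hD1 i
    have hDi1 := hD1 (i + 1)
    have hDi2 := hD1 (i + 2)
    have hP0 : 0 < P := by positivity
    have hb := norm_add_le ((x * (q (i + 1)).derivative.eval x - D * (q (i + 1)).eval x) * θ (i + 1))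
      (D * a (i + 1) * y i * θ (i + 1))
    have hb2 := norm_sub_le ((x * (q (i + 1)).derivative.eval x - D * (q (i + 1)).eval x) * θ (i + 1)
      + D * a (i + 1) * y i * θ (i + 1)) (a (i + 1) * θ i * y i)
    rw [← key] at hb2
    have t1 : ‖(x * (q (i + 1)).derivative.eval x - D * (q (i + 1)).eval x) * θ (i + 1)‖ ≤
        C1 * P * ((c + M) * Dg d (i + 1)) := by
      rw [norm_mul]
      exact mul_le_mul (F.hq _ _ (hRy _)) (hθM _) (norm_nonneg _) (by positivity)
    have t2 : ‖D * a (i + 1) * y i * θ (i + 1)‖ ≤ d (i + 1) * C1 * P * ((c + M) * Dg d (i + 1)) := by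
      rw [norm_mul, norm_mul, norm_mul]
      have : ‖D‖ = d (i + 1) := by simp [hD]
      rw [this]
      have := (F.ha (i + 1)).2
      have := hθM (i + 1)
      gcongr
    have t3 : ‖a (i + 1) * θ i * y i‖ ≤ C1 * ((c + M) * Dg d i) * P := by
      rw [norm_mul, norm_mul]
      have := (F.ha (i + 1)).2
      have := hθM i
      gcongr
    have tot : ‖(θ (i + 2) - D * θ (i + 1))‖ * ‖y (i + 2)‖ ≤ C1 * (c + M) * 3 * Dg d (i + 2) * P := by
      rw [← norm_mul]
      have e : Dg d (i + 1) + d (i + 1) * Dg d (i + 1) + Dg d i ≤ 3 * Dg d (i + 2) := by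
        rw [hDs]; nlinarith
      calc _ ≤ C1 * P * ((c + M) * Dg d (i + 1)) + d (i + 1) * C1 * P * ((c + M) * Dg d (i + 1))
            + C1 * ((c + M) * Dg d i) * P := by linarith
        _ = C1 * (c + M) * P * (Dg d (i + 1) + d (i + 1) * Dg d (i + 1) + Dg d i) := by ring
        _ ≤ C1 * (c + M) * P * (3 * Dg d (i + 2)) := by gcongr
        _ = _ := by ring
    have fin : ‖(θ (i + 2) - D * θ (i + 1))‖ * ‖x‖ ≤ M2 * Dg d (i + 2) := by
      have e1 : ‖(θ (i + 2) - D * θ (i + 1))‖ * (Real.exp (-C) * (P * ‖x‖)) ≤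
        C1 * (c + M) * 3 * Dg d (i + 2) * P := le_trans (by gcongr) tot
      have e2 : (‖(θ (i + 2) - D * θ (i + 1))‖ * ‖x‖ * Real.exp (-C)) * P ≤
        (C1 * (c + M) * 3 * Dg d (i + 2)) * P := by linarith
      have e3 := le_of_mul_le_mul_right e2 hP0
      rw [Real.exp_neg, ← div_eq_mul_inv, div_le_iff₀ (Real.exp_pos _)] at e3
      rw [hM2]; linarith
    have hφe : φ (i + 1 + 1) - φ (i + 1) = (θ (i + 2) - D * θ (i + 1)) / Dg d (i + 2) := by
      have z1 : (Dg d (i + 1) : ℂ) ≠ 0 := by exact_mod_cast (by linarith : Dg d (i + 1) ≠ 0)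
      have z2 : (d (i + 1) : ℂ) ≠ 0 := by
        have : d (i + 1) ≠ 0 := by omega
        exact_mod_cast this
      simp only [hφ, hD]
      rw [show i + 1 + 1 = i + 2 from rfl, hDs]
      push_cast
      field_simp
      ring
    rw [hφe, norm_div, Complex.norm_real, Real.norm_of_nonneg (by linarith),
      div_le_div_iff₀ (by linarith) (by linarith)]
    exact fin
  have hφM : ∀ j, ‖φ j‖ ≤ M / Dg d j := by
    intro j
    have e1 := (h2 j ζ hζ).2.2
    have := hD1 j
    simp only [hφ]
    rw [norm_div, Complex.norm_real, Real.norm_of_nonneg (by linarith)]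
    gcongr
  have mono : ∀ j ≥ 1, ∀ n ≥ j, ‖φ j‖ - 2 * M2 / ‖y j‖ ≤ ‖φ n‖ - 2 * M2 / ‖y n‖ := by
    intro j hj n hn
    induction n, hn using Nat.le_induction with
    | base => exact le_rfl
    | succ n hn ih =>
      refine ih.trans ?_
      have s := step n (by omega)
      have s2 := norm_sub_norm_le (φ n) (φ (n + 1))
      rw [norm_sub_rev] at s2
      have hp : 0 < ‖y n‖ := by linarith [hRy n]
      have s3 : 2 * M2 / ‖y (n + 1)‖ ≤ M2 / ‖y n‖ := by
        rw [div_le_div_iff₀ (by linarith [hRy (n + 1)]) hp]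
        nlinarith [hdoub n]
      have s4 : 2 * M2 / ‖y n‖ = M2 / ‖y n‖ + M2 / ‖y n‖ := by ring
      linarith
  intro j hj
  have t : Tendsto (fun n => M / Dg d n) atTop (𝓝 0) := F.par.Dg_tendsto.const_div_atTop _
  have h9 : ‖φ j‖ - 2 * M2 / ‖y j‖ ≤ 0 := by
    refine ge_of_tendsto t ?_
    filter_upwards [eventually_ge_atTop j] with n hn
    have := mono j hj n hn
    have := hφM n
    have : 0 ≤ 2 * M2 / ‖y n‖ := by positivity
    linarith
  have h10 : ‖φ j‖ = ‖deriv (Y j) ζ / Y j ζ + Complex.I * (Dg d j * c : ℝ)‖ / Dg d j := by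
    simp only [hφ]
    rw [norm_div, Complex.norm_real, Real.norm_of_nonneg (by linarith [hD1 j])]
  rw [← h10]
  linarith

end
end JS

namespace JS
open Metric ComplexConjugate

lemma deriv_bd {g : ℂ → ℂ} (hg : Differentiable ℂ g) {B : ℝ} {ζ : ℂ}
    (hB : ∀ z : ℂ, |z.im - ζ.im| ≤ 1 → ‖g z‖ ≤ B) : ‖deriv g ζ‖ ≤ B := by
  have := Complex.norm_deriv_le_of_forall_mem_sphere_norm_le (c := ζ) (R := 1) (C := B) (f := g)
    one_pos hg.diffContOnCl (fun z hz => hB z (by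
      have h1 : |(z - ζ).im| ≤ ‖z - ζ‖ := Complex.abs_im_le_norm _
      rw [mem_sphere, Complex.dist_eq] at hz
      rwa [hz, Complex.sub_im] at h1))
  simpa using this

lemma ode1 {g : ℂ → ℂ} (hg : Differentiable ℂ g) {k : ℂ} (h : ∀ ζ, deriv g ζ = k * g ζ) :
    ∀ ζ, g ζ = g 0 * Complex.exp (k * ζ) := by
  have h1 : ∀ ζ, HasDerivAt (fun z => g z * Complex.exp (-k * z)) 0 ζ := by
    intro ζ
    have d1 : HasDerivAt g (deriv g ζ) ζ := (hg ζ).hasDerivAt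
    have d2 : HasDerivAt (fun z : ℂ => -k * z) (-k) ζ := by
      simpa using (hasDerivAt_id ζ).const_mul (-k)
    refine (d1.mul d2.cexp).congr_deriv ?_
    rw [h]; ring
  have h2 := is_const_of_deriv_eq_zero (fun z => (h1 z).differentiableAt) (fun z => (h1 z).deriv)
  intro ζ
  have h3 := h2 ζ 0
  simp only [mul_zero, Complex.exp_zero, mul_one] at h3
  rw [← h3, mul_assoc, ← Complex.exp_add]
  simp

lemma liouville_form {Y : ℂ → ℂ} (hY : Differentiable ℂ Y) {l m L : ℝ} (hl : 0 < l) (hm : 0 < m)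
    (b1 : ∀ T : ℝ, ∃ B, ∀ ζ : ℂ, |ζ.im| ≤ T → ‖Y ζ‖ ≤ B)
    (b2 : ∃ B, ∀ ζ : ℂ, L ≤ ζ.im → ‖deriv Y ζ + Complex.I * l * Y ζ‖ ≤ B)
    (b3 : ∃ B, ∀ ζ : ℂ, ζ.im ≤ -L → ‖deriv Y ζ - Complex.I * m * Y ζ‖ ≤ B) :
    ∃ A K B : ℂ, ∀ ζ, Y ζ = A * Complex.exp (Complex.I * (-l : ℝ) * ζ) + K +
      B * Complex.exp (Complex.I * m * ζ) := by
  have hY' : Differentiable ℂ (deriv Y) := fun z =>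
    ((hY.differentiableOn (s := univ)).deriv isOpen_univ).differentiableAt univ_mem
  set W : ℂ → ℂ := fun ζ => deriv Y ζ + Complex.I * l * Y ζ with hW
  set U : ℂ → ℂ := fun ζ => deriv Y ζ - Complex.I * m * Y ζ with hU
  have hWd : Differentiable ℂ W := by fun_prop
  have hUd : Differentiable ℂ U := by fun_prop
  have hW' : ∀ ζ, deriv W ζ = deriv (deriv Y) ζ + Complex.I * l * deriv Y ζ := fun ζ =>
    ((hY' ζ).hasDerivAt.add ((hY ζ).hasDerivAt.const_mul _)).deriv
  have hU' : ∀ ζ, deriv U ζ = deriv (deriv Y) ζ - Complex.I * m * deriv Y ζ := fun ζ =>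
    ((hY' ζ).hasDerivAt.sub ((hY ζ).hasDerivAt.const_mul _)).deriv
  set V : ℂ → ℂ := fun ζ => deriv W ζ - Complex.I * m * W ζ with hV
  have hVU : ∀ ζ, V ζ = deriv U ζ + Complex.I * l * U ζ := by
    intro ζ
    change deriv W ζ - Complex.I * m * (deriv Y ζ + Complex.I * l * Y ζ) =
      deriv U ζ + Complex.I * l * (deriv Y ζ - Complex.I * m * Y ζ)
    rw [hW', hU']
    ring
  have hWd' : Differentiable ℂ (deriv W) := fun z =>
    ((hWd.differentiableOn (s := univ)).deriv isOpen_univ).differentiableAt univ_mem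
  have hVd : Differentiable ℂ V := by fun_prop
  obtain ⟨B2, hB2⟩ := b2
  obtain ⟨B3, hB3⟩ := b3
  obtain ⟨B1, hB1⟩ := b1 (|L| + 3)
  have nI : ∀ (s : ℝ) (z : ℂ), 0 < s → ‖Complex.I * s * z‖ = s * ‖z‖ := by
    intro s z hs
    rw [norm_mul, norm_mul, Complex.norm_I, Complex.norm_real, Real.norm_of_nonneg hs.le, one_mul]
  have c1 : ∀ ζ : ℂ, |ζ.im| ≤ |L| + 2 → ‖deriv Y ζ‖ ≤ B1 := fun ζ hζ =>
    deriv_bd hY fun z hz => hB1 z (by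
      have := abs_sub_abs_le_abs_sub z.im ζ.im; linarith)
  have c2 : ∀ ζ : ℂ, |ζ.im| ≤ |L| + 2 → ‖W ζ‖ ≤ B1 + l * B1 := fun ζ hζ => by
    refine (norm_add_le _ _).trans ?_
    rw [nI _ _ hl]
    have := c1 ζ hζ
    have := hB1 ζ (by linarith)
    gcongr
  have c3 : ∀ ζ : ℂ, |ζ.im| ≤ |L| + 1 → ‖deriv W ζ‖ ≤ B1 + l * B1 := fun ζ hζ =>
    deriv_bd hWd fun z hz => c2 z (by
      have := abs_sub_abs_le_abs_sub z.im ζ.im; linarith)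
  have hB1n : 0 ≤ B1 := (norm_nonneg _).trans (hB1 0 (by simp; positivity))
  have hB2n : 0 ≤ B2 := (norm_nonneg _).trans (hB2 (L * Complex.I) (by simp))
  have hB3n : 0 ≤ B3 := (norm_nonneg _).trans (hB3 (-L * Complex.I) (by simp))
  have hVb : ∀ ζ, ‖V ζ‖ ≤ (B1 + l * B1 + m * (B1 + l * B1)) + (B2 + m * B2) + (B3 + l * B3) := by
    intro ζ
    have p1 : 0 ≤ B1 + l * B1 + m * (B1 + l * B1) := by positivity
    have p2 : 0 ≤ B2 + m * B2 := by positivity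
    have p3 : 0 ≤ B3 + l * B3 := by positivity
    by_cases h1 : L + 1 ≤ ζ.im
    · have e1 : ‖deriv W ζ‖ ≤ B2 := deriv_bd hWd fun z hz => hB2 z (by
        have := abs_le.mp hz; linarith [this.1])
      have e2 : ‖V ζ‖ ≤ B2 + m * B2 := by
        refine (norm_sub_le _ _).trans ?_
        rw [nI _ _ hm]
        have := hB2 ζ (by linarith)
        gcongr
      linarith
    · by_cases h2 : ζ.im ≤ -(L + 1)
      · have e1 : ‖deriv U ζ‖ ≤ B3 := deriv_bd hUd fun z hz => hB3 z (by
          have := abs_le.mp hz; linarith [this.2])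
        have e2 : ‖V ζ‖ ≤ B3 + l * B3 := by
          rw [hVU]
          refine (norm_add_le _ _).trans ?_
          rw [nI _ _ hl]
          have := hB3 ζ (by linarith)
          gcongr
        linarith
      · have h3 : |ζ.im| ≤ |L| + 1 := by
          have := le_abs_self L
          rw [abs_le]; constructor <;> linarith
        have e2 : ‖V ζ‖ ≤ B1 + l * B1 + m * (B1 + l * B1) := by
          refine (norm_sub_le _ _).trans ?_
          rw [nI _ _ hm]
          have := c3 ζ h3
          have := c2 ζ (by linarith)
          gcongr
        linarith
  have hconst : ∀ ζ, V ζ = V 0 := fun ζ =>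
    hVd.apply_eq_apply_of_bounded (isBounded_iff_forall_norm_le.mpr
      ⟨_, by rintro _ ⟨z, rfl⟩; exact hVb z⟩) ζ 0
  have hl0 : (l : ℂ) ≠ 0 := by exact_mod_cast hl.ne'
  have hm0 : (m : ℂ) ≠ 0 := by exact_mod_cast hm.ne'
  have hlm0 : (l : ℂ) + m ≠ 0 := by exact_mod_cast (by linarith : l + m ≠ 0)
  set K := V 0 / (l * m) with hK
  have hKV : V 0 = l * m * K := by rw [hK]; field_simp
  have o1 := ode1 (g := fun ζ => W ζ - Complex.I * l * K) (by fun_prop) (k := Complex.I * m) (by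
    intro ζ
    have : deriv (fun ζ => W ζ - Complex.I * l * K) ζ = deriv W ζ := by simp
    rw [this]
    have h1 := hconst ζ
    rw [hKV] at h1
    simp only [hV] at h1
    have h2 : deriv W ζ = Complex.I * m * W ζ + l * m * K := by rw [← h1]; ring
    rw [h2]
    linear_combination ((m * l * K : ℂ)) * Complex.I_sq)
  have o2 := ode1 (g := fun ζ => U ζ + Complex.I * m * K) (by fun_prop) (k := Complex.I * (-l : ℝ)) (by
    intro ζ
    have : deriv (fun ζ => U ζ + Complex.I * m * K) ζ = deriv U ζ := by simp
    rw [this]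
    have h1 := hconst ζ
    rw [hKV, hVU] at h1
    have h2 : deriv U ζ = -(Complex.I * l * U ζ) + l * m * K := by rw [← h1]; ring
    rw [h2]
    push_cast
    linear_combination ((m * l * K : ℂ)) * Complex.I_sq)
  refine ⟨-(U 0 + Complex.I * m * K) / (Complex.I * (l + m)), K,
    (W 0 - Complex.I * l * K) / (Complex.I * (l + m)), fun ζ => ?_⟩
  have h1 := o1 ζ
  have h2 := o2 ζ
  have h3 : W ζ - U ζ = Complex.I * (l + m) * Y ζ := by simp only [hW, hU]; ring
  have hI := Complex.I_ne_zero
  have h4 : Y ζ = (W ζ - U ζ) / (Complex.I * (l + m)) := by rw [h3]; field_simp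
  have h5 : W ζ = (W 0 - Complex.I * l * K) * Complex.exp (Complex.I * m * ζ) + Complex.I * l * K := by
    rw [← h1]; ring
  have h6 : U ζ = (U 0 + Complex.I * m * K) * Complex.exp (Complex.I * (-l : ℝ) * ζ)
      - Complex.I * m * K := by
    rw [← h2]; ring
  rw [h4, h5, h6]
  field_simp
  ring

/-- characters -/
def chi (s : ℝ) : ℂ → ℂ := fun ζ => Complex.exp (Complex.I * s * ζ)

def chiHom (s : ℝ) : Multiplicative ℂ →* ℂ where
  toFun z := Complex.exp (Complex.I * s * z.toAdd)
  map_one' := by simp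
  map_mul' x y := by simp [mul_add, Complex.exp_add]

lemma chi_inj : Function.Injective chi := by
  intro s t h
  have h1 : HasDerivAt (chi s) (Complex.I * s) 0 := by
    have := ((hasDerivAt_id (0 : ℂ)).const_mul (Complex.I * (s : ℂ))).cexp
    exact this.congr_deriv (by simp)
  have h2 : HasDerivAt (chi t) (Complex.I * t) 0 := by
    have := ((hasDerivAt_id (0 : ℂ)).const_mul (Complex.I * (t : ℂ))).cexp
    exact this.congr_deriv (by simp)
  rw [h] at h1
  have h3 := h1.unique h2
  have := mul_left_cancel₀ Complex.I_ne_zero h3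
  exact_mod_cast this

lemma chi_indep : LinearIndependent ℂ chi := by
  have h := linearIndependent_monoidHom (Multiplicative ℂ) ℂ
  have hinj : Function.Injective chiHom := by
    intro s t h
    apply chi_inj
    funext z
    exact DFunLike.congr_fun h (Multiplicative.ofAdd z)
  exact h.comp chiHom hinj

lemma chi_add (s t : ℝ) : chi (s + t) = chi s * chi t := by
  funext z
  simp only [chi, Pi.mul_apply, ← Complex.exp_add]
  congr 1; push_cast; ring

lemma chi_zero : chi 0 = 1 := by funext z; simp [chi]

/-- the set of frequencies -/
def frq (c e : ℝ) : Set ℝ := {s | ∃ m l : ℕ, s = -c * m + e * l}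

lemma adjoin_le (c e : ℝ) {g : ℂ → ℂ} (hg : g ∈ Algebra.adjoin ℂ {chi (-c), chi e}) :
    g ∈ Submodule.span ℂ (chi '' frq c e) := by
  rw [← Subalgebra.mem_toSubmodule, Algebra.adjoin_eq_span] at hg
  refine Submodule.span_mono ?_ hg
  intro x hx
  induction hx using Submonoid.closure_induction with
  | mem x hx =>
    rcases hx with rfl | rfl
    · exact ⟨-c, ⟨1, 0, by simp⟩, rfl⟩
    · exact ⟨e, ⟨0, 1, by simp⟩, rfl⟩
  | one => exact ⟨0, ⟨0, 0, by simp⟩, chi_zero⟩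
  | mul x y _ _ hx hy =>
    obtain ⟨_, ⟨m, l, rfl⟩, rfl⟩ := hx
    obtain ⟨_, ⟨m', l', rfl⟩, rfl⟩ := hy
    exact ⟨_, ⟨m + m', l + l', by push_cast; ring⟩, chi_add (-c * m + e * l) (-c * m' + e * l')⟩

lemma freq_mem {c e s t : ℝ} {A K B : ℂ} (hA : A ≠ 0) (hs : s ≠ 0) (hst : s ≠ t)
    (h : A • chi s + K • (1 : ℂ → ℂ) + B • chi t ∈ Algebra.adjoin ℂ {chi (-c), chi e}) :
    s ∈ frq c e := by
  by_contra hn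
  have h1 := adjoin_le c e h
  have h2 : chi s ∉ Submodule.span ℂ (chi '' (frq c e ∪ {0, t})) :=
    chi_indep.notMem_span_image (by simp [hn, hs, hst])
  apply h2
  have m1 : chi t ∈ Submodule.span ℂ (chi '' (frq c e ∪ {0, t})) :=
    Submodule.subset_span ⟨t, by simp, rfl⟩
  have m2 : (1 : ℂ → ℂ) ∈ Submodule.span ℂ (chi '' (frq c e ∪ {0, t})) :=
    Submodule.subset_span ⟨0, by simp, chi_zero⟩
  have m3 := Submodule.span_mono (image_mono subset_union_left (s := frq c e) (t := frq c e ∪ {0, t})) h1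
  have m4 : A • chi s ∈ Submodule.span ℂ (chi '' (frq c e ∪ {0, t})) := by
    have := Submodule.sub_mem _ (Submodule.sub_mem _ m3 (Submodule.smul_mem _ B m1))
      (Submodule.smul_mem _ K m2)
    convert this using 1
    module
  exact (Submodule.smul_mem_iff _ hA).mp m4

lemma arith {c e : ℝ} (hc : 0 < c) (he : 0 < e) {d : ℕ} (hd : 2 ≤ d)
    (h1 : -(c / d) ∈ frq c e) (h2 : e = c ∨ e / d ∈ frq c e) : False := by
  have hd0 : (d : ℝ) ≠ 0 := by
    have : d ≠ 0 := by omega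
    exact_mod_cast this
  obtain ⟨m, l, hml⟩ := h1
  have k1 : c * (d * m - 1) = e * (d * l) := by
    field_simp at hml; linarith
  rcases h2 with rfl | ⟨m', l', hml'⟩
  · have k2 := mul_left_cancel₀ hc.ne' k1
    have k3 : (d : ℤ) * (m - l) = 1 := by
      have : (d : ℝ) * (m - l) = 1 := by linarith
      exact_mod_cast this
    have : (d : ℤ) ∣ 1 := ⟨_, k3.symm⟩
    have := Int.le_of_dvd one_pos this
    omega
  · have k2 : e * (d * l' - 1) = c * (d * m') := by
      field_simp at hml'; linarith
    have k3 : (c * e) * ((d * m - 1) * (d * l' - 1)) = (c * e) * ((d * l) * (d * m')) := by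
      calc _ = (c * (d * m - 1)) * (e * (d * l' - 1)) := by ring
        _ = (e * (d * l)) * (c * (d * m')) := by rw [k1, k2]
        _ = _ := by ring
    have k4 := mul_left_cancel₀ (mul_pos hc he).ne' k3
    have k5 : ((d : ℤ) * m - 1) * (d * l' - 1) = (d * l) * (d * m') := by exact_mod_cast k4
    have : (d : ℤ) ∣ 1 := ⟨d * l * m' - d * m * l' + m + l', by linear_combination k5⟩
    have := Int.le_of_dvd one_pos this
    omega

section
variable {d : ℕ → ℕ} {R C C1 : ℝ} {q : ℕ → Polynomial ℂ} {a : ℕ → ℂ} {Y : ℕ → ℂ → ℂ}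

lemma Fam.neg (F : Fam d R C C1 q a Y) : Fam d R C C1 q a (fun j ζ => Y j (-ζ)) where
  par := F.par
  hC1 := F.hC1
  diff j := by have := F.diff j; fun_prop
  recu j ζ := F.recu j (-ζ)
  adm ζ := F.adm (-ζ)
  real s j := by have := F.real (-s) j; push_cast at this; exact this
  order j := by
    obtain ⟨B, hB⟩ := F.order j
    exact ⟨B, fun ζ => by have := hB (-ζ); rwa [norm_neg] at this⟩
  hq := F.hq
  ha := F.ha

/-- the data on the lower side -/
lemma Fam.lower (F : Fam d R C C1 q a Y) (c₀ : ℝ) (hc₀ : 0 < c₀)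
    (hlow : (∀ ζ : ℂ, ζ.im < 0 → ∃ m, R < ‖Y m ζ‖) ∨ (∀ ζ : ℂ, ζ.im < 0 → ∀ j, ‖Y j ζ‖ ≤ R)) :
    ∃ e L : ℝ, 0 < e ∧ 0 < L ∧ (∀ (j : ℕ) (ζ : ℂ), ζ.im ≤ 0 → ‖Y j ζ‖ ≤ R * Real.exp (Dg d j * e * -ζ.im)) ∧
      (∀ j ≥ 1, ∃ B, ∀ ζ : ℂ, ζ.im ≤ -L → ‖deriv (Y j) ζ - Complex.I * (Dg d j * e : ℝ) * Y j ζ‖ ≤ B) ∧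
      (e = c₀ ∨ ∀ (j : ℕ) (ζ : ℂ), ζ.im ≤ -L → Dg d j * e * -ζ.im - C ≤ Real.log ‖Y j ζ‖) := by
  rcases hlow with h | h
  · obtain ⟨e, L, he, hL, h1, h2, h3⟩ := F.neg.E7 (fun ζ hζ => h (-ζ) (by
      have : 0 < ζ.im := hζ
      simpa using this))
    refine ⟨e, L, he, hL, fun j ζ hζ => ?_, fun j hj => ?_, Or.inr fun j ζ hζ => ?_⟩
    · have := h1 j (-ζ) (by simpa using hζ)
      simpa using this
    · obtain ⟨B, hB⟩ := h3 j hj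
      refine ⟨B, fun ζ hζ => ?_⟩
      have := hB (-ζ) (by simp; linarith)
      rw [deriv_comp_neg, neg_neg, ← norm_neg] at this
      have e0 : deriv (Y j) ζ - Complex.I * (Dg d j * e : ℝ) * Y j ζ =
          -(-deriv (Y j) ζ + Complex.I * (Dg d j * e : ℝ) * Y j ζ) := by ring
      rw [e0]
      exact this
    · have := (h2 j (-ζ) (by simp; linarith)).2
      simpa using this
  · have hb : ∀ ζ : ℂ, ζ.im ≤ 0 → ∀ j, ‖Y j ζ‖ ≤ R := by
      intro ζ hζ j
      rcases hζ.lt_or_eq with h1 | h1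
      · exact h ζ h1 j
      · have := F.real ζ.re j
        have e : ((ζ.re : ℝ) : ℂ) = ζ := by apply Complex.ext <;> simp [h1]
        rwa [e] at this
    refine ⟨c₀, 1, hc₀, one_pos, fun j ζ hζ => ?_, fun j hj => ?_, Or.inl rfl⟩
    · refine (hb ζ hζ j).trans (le_mul_of_one_le_right F.par.Rpos.le (Real.one_le_exp ?_))
      have := F.par.Dg_pos j
      have : 0 ≤ -ζ.im := by linarith
      positivity
    · refine ⟨R + (Dg d j * c₀) * R, fun ζ hζ => ?_⟩
      have e1 : ‖deriv (Y j) ζ‖ ≤ R := deriv_bd (F.diff j) fun z hz => hb z (by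
        have := abs_le.mp hz; linarith [this.2]) j
      have e2 := hb ζ (by linarith) j
      have := mul_pos (F.par.Dg_pos j) hc₀
      refine (norm_sub_le _ _).trans ?_
      rw [norm_mul, norm_mul, Complex.norm_I, Complex.norm_real, Real.norm_of_nonneg this.le, one_mul]
      gcongr

lemma Fam.absurd (F : Fam d R C C1 q a Y) (hup : ∀ ζ ∈ HH, ∃ m, R < ‖Y m ζ‖)
    (hlow : (∀ ζ : ℂ, ζ.im < 0 → ∃ m, R < ‖Y m ζ‖) ∨ (∀ ζ : ℂ, ζ.im < 0 → ∀ j, ‖Y j ζ‖ ≤ R)) :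
    False := by
  obtain ⟨c, L, hc, hL, u1, u2, u3⟩ := F.E7 hup
  obtain ⟨e, L', he, hL', l1, l2, l3⟩ := F.lower c hc hlow
  have hDp := F.par.Dg_pos
  have form : ∀ j ≥ 1, ∃ A K B : ℂ, (Y j = A • chi (-(Dg d j * c)) + K • (1 : ℂ → ℂ) + B • chi (Dg d j * e)) ∧
      A ≠ 0 ∧ (e = c ∨ B ≠ 0) := by
    intro j hj
    have b1 : ∀ T : ℝ, ∃ B, ∀ ζ : ℂ, |ζ.im| ≤ T → ‖Y j ζ‖ ≤ B := by
      intro T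
      have hRp := F.par.Rpos
      refine ⟨R * Real.exp (Dg d j * c * |T|) + R * Real.exp (Dg d j * e * |T|), fun ζ hζ => ?_⟩
      have hT := le_abs_self T
      have p1 : 0 < R * Real.exp (Dg d j * c * |T|) := by positivity
      have p2 : 0 < R * Real.exp (Dg d j * e * |T|) := by positivity
      have q1 := mul_pos (hDp j) hc
      have q2 := mul_pos (hDp j) he
      have hz := abs_le.mp (hζ.trans hT)
      rcases le_total 0 ζ.im with h | h
      · have : ‖Y j ζ‖ ≤ R * Real.exp (Dg d j * c * |T|) := by
          refine (u1 j ζ h).trans ?_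
          gcongr
          exact hz.2
        linarith
      · have : ‖Y j ζ‖ ≤ R * Real.exp (Dg d j * e * |T|) := by
          refine (l1 j ζ h).trans ?_
          gcongr
          linarith [hz.1]
        linarith
    have b2 : ∃ B, ∀ ζ : ℂ, max L L' ≤ ζ.im → ‖deriv (Y j) ζ + Complex.I * (Dg d j * c : ℝ) * Y j ζ‖ ≤ B := by
      obtain ⟨B, hB⟩ := u3 j hj
      exact ⟨B, fun ζ hζ => hB ζ ((le_max_left _ _).trans hζ)⟩
    have b3 : ∃ B, ∀ ζ : ℂ, ζ.im ≤ -max L L' → ‖deriv (Y j) ζ - Complex.I * (Dg d j * e : ℝ) * Y j ζ‖ ≤ B := by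
      obtain ⟨B, hB⟩ := l2 j hj
      exact ⟨B, fun ζ hζ => hB ζ (by linarith [le_max_right L L'])⟩
    obtain ⟨A, K, B, hform⟩ := liouville_form (F.diff j) (l := Dg d j * c) (m := Dg d j * e)
      (L := max L L') (mul_pos (hDp j) hc) (mul_pos (hDp j) he) b1 b2 b3
    refine ⟨A, K, B, ?_, ?_, ?_⟩
    · funext ζ
      rw [hform ζ]
      simp [chi]
    · rintro rfl
      -- bounded on the upper half plane
      have hb : ∀ y : ℝ, 0 ≤ y → ‖Y j (y * Complex.I)‖ ≤ ‖K‖ + ‖B‖ := by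
        intro y hy
        rw [hform, zero_mul, zero_add]
        refine (norm_add_le _ _).trans ?_
        gcongr
        rw [norm_mul, Complex.norm_exp]
        refine mul_le_of_le_one_right (norm_nonneg _) (Real.exp_le_one_iff.mpr ?_)
        have := mul_pos (hDp j) he
        simp
        positivity
      set M := Real.log (‖K‖ + ‖B‖ + 1) with hM
      set y := max L ((M + C + 1) / (Dg d j * c)) with hy
      have hyL : L ≤ y := le_max_left _ _
      have h1 := (u2 j (y * Complex.I) (by simpa using hyL))
      have h2 := hb y (hL.le.trans hyL)
      have h3 : Real.log ‖Y j (y * Complex.I)‖ ≤ M :=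
        Real.log_le_log (F.par.Rpos.trans h1.1) (by linarith)
      have h4 : (M + C + 1) / (Dg d j * c) ≤ y := le_max_right _ _
      rw [div_le_iff₀ (mul_pos (hDp j) hc)] at h4
      have h5 := h1.2
      simp at h5
      linarith
    · refine l3.imp id fun l3 => ?_
      rintro rfl
      have hb : ∀ y : ℝ, 0 ≤ y → ‖Y j (-y * Complex.I)‖ ≤ ‖K‖ + ‖A‖ := by
        intro y hy
        rw [hform, zero_mul, add_zero]
        refine (norm_add_le _ _).trans ?_
        rw [add_comm]
        gcongr
        rw [norm_mul, Complex.norm_exp]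
        refine mul_le_of_le_one_right (norm_nonneg _) (Real.exp_le_one_iff.mpr ?_)
        have := mul_pos (hDp j) hc
        simp
        positivity
      set M := Real.log (‖K‖ + ‖A‖ + 1) with hM
      set y := max L' ((M + C + 1) / (Dg d j * e)) with hy
      have hyL : L' ≤ y := le_max_left _ _
      have h1 := (l3 j (-y * Complex.I) (by simpa using hyL))
      have h2 := hb y (hL'.le.trans hyL)
      have hM0 : 0 ≤ M := Real.log_nonneg (by linarith [norm_nonneg K, norm_nonneg A])
      have h3 : Real.log ‖Y j (-y * Complex.I)‖ ≤ M := by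
        rcases (norm_nonneg (Y j (-y * Complex.I))).eq_or_lt with h0 | h0
        · rw [← h0, Real.log_zero]; exact hM0
        · exact Real.log_le_log h0 (by linarith)
      have h4 : (M + C + 1) / (Dg d j * e) ≤ y := le_max_right _ _
      rw [div_le_iff₀ (mul_pos (hDp j) he)] at h4
      simp at h1 h3
      linarith
  obtain ⟨A2, K2, B2, f2, hA2, hB2⟩ := form 2 (by norm_num)
  obtain ⟨A3, K3, B3, f3, -, -⟩ := form 3 (by norm_num)
  obtain ⟨A4, K4, B4, f4, -, -⟩ := form 4 (by norm_num)
  set cc := Dg d 3 * c with hcc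
  set ee := Dg d 3 * e with hee
  have hcc0 : 0 < cc := mul_pos (hDp 3) hc
  have hee0 : 0 < ee := mul_pos (hDp 3) he
  set S := Algebra.adjoin ℂ {chi (-cc), chi ee} with hS
  have s1 : chi (-cc) ∈ S := Algebra.subset_adjoin (by simp)
  have s2 : chi ee ∈ S := Algebra.subset_adjoin (by simp)
  have chipow : ∀ (s : ℝ) (n : ℕ), chi (s * n) = chi s ^ n := by
    intro s n
    induction n with
    | zero => simp [chi_zero]
    | succ n ih => rw [pow_succ, ← ih, ← chi_add]; congr 1; push_cast; ring
  have y3 : Y 3 ∈ S := by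
    rw [f3]
    exact S.add_mem (S.add_mem (S.smul_mem s1 _) (S.smul_mem S.one_mem _)) (S.smul_mem s2 _)
  have hD4 : Dg d 4 = Dg d 3 * d 3 := Dg_succ d 3
  have hD3 : Dg d 3 = Dg d 2 * d 2 := Dg_succ d 2
  have y4 : Y 4 ∈ S := by
    rw [f4, hD4, show -(Dg d 3 * d 3 * c) = -cc * d 3 by rw [hcc]; ring,
      show Dg d 3 * d 3 * e = ee * d 3 by rw [hee]; ring, chipow, chipow]
    exact S.add_mem (S.add_mem (S.smul_mem (S.pow_mem s1 _) _) (S.smul_mem S.one_mem _))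
      (S.smul_mem (S.pow_mem s2 _) _)
  have hqe : (fun ζ => (q 3).eval (Y 3 ζ)) = Polynomial.aeval (Y 3) (q 3) := by
    funext ζ
    rw [Polynomial.aeval_eq_sum_range, Polynomial.eval_eq_sum_range]
    simp
  have y2 : Y 2 ∈ S := by
    have ha := (F.ha 3).1
    have e1 : Y 2 = (a 3)⁻¹ • (Polynomial.aeval (Y 3) (q 3) - Y 4) := by
      rw [← hqe]
      funext ζ
      have := F.recu 2 ζ
      simp only [Pi.smul_apply, Pi.sub_apply, smul_eq_mul]
      rw [show (4 : ℕ) = 2 + 2 from rfl, this]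
      field_simp
      ring
    rw [e1]
    exact S.smul_mem (S.sub_mem (Algebra.adjoin_le (by simpa using y3)
      (Polynomial.aeval_mem_adjoin_singleton ℂ (Y 3))) y4) _
  have hd2 : (d 2 : ℝ) ≠ 0 := by have := F.par.two_le 2; linarith
  have hd2p : (0 : ℝ) < d 2 := by have := F.par.two_le 2; linarith
  have g1 : Dg d 2 * c = cc / d 2 := by rw [hcc, hD3]; field_simp
  have g2 : Dg d 2 * e = ee / d 2 := by rw [hee, hD3]; field_simp
  rw [f2, g1, g2] at y2
  have pc : 0 < cc / d 2 := by positivity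
  have pe : 0 < ee / d 2 := by positivity
  refine arith hcc0 hee0 (F.par.hd 2) (freq_mem hA2 (by linarith) (by linarith) y2) ?_
  rcases hB2 with rfl | hB2
  · left; rfl
  · right
    refine freq_mem (t := -(cc / d 2)) (A := B2) (K := K2) (B := A2) hB2 (by linarith) (by linarith) ?_
    convert y2 using 1
    abel

end
end JS

namespace JS
open Metric ComplexConjugate

/-- Montel's theorem along an ultrafilter. -/
lemma montel (U : Ultrafilter ℕ) (Z : ℕ → ℂ → ℂ)
    (hd : ∀ ρ : ℝ, ∀ᶠ k in (U : Filter ℕ), DifferentiableOn ℂ (Z k) (ball 0 ρ))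
    (hb : ∀ ρ : ℝ, ∃ B : ℝ, ∀ᶠ k in (U : Filter ℕ), ∀ ζ ∈ ball (0 : ℂ) ρ, ‖Z k ζ‖ ≤ B) :
    ∃ Y : ℂ → ℂ, TendstoLocallyUniformly Z Y (U : Filter ℕ) ∧ Differentiable ℂ Y := by
  have hpt : ∀ ζ : ℂ, ∃ y : ℂ, Tendsto (fun k => Z k ζ) U (𝓝 y) := by
    intro ζ
    obtain ⟨B, hB⟩ := hb (‖ζ‖ + 1)
    obtain ⟨y, -, hy⟩ := (isCompact_closedBall (0 : ℂ) B).ultrafilter_le_nhds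
      (U.map (fun k => Z k ζ)) (by
        rw [le_principal_iff]
        change ∀ᶠ k in (U : Filter ℕ), Z k ζ ∈ closedBall 0 B
        filter_upwards [hB] with k hk
        simpa using hk ζ (by simp))
    exact ⟨y, hy⟩
  choose Y hY using hpt
  have key : TendstoLocallyUniformly Z Y (U : Filter ℕ) := by
    rw [Metric.tendstoLocallyUniformly_iff]
    intro ε hε x
    obtain ⟨B, hB⟩ := hb (‖x‖ + 3)
    set B' := |B| + 1 with hB'
    have hB'0 : 0 < B' := by positivity
    have hlip : ∀ᶠ k in (U : Filter ℕ), ∀ y ∈ ball x 1, ‖Z k y - Z k x‖ ≤ B' * ‖y - x‖ := by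
      filter_upwards [hB, hd (‖x‖ + 3)] with k hk hdk y hy
      have hsub : ∀ w ∈ ball x 1, closedBall w 1 ⊆ ball (0 : ℂ) (‖x‖ + 3) := by
        intro w hw z hz
        rw [mem_ball, dist_eq_norm] at hw
        rw [mem_closedBall, dist_eq_norm] at hz
        rw [mem_ball_zero_iff]
        have : z = (z - w) + (w - x) + x := by ring
        rw [this]
        have := norm_add₃_le (a := z - w) (b := w - x) (c := x)
        linarith
      have hda : ∀ w ∈ ball x 1, DifferentiableAt ℂ (Z k) w := fun w hw =>
        hdk.differentiableAt (isOpen_ball.mem_nhds (hsub w hw (by simp)))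
      refine Convex.norm_image_sub_le_of_norm_deriv_le hda ?_ (convex_ball x 1) (by simp) hy
      intro w hw
      have h1 := Complex.norm_deriv_le_of_forall_mem_sphere_norm_le (c := w) (R := 1) (C := B')
        (f := Z k) one_pos
        ((hdk.mono ((closure_ball_subset_closedBall).trans (hsub w hw))).diffContOnCl)
        (fun z hz => (hk z (hsub w hw (sphere_subset_closedBall hz))).trans
          (by have := le_abs_self B; linarith))
      simpa using h1
    have hlipY : ∀ y ∈ ball x 1, ‖Y y - Y x‖ ≤ B' * ‖y - x‖ := by
      intro y hy
      refine le_of_tendsto ((hY y).sub (hY x)).norm ?_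
      filter_upwards [hlip] with k hk using hk y hy
    refine ⟨ball x (min 1 (ε / (3 * B'))), ball_mem_nhds _ (by positivity), ?_⟩
    have h3 : ∀ᶠ k in (U : Filter ℕ), dist (Z k x) (Y x) < ε / 3 :=
      (Metric.tendsto_nhds.mp (hY x)) (ε / 3) (by positivity)
    filter_upwards [hlip, h3] with k hk hk3 y hy
    have hy1 : y ∈ ball x 1 := ball_subset_ball (min_le_left _ _) hy
    have hy2 : ‖y - x‖ < ε / (3 * B') := by
      rw [mem_ball, dist_eq_norm] at hy
      exact hy.trans_le (min_le_right _ _)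
    have hy3 : B' * ‖y - x‖ < ε / 3 := by
      calc B' * ‖y - x‖ < B' * (ε / (3 * B')) := by gcongr
        _ = ε / 3 := by field_simp
    have e1 := hk y hy1
    have e2 := hlipY y hy1
    rw [← dist_eq_norm] at e1 e2
    have := dist_triangle4 (Y y) (Y x) (Z k x) (Z k y)
    rw [dist_comm (Z k x) (Z k y), dist_comm (Y x) (Z k x)] at this
    linarith
  refine ⟨Y, key, ?_⟩
  intro x
  have h1 : TendstoLocallyUniformlyOn Z Y (U : Filter ℕ) (ball 0 (‖x‖ + 1)) :=
    (tendstoLocallyUniformlyOn_univ.mpr key).mono (subset_univ _)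
  have := h1.differentiableOn (hd (‖x‖ + 1)) isOpen_ball
  exact this.differentiableAt (isOpen_ball.mem_nhds (by simp))

lemma side_dichotomy {d : ℕ → ℕ} {R C : ℝ} (hp : Par d R C) (U : Ultrafilter ℕ)
    (Z : ℕ → ℕ → ℂ → ℂ) (Y : ℕ → ℂ → ℂ)
    (hd : ∀ ρ : ℝ, ∀ᶠ k in (U : Filter ℕ), ∀ m, DifferentiableOn ℂ (Z k m) (ball 0 ρ))
    (ha : ∀ ρ : ℝ, ∀ᶠ k in (U : Filter ℕ), ∀ ζ ∈ ball (0 : ℂ) ρ, Adm d R C (fun m => Z k m ζ))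
    (he : ∀ K : Set ℂ, K ⊆ HH → IsCompact K →
      ∀ᶠ k in (U : Filter ℕ), ∀ z ∈ K, ∃ m, R < ‖Z k m z‖)
    (hY : ∀ m ζ, Tendsto (fun k => Z k m ζ) U (𝓝 (Y m ζ)))
    {ζ₂ : ℂ} (h2 : ζ₂ ∈ HH) {m : ℕ} (hm : R < ‖Y m ζ₂‖) :
    ∀ w ∈ HH, ∃ m', R < ‖Y m' w‖ := by
  intro w hw
  set t := mobi ζ₂ w with ht
  have htm : ‖t‖ < 1 := by simpa using mobi_mem h2 hw
  set ρ := (1 + ‖t‖) / 2 with hρ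
  have hρ1 : ρ < 1 := by rw [hρ]; linarith
  have hρt : ‖t‖ < ρ := by rw [hρ]; linarith
  have hρ0 : 0 < ρ := (norm_nonneg t).trans_lt hρt
  have hsub : closedBall (0 : ℂ) ρ ⊆ ball 0 1 := closedBall_subset_ball hρ1
  have hK : IsCompact (mob ζ₂ '' closedBall 0 ρ) :=
    (isCompact_closedBall _ _).image_of_continuousOn ((mob_diff ζ₂).continuousOn.mono hsub)
  have hKH : mob ζ₂ '' closedBall 0 ρ ⊆ HH := by
    rintro _ ⟨s, hs, rfl⟩
    exact mob_mem h2 (hsub hs)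
  obtain ⟨M, hM⟩ := hK.isBounded.subset_ball (0 : ℂ)
  set g := (Real.log R - C) / Dg d m with hg
  have hlogR := hp.logR
  have hC := hp.hC
  have hg0 : 0 < g := div_pos (by linarith) (hp.Dg_pos m)
  set g' := (ρ - ‖t‖) * g / (ρ + ‖t‖) with hg'
  have hg'0 : 0 < g' := div_pos (mul_pos (by linarith) hg0) (by positivity)
  have hev : ∀ᶠ k in (U : Filter ℕ), g' ≤ gr d R (fun m => Z k m w) := by
    have h1 : ∀ᶠ k in (U : Filter ℕ), R < ‖Z k m ζ₂‖ :=
      (hY m ζ₂).norm.eventually (lt_mem_nhds hm)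
    filter_upwards [hd M, ha M, he _ hKH hK, h1] with k k1 k2 k3 k4
    have hmaps : ∀ s ∈ ball (0 : ℂ) ρ, mob ζ₂ s ∈ mob ζ₂ '' closedBall 0 ρ :=
      fun s hs => ⟨s, ball_subset_closedBall hs, rfl⟩
    have hh := (harnack_adm hp (Z := fun m s => Z k m (mob ζ₂ s)) (c := 0) (ρ := ρ) (w := t)
      (fun m => (k1 m).comp ((mob_diff ζ₂).mono (ball_subset_closedBall.trans hsub))
        (fun s hs => hM (hmaps s hs)))
      (fun s hs => k2 _ (hM (hmaps s hs))) (fun s hs => k3 _ (hmaps s hs))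
      (by simpa using hρt)).2
    simp only [mob_zero, ht, mob_mobi h2 hw] at hh
    rw [← ht, dist_zero_right] at hh
    have hz2 : ζ₂ ∈ ball (0 : ℂ) M := by
      have := hM (hmaps 0 (by simpa using hρ0))
      rwa [mob_zero] at this
    have h5 := (k2 ζ₂ hz2).le_gr hp k4
    have h6 : Real.log R ≤ Real.log ‖Z k m ζ₂‖ := Real.log_le_log hp.Rpos k4.le
    have h7 : g ≤ gr d R (fun m => Z k m ζ₂) := by
      rw [hg, div_le_iff₀ (hp.Dg_pos m)]
      linarith [mul_comm (Dg d m) (gr d R (fun m => Z k m ζ₂))]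
    rw [hg', div_le_iff₀ (by positivity)]
    calc (ρ - ‖t‖) * g ≤ (ρ - ‖t‖) * gr d R (fun m => Z k m ζ₂) := by
          gcongr
      _ ≤ _ := by linarith [mul_comm (ρ + ‖t‖) (gr d R (fun m => Z k m w))]
  obtain ⟨m', hm'⟩ := (hp.Dg_tendsto.eventually_gt_atTop ((Real.log (2 * R) + C) / g')).exists
  rw [div_lt_iff₀ hg'0] at hm'
  refine ⟨m', ?_⟩
  have hRp := hp.Rpos
  have hfin : 2 * R ≤ ‖Y m' w‖ := by
    refine ge_of_tendsto (hY m' w).norm ?_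
    filter_upwards [hev, ha (‖w‖ + 1)] with k k1 k2
    have h1 := (k2 w (by simp)).gr_le hp m'
    have h2 : Real.log (2 * R) < bb R (fun m => Z k m w) m' := by
      have : Dg d m' * g' ≤ Dg d m' * gr d R (fun m => Z k m w) :=
        mul_le_mul_of_nonneg_left k1 (hp.Dg_pos m').le
      linarith
    rw [bb] at h2
    have h3 := (Real.log_lt_log_iff (by positivity) (lt_max_of_lt_right hRp)).mp h2
    rcases lt_max_iff.mp h3 with h | h
    · exact h.le
    · linarith
  linarith

end JS

namespace JS
open Metric ComplexConjugate

/-- Local data at a good point of the slice. -/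
structure Loc (d : ℕ → ℕ) (R C C1 : ℝ) (q : ℕ → Polynomial ℂ) (a : ℕ → ℂ) (X : ℕ → ℂ → ℂ)
    (δ₀ : ℝ) (N dm : ℕ) : Prop where
  par : Par d R C
  hC1 : 0 ≤ C1
  hN : 0 < N
  dper : Periodic d N
  qper : Periodic q N
  aper : Periodic a N
  hdm : ∀ j, d j ≤ dm
  hq : ∀ j x, R < ‖x‖ → ‖x * (q j).derivative.eval x - d j * (q j).eval x‖ ≤ C1 * ‖x‖ ^ (d j - 1)
  ha : ∀ j, a j ≠ 0 ∧ ‖a j‖ ≤ C1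
  hδ : 0 < δ₀
  diff : ∀ m, DifferentiableOn ℂ (X m) (ball 0 δ₀)
  adm : ∀ ζ ∈ ball (0 : ℂ) δ₀, Adm d R C (fun m => X m ζ)
  recu : ∀ j, ∀ ζ ∈ ball (0 : ℂ) δ₀, X (j + 2) ζ = (q (j + 1)).eval (X (j + 1) ζ) - a (j + 1) * X j ζ
  zero : ∀ m, ‖X m 0‖ ≤ R
  up : ∀ ε : ℝ, 0 < ε → ∃ δ : ℝ, 0 < δ ∧ ∀ ζ : ℂ, ‖ζ‖ < δ → ε * ‖ζ‖ < ζ.im → ∃ m, R < ‖X m ζ‖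
  low : (∀ ε : ℝ, 0 < ε → ∃ δ : ℝ, 0 < δ ∧ ∀ ζ : ℂ, ‖ζ‖ < δ → ε * ‖ζ‖ < -ζ.im → ∃ m, R < ‖X m ζ‖) ∨
    (∀ ε : ℝ, 0 < ε → ∃ δ : ℝ, 0 < δ ∧ ∀ ζ : ℂ, ‖ζ‖ < δ → ε * ‖ζ‖ < -ζ.im → ∀ m, ‖X m ζ‖ ≤ R)
  fill : ∀ s : ℝ, ∃ e : ℝ → ℂ, Tendsto e (𝓝[>] 0) (𝓝 (s : ℂ)) ∧
    ∀ᶠ r in 𝓝[>] (0 : ℝ), ∀ m, ‖X m (r * e r)‖ ≤ R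

section
variable {d : ℕ → ℕ} {R C C1 : ℝ} {q : ℕ → Polynomial ℂ} {a : ℕ → ℂ} {X : ℕ → ℂ → ℂ}
  {δ₀ : ℝ} {N dm : ℕ}

lemma Loc.step1 (F : Loc d R C C1 q a X δ₀ N dm) :
    ∃ δ₁ g₀ : ℝ, 0 < δ₁ ∧ 0 < g₀ ∧ 2 * δ₁ < δ₀ ∧ (∀ ζ : ℂ, ‖ζ‖ ≤ δ₁ → ‖X 0 ζ‖ ≤ 2 * R) ∧
      (∀ k : ℕ, ∃ m, R < ‖X m (Complex.I * (δ₁ / 16 ^ k : ℝ))‖) ∧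
      ∀ k : ℕ, g₀ ≤ 64 ^ k * gr d R (fun m => X m (Complex.I * (δ₁ / 16 ^ k : ℝ))) := by
  have hR := F.par.Rpos
  obtain ⟨δ, hδ, hcone⟩ := F.up (1 / 64) (by norm_num)
  have hcont : ContinuousAt (fun ζ => ‖X 0 ζ‖) 0 :=
    (((F.diff 0).continuousOn.continuousAt (ball_mem_nhds _ F.hδ))).norm
  have h0 : ∀ᶠ ζ in 𝓝 (0 : ℂ), ‖X 0 ζ‖ < 2 * R :=
    hcont.eventually (gt_mem_nhds (by have := F.zero 0; linarith))
  obtain ⟨δ', hδ', hX0⟩ := Metric.eventually_nhds_iff.mp h0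
  have hδ0 := F.hδ
  set δ₁ := min (δ / 4) (min (δ' / 2) (δ₀ / 4)) with hδ₁
  have p1 : 0 < δ₁ := by positivity
  have p2 : δ₁ ≤ δ / 4 := min_le_left _ _
  have p3 : δ₁ ≤ δ' / 2 := (min_le_right _ _).trans (min_le_left _ _)
  have p4 : δ₁ ≤ δ₀ / 4 := (min_le_right _ _).trans (min_le_right _ _)
  have hpow : ∀ k : ℕ, 0 < δ₁ / 16 ^ k ∧ δ₁ / 16 ^ k ≤ δ₁ := fun k =>
    ⟨by positivity, div_le_self p1.le (one_le_pow₀ (by norm_num))⟩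
  have hball : ∀ r : ℝ, 0 < r → r ≤ δ₁ → ∀ ζ ∈ ball (Complex.I * (r : ℂ)) (31 / 32 * r),
      ζ ∈ ball (0 : ℂ) δ₀ ∧ ∃ m, R < ‖X m ζ‖ := by
    intro r hr hr1 ζ hζ
    rw [mem_ball, dist_eq_norm] at hζ
    have e1 : ‖Complex.I * (r : ℂ)‖ = r := by simp [abs_of_pos hr]
    have e2 : ‖ζ‖ ≤ ‖ζ - Complex.I * (r : ℂ)‖ + ‖Complex.I * (r : ℂ)‖ := by
      simpa using norm_add_le (ζ - Complex.I * (r : ℂ)) (Complex.I * (r : ℂ))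
    have e3 : |(ζ - Complex.I * (r : ℂ)).im| ≤ ‖ζ - Complex.I * (r : ℂ)‖ := Complex.abs_im_le_norm _
    have e4 : (ζ - Complex.I * (r : ℂ)).im = ζ.im - r := by simp
    rw [e4, abs_le] at e3
    refine ⟨?_, hcone ζ ?_ ?_⟩
    · rw [mem_ball_zero_iff]; linarith
    · linarith
    · linarith [e3.1]
  have hesc : ∀ k : ℕ, ∃ m, R < ‖X m (Complex.I * (δ₁ / 16 ^ k : ℝ))‖ := fun k =>
    (hball _ (hpow k).1 (hpow k).2 _ (mem_ball_self (by have := (hpow k).1; positivity))).2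
  have hstep : ∀ k : ℕ, gr d R (fun m => X m (Complex.I * (δ₁ / 16 ^ k : ℝ))) ≤
      64 * gr d R (fun m => X m (Complex.I * (δ₁ / 16 ^ (k + 1) : ℝ))) := by
    intro k
    set r := δ₁ / 16 ^ k with hr
    have hrk : δ₁ / 16 ^ (k + 1) = r / 16 := by rw [hr, pow_succ]; field_simp
    have r0 : 0 < r := (hpow k).1
    have hb := hball r r0 (hpow k).2
    have hdist : dist (Complex.I * ((r / 16 : ℝ) : ℂ)) (Complex.I * (r : ℂ)) = 15 / 16 * r := by
      rw [dist_eq_norm, ← mul_sub, norm_mul, Complex.norm_I, one_mul, ← Complex.ofReal_sub,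
        Complex.norm_real, Real.norm_eq_abs, abs_sub_comm, abs_of_pos (by linarith)]
      ring
    have hh := (harnack_adm F.par (Z := X) (c := Complex.I * (r : ℂ)) (ρ := 31 / 32 * r)
      (w := Complex.I * ((r / 16 : ℝ) : ℂ))
      (fun m => (F.diff m).mono (fun ζ hζ => (hb ζ hζ).1))
      (fun ζ hζ => F.adm ζ (hb ζ hζ).1) (fun ζ hζ => (hb ζ hζ).2)
      (by rw [mem_ball, hdist]; linarith)).2
    rw [hdist] at hh
    rw [hrk]
    have hg : 0 ≤ gr d R (fun m => X m (Complex.I * ((r / 16 : ℝ) : ℂ))) :=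
      (F.adm _ (hb _ (by rw [mem_ball, hdist]; linarith)).1).gr_nonneg F.par
    nlinarith
  refine ⟨δ₁, gr d R (fun m => X m (Complex.I * (δ₁ / 16 ^ 0 : ℝ))), p1, ?_, by linarith, ?_, hesc, ?_⟩
  · obtain ⟨m, hm⟩ := hesc 0
    refine (F.adm _ ?_).gr_pos F.par hm
    exact (hball _ (hpow 0).1 (hpow 0).2 _ (mem_ball_self (by have := (hpow 0).1; positivity))).1
  · intro ζ hζ
    exact (hX0 (by rw [dist_zero_right]; linarith)).le
  · intro k
    induction k with
    | zero => simp
    | succ k ih =>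
      refine ih.trans ?_
      rw [pow_succ, mul_assoc]
      gcongr
      exact hstep k

lemma bb_le_two {d : ℕ → ℕ} {R C : ℝ} (hp : Par d R C) {x : ℕ → ℂ} {m : ℕ} (h : ‖x m‖ ≤ 2 * R) :
    bb R x m ≤ Real.log (2 * R) := by
  have := hp.Rpos
  exact Real.log_le_log (lt_max_of_lt_right this) (max_le h (by linarith))

lemma Loc.step2 (F : Loc d R C C1 q a X δ₀ N dm) :
    ∃ (δ₁ : ℝ) (ν : ℕ → ℕ), 0 < δ₁ ∧ 2 * δ₁ < δ₀ ∧
      (∀ k : ℕ, ∀ ζ : ℂ, ‖ζ‖ ≤ δ₁ / 16 ^ k → ‖X (ν k) ζ‖ ≤ 2 * R) ∧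
      (∀ k : ℕ, ∃ ζ : ℂ, ‖ζ‖ ≤ δ₁ / 16 ^ k ∧ 2 * R < ‖X (ν k + 1) ζ‖) ∧ Monotone ν ∧
      ∃ᶠ k in atTop, ∀ i ≤ k, Dg d (ν k) ≤ 128 ^ i * Dg d (ν (k - i)) := by
  obtain ⟨δ₁, g₀, h1, h2, h3, h4, h5, h6⟩ := F.step1
  have hR := F.par.Rpos
  have hin : ∀ k : ℕ, ∀ ζ : ℂ, ‖ζ‖ ≤ δ₁ / 16 ^ k → ‖ζ‖ ≤ δ₁ := fun k ζ h =>
    h.trans (div_le_self h1.le (one_le_pow₀ (by norm_num)))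
  have hin' : ∀ k : ℕ, ∀ ζ : ℂ, ‖ζ‖ ≤ δ₁ / 16 ^ k → ζ ∈ ball (0 : ℂ) δ₀ := fun k ζ h => by
    have := hin k ζ h
    rw [mem_ball_zero_iff]; linarith
  have hI : ∀ k : ℕ, ‖Complex.I * ((δ₁ / 16 ^ k : ℝ) : ℂ)‖ ≤ δ₁ / 16 ^ k := fun k => by
    rw [norm_mul, Complex.norm_I, one_mul, Complex.norm_real, Real.norm_eq_abs,
      abs_of_pos (by positivity)]
  have hex : ∀ k : ℕ, ∃ n, ∃ ζ : ℂ, ‖ζ‖ ≤ δ₁ / 16 ^ k ∧ 2 * R < ‖X n ζ‖ := by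
    intro k
    obtain ⟨m, hm⟩ := h5 k
    refine ⟨m + 1, _, hI k, ?_⟩
    have := (F.adm _ (hin' k _ (hI k))).double F.par hm
    linarith
  classical
  let n : ℕ → ℕ := fun k => Nat.find (hex k)
  have hn : ∀ k, ∃ ζ : ℂ, ‖ζ‖ ≤ δ₁ / 16 ^ k ∧ 2 * R < ‖X (n k) ζ‖ := fun k => Nat.find_spec (hex k)
  have hmin : ∀ k m, m < n k → ∀ ζ : ℂ, ‖ζ‖ ≤ δ₁ / 16 ^ k → ‖X m ζ‖ ≤ 2 * R := by
    intro k m hm ζ hζ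
    by_contra hcon
    exact Nat.find_min (hex k) hm ⟨ζ, hζ, not_le.mp hcon⟩
  have hn1 : ∀ k, n k - 1 + 1 = n k := by
    intro k
    have : n k ≠ 0 := by
      intro h0
      obtain ⟨ζ, hζ, hb⟩ := hn k
      rw [h0] at hb
      exact absurd (h4 ζ (hin k ζ hζ)) (not_le.mpr hb)
    omega
  have hmono : Monotone n := by
    intro k l hkl
    refine Nat.find_min' (hex k) ?_
    obtain ⟨ζ, hζ, hb⟩ := hn l
    refine ⟨ζ, hζ.trans ?_, hb⟩
    gcongr
    norm_num
  have hA : ∀ k : ℕ, ∀ ζ : ℂ, ‖ζ‖ ≤ δ₁ / 16 ^ k → ‖X (n k - 1) ζ‖ ≤ 2 * R := fun k =>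
    hmin k _ (by have := hn1 k; omega)
  set L := Real.log (2 * R) + C with hL
  have hlog : 0 < Real.log (2 * R) := Real.log_pos (by have := F.par.R_gt_one; linarith)
  have hL0 : 0 < L := by have := F.par.hC; linarith
  have hE : ∀ k, Dg d (n k - 1) * g₀ ≤ 64 ^ k * L := by
    intro k
    have e1 := (F.adm _ (hin' k _ (hI k))).gr_le F.par (n k - 1)
    have e2 := bb_le_two F.par (x := fun m => X m (Complex.I * ((δ₁ / 16 ^ k : ℝ) : ℂ)))
      (m := n k - 1) (hA k _ (hI k))
    have e3 := h6 k
    calc Dg d (n k - 1) * g₀ ≤ Dg d (n k - 1) * (64 ^ k *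
          gr d R (fun m => X m (Complex.I * ((δ₁ / 16 ^ k : ℝ) : ℂ)))) :=
          mul_le_mul_of_nonneg_left e3 (F.par.Dg_pos _).le
      _ = 64 ^ k * (Dg d (n k - 1) *
          gr d R (fun m => X m (Complex.I * ((δ₁ / 16 ^ k : ℝ) : ℂ)))) := by ring
      _ ≤ 64 ^ k * L := by gcongr; linarith
  have htend : Tendsto (fun k => (128 : ℝ) ^ k / Dg d (n k - 1)) atTop atTop := by
    have h7 : Tendsto (fun k : ℕ => (2 : ℝ) ^ k * (g₀ / L)) atTop atTop :=
      (tendsto_pow_atTop_atTop_of_one_lt (by norm_num)).atTop_mul_const (by positivity)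
    refine tendsto_atTop_mono (fun k => ?_) h7
    rw [le_div_iff₀ (F.par.Dg_pos _)]
    have e : (128 : ℝ) ^ k = 2 ^ k * 64 ^ k := by rw [← mul_pow]; norm_num
    rw [e, mul_assoc]
    gcongr
    rw [div_mul_eq_mul_div, div_le_iff₀ hL0, mul_comm g₀]
    exact hE k
  refine ⟨δ₁, fun k => n k - 1, h1, h3, hA, fun k => ?_, fun k l hkl => ?_, ?_⟩
  · simp only [hn1]; exact hn k
  · exact Nat.sub_le_sub_right (hmono hkl) 1
  · refine (frequently_high_scores htend).mono fun k hk i hi => ?_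
    rcases Nat.eq_zero_or_pos i with rfl | hi0
    · simp
    have := hk (k - i) (by omega)
    rw [div_lt_div_iff₀ (F.par.Dg_pos _) (F.par.Dg_pos _)] at this
    have e : (128 : ℝ) ^ k = 128 ^ (k - i) * 128 ^ i := by rw [← pow_add]; congr 1; omega
    rw [e, mul_assoc] at this
    exact (lt_of_mul_lt_mul_left this (by positivity)).le

end

end JS

namespace JS
open Metric ComplexConjugate

lemma Adm.shift {d : ℕ → ℕ} {R C : ℝ} {x : ℕ → ℂ} (h : Adm d R C x) (n : ℕ) :
    Adm (fun j => d (n + j)) R C (fun j => x (n + j)) :=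
  ⟨fun m => h.up (n + m), fun m => h.low (n + m)⟩

lemma Adm.lim {d : ℕ → ℕ} {R C : ℝ} {U : Ultrafilter ℕ} {z : ℕ → ℕ → ℂ} {y : ℕ → ℂ}
    (h : ∀ᶠ k in (U : Filter ℕ), Adm d R C (z k))
    (hy : ∀ m, Tendsto (fun k => z k m) U (𝓝 (y m))) : Adm d R C y := by
  constructor
  · intro m
    refine le_of_tendsto_of_tendsto (hy (m + 1)).norm
      ((((hy m).norm.max tendsto_const_nhds).pow (d m)).const_mul (Real.exp C)) ?_
    filter_upwards [h] with k hk using hk.up m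
  · intro m hm
    refine le_of_tendsto_of_tendsto (((hy m).norm.pow (d m)).const_mul (Real.exp (-C)))
      (hy (m + 1)).norm ?_
    filter_upwards [h, (hy m).norm.eventually (lt_mem_nhds hm)] with k hk h1 using hk.low m h1

lemma Dg_add_le {d : ℕ → ℕ} {R C : ℝ} (hp : Par d R C) {dm : ℕ} (hdm : ∀ j, d j ≤ dm) (n j : ℕ) :
    Dg d (n + j) ≤ dm ^ j * Dg d n := by
  induction j with
  | zero => simp
  | succ j ih =>
    rw [← add_assoc, Dg_succ, pow_succ]
    have h1 : (d (n + j) : ℝ) ≤ dm := by exact_mod_cast hdm _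
    calc Dg d (n + j) * d (n + j) ≤ (dm ^ j * Dg d n) * dm := by
          gcongr
          exact mul_nonneg (by positivity) (hp.Dg_pos n).le
      _ = _ := by ring

/-- scaled cone condition: every compact subset of the half plane eventually escapes. -/
lemma cone_compact {P : ℂ → Prop}
    (h : ∀ ε : ℝ, 0 < ε → ∃ δ : ℝ, 0 < δ ∧ ∀ ζ : ℂ, ‖ζ‖ < δ → ε * ‖ζ‖ < ζ.im → P ζ)
    {r : ℕ → ℝ} {l : Filter ℕ} (hr : Tendsto r l (𝓝 0)) (hr0 : ∀ k, 0 < r k)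
    {K : Set ℂ} (hK : K ⊆ HH) (hc : IsCompact K) :
    ∀ᶠ k in l, ∀ z ∈ K, P (r k * z) := by
  rcases K.eq_empty_or_nonempty with rfl | hne
  · simp
  obtain ⟨z₀, hz₀, hmin⟩ := hc.exists_isMinOn hne Complex.continuous_im.continuousOn
  have hc0 : 0 < z₀.im := hK hz₀
  obtain ⟨M, hM⟩ := hc.isBounded.exists_norm_le
  have hM0 : 0 ≤ M := (norm_nonneg _).trans (hM z₀ hz₀)
  obtain ⟨δ, hδ, hcone⟩ := h (z₀.im / (2 * (M + 1))) (by positivity)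
  have hr1 : ∀ᶠ k in l, r k < δ / (M + 1) := hr.eventually (gt_mem_nhds (by positivity))
  filter_upwards [hr1] with k hk z hz
  have hk0 := hr0 k
  have hn : ‖(r k : ℂ) * z‖ = r k * ‖z‖ := by simp [abs_of_pos hk0]
  have hzM := hM z hz
  refine hcone _ ?_ ?_
  · rw [hn]
    rw [lt_div_iff₀ (by positivity)] at hk
    calc r k * ‖z‖ ≤ r k * M := by gcongr
      _ < r k * (M + 1) := by gcongr; linarith
      _ < δ := hk
  · rw [hn, Complex.im_ofReal_mul]
    have h1 : z₀.im ≤ z.im := hmin hz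
    have h2 : z₀.im / (2 * (M + 1)) * ‖z‖ < z.im := by
      rw [div_mul_eq_mul_div, div_lt_iff₀ (by positivity)]
      nlinarith
    calc z₀.im / (2 * (M + 1)) * (r k * ‖z‖) = r k * (z₀.im / (2 * (M + 1)) * ‖z‖) := by ring
      _ < r k * z.im := by gcongr

section
variable {d : ℕ → ℕ} {R C C1 : ℝ} {q : ℕ → Polynomial ℂ} {a : ℕ → ℂ} {X : ℕ → ℂ → ℂ}
  {δ₀ : ℝ} {N dm : ℕ}

theorem Loc.absurd (F : Loc d R C C1 q a X δ₀ N dm) : False := by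
  obtain ⟨δ₁, ν, hδ₁, hδ01, hA, hB, hmono, hrec⟩ := F.step2
  have hp := F.par
  have hR := hp.Rpos
  have hdm1 : 1 ≤ dm := by have := hp.hd 0; have := F.hdm 0; omega
  set Rec : Set ℕ := {k | ∀ i ≤ k, Dg d (ν k) ≤ 128 ^ i * Dg d (ν (k - i))} with hRec
  have hne : (atTop ⊓ 𝓟 Rec : Filter ℕ).NeBot := frequently_mem_iff_neBot.mp hrec
  set U : Ultrafilter ℕ := Ultrafilter.of (atTop ⊓ 𝓟 Rec) with hU
  have hUle : (U : Filter ℕ) ≤ atTop ⊓ 𝓟 Rec := Ultrafilter.of_le _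
  have hUtop : (U : Filter ℕ) ≤ atTop := hUle.trans inf_le_left
  have hURec : ∀ᶠ k in (U : Filter ℕ), k ∈ Rec := le_principal_iff.mp (hUle.trans inf_le_right)
  obtain ⟨a0, -, ha0⟩ := (Ultrafilter.eventually_exists_mem_iff (f := U)
    (P := fun a0 k => (ν k + 1) % N = a0) (Set.finite_Iio N)).mp
    (Eventually.of_forall fun k => ⟨_, Nat.mod_lt _ F.hN, rfl⟩)
  have hper : ∀ {α : Type} (g : ℕ → α), Periodic g N → ∀ k, (ν k + 1) % N = a0 → ∀ j,
      g (ν k + 1 + j) = g (a0 + j) := by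
    intro α g hg k hk j
    rw [← hg.map_mod_nat (ν k + 1 + j), ← hg.map_mod_nat (a0 + j), ← hk, Nat.mod_add_mod]
  set r : ℕ → ℝ := fun k => δ₁ / 16 ^ k with hr
  have hr0 : ∀ k, 0 < r k := fun k => by positivity
  have hrt : Tendsto r atTop (𝓝 0) :=
    tendsto_const_nhds.div_atTop (tendsto_pow_atTop_atTop_of_one_lt (by norm_num))
  have hrU : Tendsto r U (𝓝 0) := hrt.mono_left hUtop
  set Z : ℕ → ℕ → ℂ → ℂ := fun k j ζ => X (ν k + 1 + j) (r k * ζ) with hZ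
  set d' : ℕ → ℕ := fun j => d (a0 + j) with hd'
  have hp' : Par d' R C := ⟨fun m => hp.hd _, hp.hC, hp.hR⟩
  have hin : ∀ ρ : ℝ, ∀ᶠ k in (U : Filter ℕ), ∀ ζ ∈ ball (0 : ℂ) ρ, (r k : ℂ) * ζ ∈ ball (0 : ℂ) δ₀ := by
    intro ρ
    have h1 : ∀ᶠ k in (U : Filter ℕ), r k < δ₀ / (|ρ| + 1) :=
      hrU.eventually (gt_mem_nhds (div_pos F.hδ (by positivity)))
    filter_upwards [h1] with k hk ζ hζ
    rw [mem_ball_zero_iff] at hζ ⊢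
    rw [lt_div_iff₀ (by positivity)] at hk
    have hk0 := hr0 k
    rw [norm_mul, Complex.norm_real, Real.norm_eq_abs, abs_of_pos hk0]
    have := le_abs_self ρ
    refine lt_of_le_of_lt ?_ hk
    gcongr
    linarith
  have hdiff : ∀ ρ : ℝ, ∀ᶠ k in (U : Filter ℕ), ∀ m, DifferentiableOn ℂ (Z k m) (ball 0 ρ) := by
    intro ρ
    filter_upwards [hin ρ] with k hk m
    exact (F.diff _).comp (by fun_prop) hk
  have hadm : ∀ ρ : ℝ, ∀ᶠ k in (U : Filter ℕ), ∀ ζ ∈ ball (0 : ℂ) ρ,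
      Adm d' R C (fun m => Z k m ζ) := by
    intro ρ
    filter_upwards [hin ρ, ha0] with k hk h0 ζ hζ
    have := (F.adm _ (hk ζ hζ)).shift (ν k + 1)
    convert this using 1
    funext j
    exact (hper d F.dper k h0 j).symm
  set L := Real.log (2 * R) + C with hL
  have hlog : 0 < Real.log (2 * R) := Real.log_pos (by have := F.par.R_gt_one; linarith)
  have hL0 : 0 < L := by have := F.par.hC; linarith
  have hbd : ∀ (i j : ℕ), ∀ᶠ k in (U : Filter ℕ), ∀ ζ : ℂ, ‖ζ‖ ≤ 16 ^ i →
      ‖Z k j ζ‖ ≤ Real.exp (dm ^ (j + 1) * 128 ^ i * L) := by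
    intro i j
    filter_upwards [hURec, hUtop (eventually_ge_atTop i)] with k hk hki ζ hζ
    have hk' := hk i hki
    have hk0 := hr0 k
    have hnorm : ‖(r k : ℂ) * ζ‖ ≤ δ₁ / 16 ^ (k - i) := by
      rw [norm_mul, Complex.norm_real, Real.norm_eq_abs, abs_of_pos hk0]
      calc r k * ‖ζ‖ ≤ r k * 16 ^ i := by gcongr
        _ = δ₁ / 16 ^ (k - i) := by
          have : (16 : ℝ) ^ k = 16 ^ (k - i) * 16 ^ i := by rw [← pow_add]; congr 1; omega
          simp only [hr, this]; field_simp
    have hball : (r k : ℂ) * ζ ∈ ball (0 : ℂ) δ₀ := by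
      rw [mem_ball_zero_iff]
      have : δ₁ / 16 ^ (k - i) ≤ δ₁ := div_le_self hδ₁.le (one_le_pow₀ (by norm_num))
      linarith
    have h1 := bb_le_two hp (x := fun m => X m ((r k : ℂ) * ζ)) (m := ν (k - i)) (hA _ _ hnorm)
    have hle : ν (k - i) ≤ ν k + (1 + j) := (hmono (Nat.sub_le k i)).trans (Nat.le_add_right _ _)
    have h2 := (F.adm _ hball).growth hp hle
    have h3 : Dg d (ν k + (1 + j)) / Dg d (ν (k - i)) ≤ dm ^ (j + 1) * 128 ^ i := by
      rw [div_le_iff₀ (hp.Dg_pos _)]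
      refine (Dg_add_le hp F.hdm _ _).trans ?_
      rw [add_comm 1 j, mul_assoc]
      gcongr
    have h4 : bb R (fun m => X m ((r k : ℂ) * ζ)) (ν k + (1 + j)) ≤ dm ^ (j + 1) * 128 ^ i * L := by
      have h5 : Dg d (ν k + (1 + j)) / Dg d (ν (k - i)) *
          (bb R (fun m => X m ((r k : ℂ) * ζ)) (ν (k - i)) + C) ≤ dm ^ (j + 1) * 128 ^ i * L := by
        have := bb_pos hp (ν (k - i)) (x := fun m => X m ((r k : ℂ) * ζ))
        have := hp.hC
        refine mul_le_mul h3 (by linarith) (by linarith) (by positivity)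
      have := hp.hC
      linarith
    have h6 : 0 < max ‖X (ν k + (1 + j)) ((r k : ℂ) * ζ)‖ R := lt_max_of_lt_right hR
    simp only [hZ]
    rw [add_assoc]
    refine (le_max_left _ R).trans ?_
    rw [← Real.exp_log h6]
    exact Real.exp_le_exp.mpr h4
  have hmontel : ∀ j, ∃ Y : ℂ → ℂ, TendstoLocallyUniformly (fun k => Z k j) Y (U : Filter ℕ) ∧
      Differentiable ℂ Y := by
    intro j
    refine montel U (fun k => Z k j) (fun ρ => (hdiff ρ).mono fun k hk => hk j) (fun ρ => ?_)
    obtain ⟨i, hi⟩ := pow_unbounded_of_one_lt ρ (show (1 : ℝ) < 16 by norm_num)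
    refine ⟨_, (hbd i j).mono fun k hk ζ hζ => hk ζ ?_⟩
    rw [mem_ball_zero_iff] at hζ
    linarith
  choose Y hYu hYd using hmontel
  have hY : ∀ m ζ, Tendsto (fun k => Z k m ζ) U (𝓝 (Y m ζ)) := fun m ζ =>
    (hYu m).tendsto_comp (hYd m ζ).continuousAt tendsto_const_nhds
  have hFam : Fam d' R C C1 (fun j => q (a0 + j)) (fun j => a (a0 + j)) Y := by
    refine ⟨hp', F.hC1, hYd, ?_, ?_, ?_, ?_, fun j => F.hq _, fun j => F.ha _⟩
    · intro j ζ
      refine tendsto_nhds_unique (hY (j + 2) ζ) ?_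
      have h1 : Tendsto (fun k => (q (a0 + (j + 1))).eval (Z k (j + 1) ζ) - a (a0 + (j + 1)) * Z k j ζ)
          U (𝓝 ((q (a0 + (j + 1))).eval (Y (j + 1) ζ) - a (a0 + (j + 1)) * Y j ζ)) :=
        (((q (a0 + (j + 1))).continuous.tendsto _).comp (hY (j + 1) ζ)).sub ((hY j ζ).const_mul _)
      refine h1.congr' ?_
      filter_upwards [hin (‖ζ‖ + 1), ha0] with k hk h0
      have h2 := F.recu (ν k + 1 + j) _ (hk ζ (by simp))
      have h3 := hper q F.qper k h0 (j + 1)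
      have h4 := hper a F.aper k h0 (j + 1)
      rw [← h3, ← h4]
      exact h2.symm
    · intro ζ
      refine Adm.lim (U := U) (z := fun k m => Z k m ζ) ?_ (fun m => hY m ζ)
      filter_upwards [hadm (‖ζ‖ + 1)] with k hk using hk ζ (by simp)
    · intro s j
      obtain ⟨e, he, hef⟩ := F.fill s
      have hr' : Tendsto r U (𝓝[>] 0) :=
        tendsto_nhdsWithin_iff.mpr ⟨hrU, Eventually.of_forall hr0⟩
      have h1 := (hYu j).tendsto_comp (hYd j s).continuousAt (he.comp hr')
      refine le_of_tendsto h1.norm ?_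
      filter_upwards [hr'.eventually hef] with k hk using hk _
    · intro j
      refine ⟨dm ^ (j + 1) * 128 * L, fun ζ => ?_⟩
      obtain ⟨i, hi1, hi2⟩ := exists_nat_pow_near (x := 1 + ‖ζ‖) (y := 16)
        (by linarith [norm_nonneg ζ]) (by norm_num)
      have h1 : ‖Y j ζ‖ ≤ Real.exp (dm ^ (j + 1) * 128 ^ (i + 1) * L) := by
        refine le_of_tendsto (hY j ζ).norm ?_
        filter_upwards [hbd (i + 1) j] with k hk using hk ζ (by linarith)
      refine h1.trans (Real.exp_le_exp.mpr ?_)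
      have h2 : (128 : ℝ) ^ i = ((16 : ℝ) ^ i) ^ (7 / 4 : ℝ) := by
        have h16 : (16 : ℝ) ^ (7 / 4 : ℝ) = 128 := by
          rw [show (16 : ℝ) = 2 ^ (4 : ℝ) by norm_num, ← Real.rpow_mul (by norm_num)]
          norm_num
        rw [← Real.rpow_natCast, ← Real.rpow_natCast, ← Real.rpow_mul (by norm_num),
          mul_comm, Real.rpow_mul (by norm_num), h16]
      have h3 : (128 : ℝ) ^ i ≤ (1 + ‖ζ‖) ^ (7 / 4 : ℝ) := by
        rw [h2]; exact Real.rpow_le_rpow (by positivity) hi1 (by norm_num)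
      calc (dm : ℝ) ^ (j + 1) * 128 ^ (i + 1) * L = dm ^ (j + 1) * 128 * L * 128 ^ i := by ring
        _ ≤ _ := by gcongr
  -- escape transfers
  have hshift : ∀ k : ℕ, ∀ ζ : ℂ, (r k : ℂ) * ζ ∈ ball (0 : ℂ) δ₀ →
      (∃ m, R < ‖X m (r k * ζ)‖) → ∃ m, R < ‖Z k m ζ‖ := by
    rintro k ζ hζ ⟨m, hm⟩
    exact ⟨m, (F.adm _ hζ).esc_mono hp (Nat.le_add_left m (ν k + 1)) hm⟩
  have heup : ∀ K : Set ℂ, K ⊆ HH → IsCompact K →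
      ∀ᶠ k in (U : Filter ℕ), ∀ z ∈ K, ∃ m, R < ‖Z k m z‖ := by
    intro K hK hc
    obtain ⟨M, hM⟩ := hc.isBounded.subset_ball (0 : ℂ)
    filter_upwards [cone_compact F.up hrU hr0 hK hc, hin M] with k hk1 hk2 z hz
    exact hshift k z (hk2 z (hM hz)) (hk1 z hz)
  have hupdich : ∀ ζ₂ ∈ HH, ∀ m, R < ‖Y m ζ₂‖ → ∀ w ∈ HH, ∃ m', R < ‖Y m' w‖ :=
    fun ζ₂ h2 m hm => side_dichotomy hp' U Z Y hdiff hadm heup hY h2 hm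
  have hneg : ∀ ζ : ℂ, ζ.im < 0 ↔ -ζ ∈ HH := fun ζ => by simp [HH]
  have hlow : (∀ ζ₂ : ℂ, ζ₂.im < 0 → ∀ m, R < ‖Y m ζ₂‖ → ∀ w : ℂ, w.im < 0 → ∃ m', R < ‖Y m' w‖) := by
    intro ζ₂ h2 m hm
    rcases F.low with hl | hl
    · have hcone : ∀ ε : ℝ, 0 < ε → ∃ δ : ℝ, 0 < δ ∧ ∀ ζ : ℂ, ‖ζ‖ < δ → ε * ‖ζ‖ < ζ.im →
          ∃ m, R < ‖X m (-ζ)‖ := by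
        intro ε hε
        obtain ⟨δ, hδ, h⟩ := hl ε hε
        exact ⟨δ, hδ, fun ζ h1 h3 => h (-ζ) (by simpa using h1) (by simpa using h3)⟩
      have hsd := side_dichotomy hp' U (fun k m ζ => Z k m (-ζ)) (fun m ζ => Y m (-ζ))
        (fun ρ => (hdiff ρ).mono fun k hk m => (hk m).comp (by fun_prop)
          (fun ζ hζ => by simpa using hζ))
        (fun ρ => (hadm ρ).mono fun k hk ζ hζ => hk (-ζ) (by simpa using hζ))
        (by
          intro K hK hc
          obtain ⟨M, hM⟩ := hc.isBounded.subset_ball (0 : ℂ)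
          filter_upwards [cone_compact hcone hrU hr0 hK hc, hin M] with k hk1 hk2 z hz
          have h1 := hk2 (-z) (by simpa using hM hz)
          exact hshift k (-z) h1 (by simpa using hk1 z hz))
        (fun m ζ => hY m (-ζ)) (ζ₂ := -ζ₂) ((hneg _).mp h2) (m := m) (by simpa using hm)
      intro w hw
      simpa using hsd (-w) ((hneg _).mp hw)
    · exfalso
      have hcone : ∀ ε : ℝ, 0 < ε → ∃ δ : ℝ, 0 < δ ∧ ∀ ζ : ℂ, ‖ζ‖ < δ → ε * ‖ζ‖ < ζ.im →
          ∀ m, ‖X m (-ζ)‖ ≤ R := by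
        intro ε hε
        obtain ⟨δ, hδ, h⟩ := hl ε hε
        exact ⟨δ, hδ, fun ζ h1 h3 => h (-ζ) (by simpa using h1) (by simpa using h3)⟩
      have h1 := cone_compact hcone hrU hr0 (K := {-ζ₂})
        (by simpa using (hneg _).mp h2) isCompact_singleton
      have h3 : ‖Y m ζ₂‖ ≤ R := by
        refine le_of_tendsto (hY m ζ₂).norm ?_
        filter_upwards [h1] with k hk
        simpa using hk (-ζ₂) rfl _
      linarith
  -- the nontrivial point
  have hzk : ∀ k, ∃ ζ : ℂ, ζ ∈ closedBall (0 : ℂ) 1 ∧ 2 * R < ‖Z k 0 ζ‖ := by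
    intro k
    obtain ⟨ζ, h1, h2⟩ := hB k
    have hk0 := hr0 k
    refine ⟨ζ / r k, ?_, ?_⟩
    · rw [mem_closedBall_zero_iff, norm_div, Complex.norm_real, Real.norm_eq_abs, abs_of_pos hk0,
        div_le_one hk0]
      exact h1
    · have : (r k : ℂ) ≠ 0 := by exact_mod_cast hk0.ne'
      simp only [hZ, add_zero]
      rwa [mul_div_cancel₀ _ this]
  choose ζk hζ1 hζ2 using hzk
  obtain ⟨ζs, -, hζs⟩ := (isCompact_closedBall (0 : ℂ) 1).ultrafilter_le_nhds (U.map ζk) (by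
    rw [le_principal_iff]
    change ∀ᶠ k in (U : Filter ℕ), ζk k ∈ closedBall (0 : ℂ) 1
    exact Eventually.of_forall hζ1)
  have hζs' : Tendsto ζk U (𝓝 ζs) := hζs
  have hbig : 2 * R ≤ ‖Y 0 ζs‖ := by
    refine ge_of_tendsto ((hYu 0).tendsto_comp (hYd 0 ζs).continuousAt hζs').norm ?_
    exact Eventually.of_forall fun k => (hζ2 k).le
  have hbig' : R < ‖Y 0 ζs‖ := by linarith
  rcases lt_trichotomy ζs.im 0 with h | h | h
  · have hall := hlow ζs h 0 hbig'
    refine (Fam.neg hFam).absurd (fun ζ hζ => hall (-ζ) (by simpa [HH] using hζ)) ?_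
    by_cases hex : ∃ ζ ∈ HH, ∃ m, R < ‖Y m ζ‖
    · obtain ⟨ζ₂, hζ₂, m, hm⟩ := hex
      exact Or.inl fun ζ hζ => hupdich ζ₂ hζ₂ m hm (-ζ) ((hneg _).mp hζ)
    · push Not at hex
      exact Or.inr fun ζ hζ j => hex (-ζ) ((hneg _).mp hζ) j
  · have h1 : ζs = (ζs.re : ℂ) := Complex.ext (by simp) (by simp [h])
    have := hFam.real ζs.re 0
    rw [← h1] at this
    linarith
  · refine hFam.absurd (hupdich ζs h 0 hbig') ?_
    by_cases hex : ∃ ζ : ℂ, ζ.im < 0 ∧ ∃ m, R < ‖Y m ζ‖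
    · obtain ⟨ζ₂, hζ₂, m, hm⟩ := hex
      exact Or.inl (hlow ζ₂ hζ₂ m hm)
    · push Not at hex
      exact Or.inr hex

end

end JS

namespace JS
open Metric ComplexConjugate

lemma poly_bound (r : Polynomial ℂ) {n : ℕ} (hn : r.natDegree ≤ n) :
    ∃ M : ℝ, 0 ≤ M ∧ ∀ (x : ℂ) (T : ℝ), 1 ≤ T → ‖x‖ ≤ T → ‖r.eval x‖ ≤ M * T ^ n := by
  refine ⟨∑ i ∈ Finset.range (n + 1), ‖r.coeff i‖, Finset.sum_nonneg fun _ _ => norm_nonneg _, ?_⟩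
  intro x T hT hx
  rw [Polynomial.eval_eq_sum_range' (Nat.lt_succ_of_le hn), Finset.sum_mul]
  refine norm_sum_le_of_le _ fun i hi => ?_
  rw [norm_mul, norm_pow]
  have h1 : ‖x‖ ^ i ≤ T ^ i := by gcongr
  have h2 : T ^ i ≤ T ^ n := pow_le_pow_right₀ hT (by have := Finset.mem_range.mp hi; omega)
  exact mul_le_mul_of_nonneg_left (h1.trans h2) (norm_nonneg _)

/-- elementary estimates for one generalized Henon map -/
def HC (p : Polynomial ℂ) (a : ℂ) (C C1 R : ℝ) : Prop :=
  (∀ x y : ℂ, R ≤ ‖x‖ → ‖y‖ ≤ ‖x‖ → Real.exp (-C) * ‖x‖ ^ p.natDegree ≤ ‖p.eval x - a * y‖) ∧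
  (∀ (x y : ℂ) (T : ℝ), R ≤ T → ‖x‖ ≤ T → ‖y‖ ≤ T → ‖p.eval x - a * y‖ ≤ Real.exp C * T ^ p.natDegree) ∧
  (∀ x : ℂ, R ≤ ‖x‖ →
    ‖x * p.derivative.eval x - p.natDegree * p.eval x‖ ≤ C1 * ‖x‖ ^ (p.natDegree - 1)) ∧ ‖a‖ ≤ C1

lemma HC.mono {p : Polynomial ℂ} {a : ℂ} {C C1 R C' C1' R' : ℝ} (h : HC p a C C1 R)
    (hC : C ≤ C') (hC1 : C1 ≤ C1') (hR : R ≤ R') (hR0 : 0 ≤ R) : HC p a C' C1' R' := by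
  obtain ⟨h1, h2, h3, h4⟩ := h
  refine ⟨fun x y hx hy => ?_, fun x y T hT hx hy => ?_, fun x hx => ?_, h4.trans hC1⟩
  · refine le_trans ?_ (h1 x y (hR.trans hx) hy)
    gcongr
  · refine (h2 x y T (hR.trans hT) hx hy).trans ?_
    have : 0 ≤ T := by linarith
    gcongr
  · refine (h3 x (hR.trans hx)).trans ?_
    gcongr

lemma HC.exists (p : Polynomial ℂ) (a : ℂ) (hp : 2 ≤ p.natDegree) :
    ∃ C C1 R : ℝ, 0 ≤ C ∧ 0 ≤ C1 ∧ 1 ≤ R ∧ HC p a C C1 R := by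
  set n := p.natDegree with hn
  have hp0 : p ≠ 0 := by rintro rfl; simp at hn; omega
  set lc := p.leadingCoeff with hlc
  have hlc0 : 0 < ‖lc‖ := by simpa [hlc] using hp0
  have he : p.eraseLead.natDegree ≤ n - 1 := Polynomial.eraseLead_natDegree_le p
  obtain ⟨M, hM0, hM⟩ := poly_bound p.eraseLead he
  obtain ⟨M2, hM20, hM2⟩ := poly_bound p (le_refl p.natDegree)
  have he2 : (Polynomial.X * p.derivative - Polynomial.C (n : ℂ) * p).natDegree ≤ n - 1 := by
    rw [Polynomial.natDegree_le_iff_coeff_eq_zero]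
    intro k hk
    rw [Polynomial.coeff_sub, Polynomial.coeff_C_mul]
    obtain ⟨k', rfl⟩ : ∃ k', k = k' + 1 := ⟨k - 1, by omega⟩
    rw [Polynomial.coeff_X_mul, Polynomial.coeff_derivative]
    rcases (show n ≤ k' + 1 by omega).eq_or_lt with h | h
    · have : (n : ℂ) = k' + 1 := by rw [h]; push_cast; ring
      rw [this]; ring
    · rw [Polynomial.coeff_eq_zero_of_natDegree_lt h]; simp
  obtain ⟨M3, hM30, hM3⟩ := poly_bound _ he2
  have hev : ∀ x : ℂ, p.eval x = p.eraseLead.eval x + lc * x ^ n := by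
    intro x
    have h := congrArg (Polynomial.eval x) (Polynomial.eraseLead_add_C_mul_X_pow p)
    rw [Polynomial.eval_add, Polynomial.eval_mul, Polynomial.eval_C, Polynomial.eval_pow,
      Polynomial.eval_X] at h
    exact h.symm
  refine ⟨|Real.log (‖lc‖ / 2)| + Real.log (M2 + ‖a‖ + 1), M3 + ‖a‖, 2 * (M + ‖a‖) / ‖lc‖ + 1, ?_, by positivity, ?_, ?_⟩
  · have : 0 ≤ Real.log (M2 + ‖a‖ + 1) := Real.log_nonneg (by linarith [norm_nonneg a])
    positivity
  · have : 0 ≤ 2 * (M + ‖a‖) / ‖lc‖ := by positivity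
    linarith
  have hq0 : 0 ≤ 2 * (M + ‖a‖) / ‖lc‖ := by positivity
  have hl0 : 0 ≤ Real.log (M2 + ‖a‖ + 1) := Real.log_nonneg (by linarith [norm_nonneg a])
  refine ⟨?_, ?_, ?_, ?_⟩
  · intro x y hx hy
    have hx1 : 1 ≤ ‖x‖ := by linarith
    have h1 := hM x ‖x‖ hx1 le_rfl
    have h2 : ‖lc‖ * ‖x‖ ^ n ≤ ‖p.eval x - a * y‖ + M * ‖x‖ ^ (n - 1) + ‖a‖ * ‖x‖ ^ (n - 1) := by
      have e : lc * x ^ n = (p.eval x - a * y) - p.eraseLead.eval x + a * y := by rw [hev]; ring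
      calc ‖lc‖ * ‖x‖ ^ n = ‖lc * x ^ n‖ := by simp
        _ ≤ ‖p.eval x - a * y‖ + ‖p.eraseLead.eval x‖ + ‖a * y‖ := by
          rw [e]; exact (norm_add_le _ _).trans (by gcongr; exact norm_sub_le _ _)
        _ ≤ _ := by
          rw [norm_mul]
          have : ‖y‖ ≤ ‖x‖ ^ (n - 1) := hy.trans (le_self_pow₀ hx1 (by omega))
          gcongr
    have h3 : (M + ‖a‖) * ‖x‖ ^ (n - 1) ≤ ‖lc‖ / 2 * ‖x‖ ^ n := by
      have : ‖x‖ ^ n = ‖x‖ * ‖x‖ ^ (n - 1) := by rw [← pow_succ']; congr 1; omega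
      rw [this, ← mul_assoc]
      gcongr
      have h5 : 2 * (M + ‖a‖) / ‖lc‖ ≤ ‖x‖ := by linarith
      rw [div_le_iff₀ hlc0] at h5
      linarith
    have h4 : Real.exp (-(|Real.log (‖lc‖ / 2)| + Real.log (M2 + ‖a‖ + 1))) ≤ ‖lc‖ / 2 := by
      rw [← Real.le_log_iff_exp_le (by positivity)]
      linarith [neg_abs_le (Real.log (‖lc‖ / 2))]
    calc _ ≤ ‖lc‖ / 2 * ‖x‖ ^ n := by gcongr
      _ ≤ _ := by linarith
  · intro x y T hT hx hy
    have hT1 : 1 ≤ T := by linarith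
    have h1 := hM2 x T hT1 hx
    have h2 : ‖p.eval x - a * y‖ ≤ (M2 + ‖a‖) * T ^ n := by
      refine (norm_sub_le _ _).trans ?_
      rw [norm_mul, add_mul]
      have : ‖y‖ ≤ T ^ n := hy.trans (le_self_pow₀ hT1 (by omega))
      gcongr
    refine h2.trans ?_
    gcongr
    have h4 : M2 + ‖a‖ + 1 ≤ Real.exp (|Real.log (‖lc‖ / 2)| + Real.log (M2 + ‖a‖ + 1)) := by
      rw [← Real.log_le_iff_le_exp (by positivity)]
      linarith [abs_nonneg (Real.log (‖lc‖ / 2))]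
    linarith
  · intro x hx
    have h1 := hM3 x ‖x‖ (by linarith) le_rfl
    simp only [Polynomial.eval_sub, Polynomial.eval_mul, Polynomial.eval_X, Polynomial.eval_C] at h1
    refine h1.trans ?_
    gcongr
    linarith [norm_nonneg a]
  · linarith

lemma adm_of_rec {d : ℕ → ℕ} {R C C1 : ℝ} (hp : Par d R C) {q : ℕ → Polynomial ℂ} {a : ℕ → ℂ}
    (hd : ∀ j, d j = (q j).natDegree) (hHC : ∀ j, HC (q j) (a j) C C1 R) {x : ℕ → ℂ}
    (hrec : ∀ j, x (j + 2) = (q (j + 1)).eval (x (j + 1)) - a (j + 1) * x j)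
    (h0 : ‖x 0‖ ≤ R) (h1 : ‖x 1‖ ≤ R) : Adm d R C x := by
  have hR := hp.R_gt_one
  have hlow : ∀ j, ‖x j‖ ≤ max ‖x (j + 1)‖ R → R < ‖x (j + 1)‖ →
      Real.exp (-C) * ‖x (j + 1)‖ ^ d (j + 1) ≤ ‖x (j + 2)‖ := by
    intro j hj hR'
    rw [hrec, hd]
    exact (hHC (j + 1)).1 _ _ hR'.le (by rwa [max_eq_left hR'.le] at hj)
  have hinv : ∀ j, ‖x j‖ ≤ max ‖x (j + 1)‖ R := by
    intro j
    induction j with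
    | zero => exact h0.trans (le_max_right _ _)
    | succ j ih =>
      by_cases h : ‖x (j + 1)‖ ≤ R
      · exact h.trans (le_max_right _ _)
      push Not at h
      refine le_trans ?_ (le_max_left _ _)
      refine le_trans ?_ (hlow j ih h)
      have hx1 : 1 ≤ ‖x (j + 1)‖ := by linarith
      have e1 : ‖x (j + 1)‖ ^ 2 ≤ ‖x (j + 1)‖ ^ d (j + 1) := pow_le_pow_right₀ hx1 (hp.hd _)
      have e2 : 1 ≤ Real.exp (-C) * ‖x (j + 1)‖ := by
        have : Real.exp C ≤ ‖x (j + 1)‖ := by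
          refine le_trans ?_ (hp.hR.trans h.le)
          exact Real.exp_le_exp.mpr (by linarith [hp.hC])
        calc 1 = Real.exp (-C) * Real.exp C := by rw [← Real.exp_add]; simp
          _ ≤ _ := by gcongr
      calc ‖x (j + 1)‖ ≤ (Real.exp (-C) * ‖x (j + 1)‖) * ‖x (j + 1)‖ := le_mul_of_one_le_left (by linarith) e2
        _ = Real.exp (-C) * ‖x (j + 1)‖ ^ 2 := by ring
        _ ≤ _ := by gcongr
  constructor
  · intro m
    rcases m with _ | m
    · refine h1.trans ?_
      have e1 : 1 ≤ max ‖x 0‖ R := le_max_of_le_right (by linarith)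
      calc R ≤ max ‖x 0‖ R := le_max_right _ _
        _ ≤ max ‖x 0‖ R ^ d 0 := le_self_pow₀ e1 (by have := hp.hd 0; omega)
        _ ≤ _ := le_mul_of_one_le_left (by positivity) (Real.one_le_exp hp.hC)
    · rw [hrec, hd]
      exact (hHC (m + 1)).2.1 _ _ _ (le_max_right _ _) (le_max_left _ _) (hinv m)
  · intro m hm
    rcases m with _ | m
    · exact absurd hm (not_lt.mpr h0)
    · exact hlow m (hinv m) hm

end JS

namespace JS
open Metric ComplexConjugate

/-- The recurrence attached to the restriction of a loxodromic map to a disk. -/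
structure Red (S : Set ℂ) (q : ℕ → Polynomial ℂ) (a : ℕ → ℂ) (N dm : ℕ) (C C1 R₀ : ℝ)
    (X : ℕ → ℂ → ℂ) : Prop where
  hC : 0 ≤ C
  hC1 : 0 ≤ C1
  hN : 0 < N
  qper : Periodic q N
  aper : Periodic a N
  hd : ∀ j, 2 ≤ (q j).natDegree
  hdm : ∀ j, (q j).natDegree ≤ dm
  hR₀ : 1 ≤ R₀
  hHC : ∀ j, HC (q j) (a j) C C1 R₀
  ha : ∀ j, a j ≠ 0
  diff : ∀ m, DifferentiableOn ℂ (X m) unitDisk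
  recu : ∀ j ζ, X (j + 2) ζ = (q (j + 1)).eval (X (j + 1) ζ) - a (j + 1) * X j ζ
  mem : ∀ ζ ∈ unitDisk, ζ ∈ S ↔ ∃ B : ℝ, ∀ m, ‖X m ζ‖ ≤ B

lemma mvpoly_diff (P : MvPolynomial (Fin 2) ℂ) :
    Differentiable ℂ (fun z : ℂ × ℂ => MvPolynomial.eval ![z.1, z.2] P) := by
  induction P using MvPolynomial.induction_on with
  | C c => simp
  | add p q hp hq => simp only [map_add]; exact hp.add hq
  | mul_X p i hp =>
    simp only [map_mul, MvPolynomial.eval_X]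
    refine hp.mul ?_
    fin_cases i
    · exact differentiable_fst
    · exact differentiable_snd

lemma polymap_diff {F : ℂ × ℂ → ℂ × ℂ} (h : IsPolyMap F) : Differentiable ℂ F := by
  obtain ⟨P, Q, h⟩ := h
  have : F = fun z => (MvPolynomial.eval ![z.1, z.2] P, MvPolynomial.eval ![z.1, z.2] Q) := funext h
  rw [this]
  exact (mvpoly_diff P).prodMk (mvpoly_diff Q)

lemma bdd_comp {ι : Type} {F : ℂ × ℂ → ℂ × ℂ} (hF : Continuous F) {x : ι → ℂ × ℂ}
    (h : ∃ B : ℝ, ∀ n, ‖x n‖ ≤ B) : ∃ B : ℝ, ∀ n, ‖F (x n)‖ ≤ B := by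
  obtain ⟨B, hB⟩ := h
  obtain ⟨B', hB'⟩ := ((isCompact_closedBall (0 : ℂ × ℂ) B).image hF).isBounded.exists_norm_le
  exact ⟨B', fun n => hB' _ ⟨x n, by simpa using hB n, rfl⟩⟩

lemma foldr_comp_eq (hs : List (ℂ × ℂ → ℂ × ℂ)) (w : ℂ × ℂ) :
    hs.foldr (fun h acc => h ∘ acc) id w = hs.reverse.foldl (fun w h => h w) w := by
  rw [List.foldl_reverse]
  induction hs with
  | nil => rfl
  | cons h t ih => simp only [List.foldr_cons, comp_apply, ih]

/-- the orbit through the individual factors -/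
def zz (l : List (ℂ × ℂ → ℂ × ℂ)) : ℕ → ℂ × ℂ → ℂ × ℂ
  | 0, w => w
  | n + 1, w => (l.getD (n % l.length) id) (zz l n w)

lemma zz_take (l : List (ℂ × ℂ → ℂ × ℂ)) (w : ℂ × ℂ) (n : ℕ) (hn : n ≤ l.length) :
    zz l n w = (l.take n).foldl (fun w h => h w) w := by
  induction n with
  | zero => simp [zz]
  | succ n ih =>
    have hn' : n < l.length := hn
    rw [zz, Nat.mod_eq_of_lt hn', ih hn'.le, List.take_succ_eq_append_getElem hn', List.foldl_append,
      List.getD_eq_getElem _ _ hn']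
    rfl

lemma zz_add (l : List (ℂ × ℂ → ℂ × ℂ)) (w : ℂ × ℂ) (k n : ℕ) :
    zz l (l.length * k + n) w = zz l n (zz l (l.length * k) w) := by
  induction n with
  | zero => simp [zz]
  | succ n ih =>
    rw [← add_assoc, zz, zz, ih, Nat.mul_add_mod]

lemma zz_iter (l : List (ℂ × ℂ → ℂ × ℂ)) (w : ℂ × ℂ) (k : ℕ) :
    zz l (l.length * k) w = (fun w => l.foldl (fun w h => h w) w)^[k] w := by
  induction k with
  | zero => simp [zz]
  | succ k ih =>
    rw [mul_add, mul_one, zz_add, ih, iterate_succ_apply', zz_take _ _ _ le_rfl, List.take_length]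

lemma zz_prop (l : List (ℂ × ℂ → ℂ × ℂ)) {P : (ℂ × ℂ → ℂ × ℂ) → Prop} (hid : P id)
    (hcomp : ∀ f g, P f → P g → P (f ∘ g)) (hl : ∀ h ∈ l, P h) (n : ℕ) : P (zz l n) := by
  induction n with
  | zero => exact hid
  | succ n ih =>
    refine hcomp (l.getD (n % l.length) id) (zz l n) ?_ ih
    rcases eq_or_ne l [] with rfl | hne
    · simpa using hid
    · have : n % l.length < l.length := Nat.mod_lt _ (List.length_pos_of_ne_nil hne)
      rw [List.getD_eq_getElem _ _ this]
      exact hl _ (List.getElem_mem this)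

theorem reduction {f : ℂ × ℂ → ℂ × ℂ} {γ : ℂ → ℂ × ℂ} (hf : IsLoxodromic f)
    (hγ : DifferentiableOn ℂ γ unitDisk) :
    ∃ q a N dm C C1 R₀ X, Red {z | z ∈ unitDisk ∧ γ z ∈ Kplus f} q a N dm C C1 R₀ X := by
  obtain ⟨-, u, uinv, hs, hu, hu1, hu2, hsne, hH, hfz⟩ := hf
  obtain ⟨hup, G, hG, hG1, hG2⟩ := hu
  have hud : Differentiable ℂ u := polymap_diff hup
  have huinv : uinv = G := by
    funext z
    rw [← hu1 (G z), hG2]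
  have huid : Differentiable ℂ uinv := by rw [huinv]; exact polymap_diff hG
  set l := hs.reverse with hl
  set N := l.length with hN
  have hN0 : 0 < N := by rw [hN, hl]; simpa using List.length_pos_of_ne_nil hsne
  set g : ℂ × ℂ → ℂ × ℂ := fun w => l.foldl (fun w h => h w) w with hg
  have hfg : ∀ z, f z = uinv (g (u z)) := fun z => by rw [hfz, foldr_comp_eq]
  have hfn : ∀ n z, f^[n] z = uinv (g^[n] (u z)) := by
    intro n z
    induction n with
    | zero => simp [hu1]
    | succ n ih => rw [iterate_succ_apply', ih, hfg, hu2, iterate_succ_apply']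
  have hgn : ∀ n z, g^[n] (u z) = u (f^[n] z) := fun n z => by rw [hfn, hu2]
  have hlH : ∀ h ∈ l, IsHenon h := fun h hh => hH h (by simpa [hl] using hh)
  have hPA : ∀ i : ℕ, ∃ (p : Polynomial ℂ) (a : ℂ), a ≠ 0 ∧ 2 ≤ p.natDegree ∧
      ∀ z : ℂ × ℂ, l.getD (i % N) id z = (Polynomial.eval z.1 p - a * z.2, z.1) := by
    intro i
    have : i % N < l.length := Nat.mod_lt _ hN0
    rw [List.getD_eq_getElem _ _ this]
    exact hlH _ (List.getElem_mem this)
  choose P A hA0 hPd hPA using hPA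
  choose C C1 R hC hC1 hR hHC using fun i => HC.exists (P i) (A i) (hPd i)
  have hlt : ∀ j, (j + (N - 1)) % N ∈ Finset.range N := fun j => Finset.mem_range.mpr (Nat.mod_lt _ hN0)
  have hHd : ∀ h ∈ l, Differentiable ℂ h := by
    intro h hh
    obtain ⟨p, a, -, -, hpa⟩ := hlH h hh
    have : h = fun z => (Polynomial.eval z.1 p - a * z.2, z.1) := funext hpa
    rw [this]
    have := p.differentiable
    fun_prop
  have hzd : ∀ n, Differentiable ℂ (zz l n) := fun n =>
    zz_prop l differentiable_id (fun f g hf hg => hf.comp hg) hHd n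
  have hz1 : ∀ n w, (zz l (n + 1) w).2 = (zz l n w).1 := by
    intro n w
    rw [zz, hPA]
  have hz2 : ∀ n w, (zz l (n + 1) w).1 = (P (n % N)).eval (zz l n w).1 - A (n % N) * (zz l n w).2 := by
    intro n w
    have := hPA (n % N) (zz l n w)
    rw [Nat.mod_mod] at this
    rw [zz, this]
  refine ⟨fun j => P ((j + (N - 1)) % N), fun j => A ((j + (N - 1)) % N), N,
    ∑ i ∈ Finset.range N, (P i).natDegree, ∑ i ∈ Finset.range N, C i, ∑ i ∈ Finset.range N, C1 i,
    ∑ i ∈ Finset.range N, R i, fun m ζ => (zz l m (u (γ ζ))).2, ?_⟩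
  have hidx : ∀ j, (j + 1 + (N - 1)) % N = j % N := fun j => by
    rw [show j + 1 + (N - 1) = j + N by omega, Nat.add_mod_right]
  have hR0 : ∀ i, 0 ≤ R i := fun i => by linarith [hR i]
  refine ⟨Finset.sum_nonneg fun i _ => hC i, Finset.sum_nonneg fun i _ => hC1 i, hN0, ?_, ?_,
    fun j => hPd _, fun j => ?_, ?_, fun j => ?_, fun j => hA0 _, fun m => ?_, fun j ζ => ?_, ?_⟩
  · intro j
    simp only
    rw [show j + N + (N - 1) = j + (N - 1) + N by omega, Nat.add_mod_right]
  · intro j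
    simp only
    rw [show j + N + (N - 1) = j + (N - 1) + N by omega, Nat.add_mod_right]
  · exact Finset.single_le_sum (f := fun i => (P i).natDegree) (fun i _ => Nat.zero_le _) (hlt j)
  · exact (hR _).trans (Finset.single_le_sum (f := R) (fun i _ => hR0 i) (hlt 0))
  · exact (hHC _).mono (Finset.single_le_sum (f := C) (fun i _ => hC i) (hlt j))
      (Finset.single_le_sum (f := C1) (fun i _ => hC1 i) (hlt j))
      (Finset.single_le_sum (f := R) (fun i _ => hR0 i) (hlt j)) (hR0 _)
  · exact ((hzd m).comp hud).snd.comp_differentiableOn hγ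
  · simp only [hz1, hz2, hidx]
  · intro ζ hζ
    have hK : ζ ∈ {z | z ∈ unitDisk ∧ γ z ∈ Kplus f} ↔ γ ζ ∈ Kplus f :=
      ⟨fun h => h.2, fun h => ⟨hζ, h⟩⟩
    rw [hK]
    constructor
    · intro h
      have h1 : ∃ B : ℝ, ∀ n, ‖u (f^[n] (γ ζ))‖ ≤ B := bdd_comp hud.continuous h
      have h2 : ∀ i : ℕ, ∃ B : ℝ, ∀ n : ℕ, ‖zz l i (zz l (N * n) (u (γ ζ)))‖ ≤ B := by
        intro i
        refine bdd_comp (hzd i).continuous ?_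
        obtain ⟨B, hB⟩ := h1
        refine ⟨B, fun n => ?_⟩
        rw [zz_iter]
        change ‖g^[n] (u (γ ζ))‖ ≤ B
        rw [hgn]; exact hB n
      choose B hB using h2
      have hB0 : ∀ i, 0 ≤ B i := fun i => (norm_nonneg _).trans (hB i 0)
      refine ⟨∑ i ∈ Finset.range N, B i, fun m => (norm_snd_le _).trans ?_⟩
      rw [← Nat.div_add_mod m N, zz_add]
      exact (hB _ _).trans (Finset.single_le_sum (f := B) (fun i _ => hB0 i)
        (Finset.mem_range.mpr (Nat.mod_lt _ hN0)))
    · rintro ⟨B, hB⟩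
      have h1 : ∃ B : ℝ, ∀ n, ‖uinv (g^[n] (u (γ ζ)))‖ ≤ B := by
        refine bdd_comp huid.continuous ⟨B, fun n => ?_⟩
        have : g^[n] (u (γ ζ)) = zz l (N * n) (u (γ ζ)) := (zz_iter _ _ _).symm
        rw [this, Prod.norm_def]
        refine max_le ?_ (hB _)
        rw [← hz1]
        exact hB _
      obtain ⟨B, hB⟩ := h1
      exact ⟨B, fun n => by rw [hfn]; exact hB n⟩

end JS

namespace JS
open Metric ComplexConjugate

open MeasureTheory in
lemma sard_level {η : ℝ → ℂ} {K : NNReal} (hL : LipschitzOnWith K η (Icc 0 1)) (ℓ : ℂ →L[ℝ] ℝ) :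
    ∀ᵐ s : ℝ, ∀ t ∈ Icc (0 : ℝ) 1, ℓ (η t) = s → t ∈ Ioo (0 : ℝ) 1 ∧ ∃ v, HasDerivAt η v t ∧ ℓ v ≠ 0 := by
  have hφ : LipschitzOnWith (‖ℓ‖₊ * K) (fun t => ℓ (η t)) (Icc 0 1) :=
    ℓ.lipschitz.comp_lipschitzOnWith hL
  set A : Set ℝ := {t | t ∈ Icc (0 : ℝ) 1 ∧ ¬ DifferentiableWithinAt ℝ η (Icc 0 1) t} with hA
  have hA0 : volume A = 0 := by
    have := hL.ae_differentiableWithinAt_of_mem (μ := volume)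
    rw [ae_iff] at this
    convert this using 2
    ext t; simp [hA, and_assoc]
  set A' : Set ℝ := A ∪ {0, 1} with hA'
  have hA'0 : volume A' = 0 := by
    refine measure_union_null hA0 ?_
    exact (Set.toFinite _).measure_zero _
  have hA's : A' ⊆ Icc 0 1 := by
    rintro t (h | h)
    · exact h.1
    · rcases h with rfl | h
      · simp
      · rw [mem_singleton_iff.mp h]; simp
  have h1 : volume ((fun t => ℓ (η t)) '' A') = 0 := by
    have h := (hφ.mono hA's).hausdorffMeasure_image_le (d := 1) zero_le_one
    rw [hausdorffMeasure_real, hA'0] at h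
    simpa using h
  set B : Set ℝ := {t | HasDerivWithinAt (fun t => ℓ (η t)) 0 (Icc 0 1) t} ∩ Icc 0 1 with hB
  have h2 : volume ((fun t => ℓ (η t)) '' B) = 0 := by
    refine addHaar_image_eq_zero_of_det_fderivWithin_eq_zero volume (f' := fun _ => 0) ?_ ?_
    · intro t ht
      have h3 : HasDerivWithinAt (fun t => ℓ (η t)) 0 B t := HasDerivWithinAt.mono ht.1 inter_subset_right
      have := h3.hasFDerivWithinAt
      simpa using this
    · intro t _
      simp [ContinuousLinearMap.det]
  have h3 : ∀ᵐ s : ℝ, s ∉ (fun t => ℓ (η t)) '' A' ∪ (fun t => ℓ (η t)) '' B := by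
    rw [← measure_eq_zero_iff_ae_notMem]
    exact measure_union_null h1 h2
  filter_upwards [h3] with s hs t ht hst
  rw [mem_union, not_or] at hs
  have hnA : t ∉ A' := fun h => hs.1 ⟨t, h, hst⟩
  have hnB : t ∉ B := fun h => hs.2 ⟨t, h, hst⟩
  have ht0 : t ≠ 0 := fun h => hnA (Or.inr (by simp [h]))
  have ht1 : t ≠ 1 := fun h => hnA (Or.inr (by simp [h]))
  have hto : t ∈ Ioo (0 : ℝ) 1 := ⟨lt_of_le_of_ne ht.1 ht0.symm, lt_of_le_of_ne ht.2 ht1⟩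
  have hd : DifferentiableWithinAt ℝ η (Icc 0 1) t := by
    by_contra h
    exact hnA (Or.inl ⟨ht, h⟩)
  have hd' := hd.differentiableAt (Icc_mem_nhds hto.1 hto.2)
  refine ⟨hto, _, hd'.hasDerivAt, fun h0 => hnB ⟨?_, ht⟩⟩
  have h4 := (ℓ.hasFDerivAt.comp_hasDerivAt t hd'.hasDerivAt).hasDerivWithinAt (s := Icc 0 1)
  rw [h0] at h4
  exact h4

/-- the cone at `x` in direction `v` is contained in `S` -/
def ConeIn (S : Set ℂ) (x v : ℂ) : Prop :=
  ∀ ε : ℝ, 0 < ε → ∃ δ : ℝ, 0 < δ ∧ ∀ ζ : ℂ, ‖ζ‖ < δ → ε * ‖ζ‖ < ζ.im → x + v * ζ ∈ S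

/-- the double cone avoids `E` -/
def Avoid (E : Set ℂ) (x v : ℂ) : Prop :=
  ∀ ε : ℝ, 0 < ε → ∃ δ : ℝ, 0 < δ ∧ ∀ ζ : ℂ, ‖ζ‖ < δ → ε * ‖ζ‖ < |ζ.im| → x + v * ζ ∉ E

lemma avoid_neg {E : Set ℂ} {x v : ℂ} (h : Avoid E x v) : Avoid E x (-v) := by
  intro ε hε
  obtain ⟨δ, hδ, h⟩ := h ε hε
  refine ⟨δ, hδ, fun ζ h1 h2 => ?_⟩
  have := h (-ζ) (by simpa using h1) (by simpa using h2)
  simpa using this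

lemma avoid_curve {η : ℝ → ℂ} (hinj : InjOn η (Icc 0 1)) (hc : ContinuousOn η (Icc 0 1)) {t : ℝ}
    (ht : t ∈ Icc (0 : ℝ) 1) {v : ℂ} (hv : HasDerivAt η v t) (hv0 : v ≠ 0) :
    Avoid (η '' Icc 0 1) (η t) v := by
  intro ε hε
  have hvn : 0 < ‖v‖ := norm_pos_iff.mpr hv0
  set ε' := min ε 1 / 2 with hε'
  have e0 : 0 < ε' := by positivity
  have e1 : ε' ≤ 1 / 2 := by have := min_le_right ε 1; rw [hε']; linarith
  have e2 : 2 * ε' ≤ ε := by have := min_le_left ε 1; rw [hε']; linarith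
  have hder := (hasDerivAt_iff_isLittleO.mp hv).def (c := ε' * ‖v‖) (by positivity)
  obtain ⟨τ, hτ, hder⟩ := Metric.eventually_nhds_iff.mp hder
  set K := Icc (0 : ℝ) 1 \ ball t τ with hK
  have hKc : IsCompact K := isCompact_Icc.diff isOpen_ball
  have hcK : IsCompact (η '' K) := hKc.image_of_continuousOn (hc.mono sdiff_subset)
  have hnot : η t ∉ η '' K := by
    rintro ⟨t', ht', he⟩
    have := hinj ht'.1 ht he
    exact ht'.2 (by rw [this]; exact mem_ball_self hτ)
  obtain ⟨c, hc0, hcb⟩ := Metric.isOpen_iff.mp hcK.isClosed.isOpen_compl (η t) hnot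
  refine ⟨c / ‖v‖, by positivity, ?_⟩
  rintro ζ hζ him ⟨t', ht', he⟩
  rw [lt_div_iff₀ hvn] at hζ
  have hb : η t' ∈ ball (η t) c := by
    rw [he, mem_ball, dist_eq_norm, add_sub_cancel_left, norm_mul]; linarith
  have ht'b : dist t' t < τ := by
    by_contra hcon
    exact hcb hb ⟨t', ⟨ht', hcon⟩, rfl⟩
  have hd := hder ht'b
  rw [he, add_sub_cancel_left] at hd
  set h := t' - t with hh
  have hd2 : ‖ζ - h‖ ≤ ε' * |h| := by
    have : v * ζ - h • v = v * (ζ - h) := by rw [Complex.real_smul]; ring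
    rw [this, norm_mul, Real.norm_eq_abs] at hd
    have h3 : ‖v‖ * ‖ζ - h‖ ≤ ‖v‖ * (ε' * |h|) := by linarith
    exact le_of_mul_le_mul_left h3 hvn
  have h4 : |ζ.im| ≤ ‖ζ - h‖ := by
    have := Complex.abs_im_le_norm (ζ - h)
    simpa using this
  have h5 : |h| ≤ ‖ζ‖ + ‖ζ - h‖ := by
    have : ‖(h : ℂ)‖ ≤ ‖ζ‖ + ‖ζ - h‖ := by
      have h6 : (h : ℂ) = ζ - (ζ - h) := by ring
      conv_lhs => rw [h6]
      exact norm_sub_le _ _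
    simpa using this
  have h7 : |h| ≤ 2 * ‖ζ‖ := by
    have : ε' * |h| ≤ 1 / 2 * |h| := by gcongr
    linarith
  have h8 : ε' * |h| ≤ ε' * (2 * ‖ζ‖) := by gcongr
  have h9 : 2 * ε' * ‖ζ‖ ≤ ε * ‖ζ‖ := by gcongr
  linarith

lemma preconn_frontier {S T : Set ℂ} (hT : IsPreconnected T) (hf : ∀ z ∈ T, z ∉ frontier S) :
    T ⊆ S ∨ T ⊆ Sᶜ := by
  have hcov : T ⊆ interior S ∪ interior Sᶜ := by
    intro z hz
    by_contra hcon
    rw [mem_union, not_or] at hcon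
    apply hf z hz
    rw [frontier_eq_closure_inter_closure, closure_eq_compl_interior_compl, closure_eq_compl_interior_compl,
      compl_compl]
    exact ⟨hcon.2, hcon.1⟩
  have hdis : Disjoint (interior S) (interior Sᶜ) :=
    (disjoint_compl_right (a := S)).mono interior_subset interior_subset
  rcases hT.subset_or_subset isOpen_interior isOpen_interior hdis hcov with h | h
  · exact Or.inl (h.trans interior_subset)
  · exact Or.inr (h.trans interior_subset)

lemma cone_dichotomy {S D : Set ℂ} (hD : IsOpen D) {x v : ℂ} (hx : x ∈ D)
    (hav : Avoid (D ∩ frontier S) x v) : ConeIn S x v ∨ ConeIn Sᶜ x v := by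
  have hconv : ∀ ε δ : ℝ, 0 < ε → Convex ℝ {ζ : ℂ | ‖ζ‖ < δ ∧ ε * ‖ζ‖ < ζ.im} := by
    intro ε δ hε z hz w hw α β hα hβ hαβ
    have hn : ‖α • z + β • w‖ ≤ α * ‖z‖ + β * ‖w‖ := by
      refine (norm_add_le _ _).trans ?_
      rw [norm_smul, norm_smul, Real.norm_eq_abs, Real.norm_eq_abs, abs_of_nonneg hα, abs_of_nonneg hβ]
    have him : (α • z + β • w).im = α * z.im + β * w.im := by simp
    have key : ∀ p r s : ℝ, p < s → r < s → α * p + β * r < s := by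
      intro p r s hp hr
      rcases hα.eq_or_lt with h | h
      · have : β = 1 := by linarith
        rw [← h, this]; linarith
      · have e1 : α * p < α * s := by gcongr
        have e2 : β * r ≤ β * s := by gcongr
        have : α * s + β * s = s := by rw [← add_mul, hαβ, one_mul]
        linarith
    refine ⟨hn.trans_lt (key _ _ _ hz.1 hw.1), ?_⟩
    rw [him]
    have e3 := key (ε * ‖z‖ - z.im) (ε * ‖w‖ - w.im) 0 (by linarith [hz.2]) (by linarith [hw.2])
    have e4 : ε * ‖α • z + β • w‖ ≤ ε * (α * ‖z‖ + β * ‖w‖) := by gcongr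
    linarith
  obtain ⟨ρ, hρ, hρD⟩ := Metric.isOpen_iff.mp hD x hx
  have hmain : ∀ ε : ℝ, 0 < ε → ∃ δ : ℝ, 0 < δ ∧
      ((∀ ζ : ℂ, ‖ζ‖ < δ → ε * ‖ζ‖ < ζ.im → x + v * ζ ∈ S) ∨
       (∀ ζ : ℂ, ‖ζ‖ < δ → ε * ‖ζ‖ < ζ.im → x + v * ζ ∈ Sᶜ)) := by
    intro ε hε
    obtain ⟨δ, hδ, h⟩ := hav ε hε
    refine ⟨min δ (ρ / (‖v‖ + 1)), by positivity, ?_⟩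
    set T := {ζ : ℂ | ‖ζ‖ < min δ (ρ / (‖v‖ + 1)) ∧ ε * ‖ζ‖ < ζ.im} with hT
    have hpre : IsPreconnected ((fun ζ => x + v * ζ) '' T) :=
      (hconv ε _ hε).isPreconnected.image _ (by fun_prop)
    have := preconn_frontier (S := S) hpre (by
      rintro _ ⟨ζ, ⟨h1, h2⟩, rfl⟩ hfr
      refine h ζ (h1.trans_le (min_le_left _ _)) (h2.trans_le (le_abs_self _)) ⟨hρD ?_, hfr⟩
      rw [mem_ball, dist_eq_norm, add_sub_cancel_left, norm_mul]
      have h3 := h1.trans_le (min_le_right _ _)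
      rw [lt_div_iff₀ (by positivity)] at h3
      nlinarith [norm_nonneg ζ])
    rcases this with h3 | h3
    · exact Or.inl fun ζ h1 h2 => h3 ⟨ζ, ⟨h1, h2⟩, rfl⟩
    · exact Or.inr fun ζ h1 h2 => h3 ⟨ζ, ⟨h1, h2⟩, rfl⟩
  obtain ⟨δ₁, hδ₁, hb⟩ := hmain (1 / 2) (by norm_num)
  have gen : ∀ S' : Set ℂ, (∀ ζ : ℂ, ‖ζ‖ < δ₁ → 1 / 2 * ‖ζ‖ < ζ.im → x + v * ζ ∈ S') →
      (∀ ε : ℝ, 0 < ε → ∃ δ : ℝ, 0 < δ ∧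
      ((∀ ζ : ℂ, ‖ζ‖ < δ → ε * ‖ζ‖ < ζ.im → x + v * ζ ∈ S') ∨
       (∀ ζ : ℂ, ‖ζ‖ < δ → ε * ‖ζ‖ < ζ.im → x + v * ζ ∈ S'ᶜ))) → ConeIn S' x v := by
    intro S' h1 h2 ε hε
    obtain ⟨δ, hδ, h3⟩ := h2 (min ε (1 / 2)) (by positivity)
    refine ⟨δ, hδ, ?_⟩
    rcases h3 with h3 | h3
    · intro ζ h4 h5
      refine h3 ζ h4 (lt_of_le_of_lt ?_ h5)
      gcongr
      exact min_le_left _ _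
    · exfalso
      set r := min δ δ₁ / 2 with hr
      have hm : 0 < min δ δ₁ := by positivity
      have hr0 : 0 < r := by positivity
      have hn : ‖Complex.I * (r : ℂ)‖ = r := by simp [abs_of_pos hr0]
      have hi : (Complex.I * (r : ℂ)).im = r := by simp
      have hlt : r < min δ δ₁ := by rw [hr]; linarith
      refine h3 (Complex.I * r) ?_ ?_ (h1 _ ?_ ?_)
      · rw [hn]; exact hlt.trans_le (min_le_left _ _)
      · rw [hn, hi]; have := min_le_right ε (1 / 2); nlinarith
      · rw [hn]; exact hlt.trans_le (min_le_right _ _)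
      · rw [hn, hi]; linarith
  rcases hb with hb | hb
  · exact Or.inl (gen S hb hmain)
  · refine Or.inr (gen Sᶜ hb fun ε hε => ?_)
    obtain ⟨δ, hδ, h⟩ := hmain ε hε
    exact ⟨δ, hδ, by rw [compl_compl]; exact h.symm⟩

end JS

namespace JS
open Metric ComplexConjugate

section
variable {S : Set ℂ} {q : ℕ → Polynomial ℂ} {a : ℕ → ℂ} {N dm : ℕ} {C C1 R₀ : ℝ} {X : ℕ → ℂ → ℂ}

lemma isOpen_unitDisk : IsOpen unitDisk := isOpen_ball

lemma Adm.bdd {d : ℕ → ℕ} {R C : ℝ} (hp : Par d R C) {x : ℕ → ℂ} (h : Adm d R C x)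
    (hb : ∃ B : ℝ, ∀ m, ‖x m‖ ≤ B) (m : ℕ) : ‖x m‖ ≤ R := by
  by_contra hcon
  push Not at hcon
  obtain ⟨B, hB⟩ := hb
  have hR := hp.R_gt_one
  have h1 : ∀ k : ℕ, (2 : ℝ) ^ k ≤ ‖x (m + k)‖ := by
    intro k
    induction k with
    | zero => simp; linarith
    | succ k ih =>
      have := h.double hp (h.esc_mono hp (Nat.le_add_right m k) hcon)
      rw [pow_succ, ← add_assoc]
      linarith
  obtain ⟨k, hk⟩ := pow_unbounded_of_one_lt B (show (1 : ℝ) < 2 by norm_num)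
  linarith [h1 k, hB (m + k)]

lemma Red.loc (H : Red S q a N dm C C1 R₀ X) {x : ℂ} (hx : x ∈ unitDisk) :
    ∃ R : ℝ, Par (fun j => (q j).natDegree) R C ∧ R₀ ≤ R ∧ ∃ δ : ℝ, 0 < δ ∧ ball x δ ⊆ unitDisk ∧
      ∀ z ∈ ball x δ, Adm (fun j => (q j).natDegree) R C (fun m => X m z) ∧
        (z ∈ S ↔ ∀ m, ‖X m z‖ ≤ R) := by
  set R := R₀ + Real.exp (2 * C + 1) + ‖X 0 x‖ + ‖X 1 x‖ with hR
  have n0 := norm_nonneg (X 0 x)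
  have n1 := norm_nonneg (X 1 x)
  have e0 := Real.exp_pos (2 * C + 1)
  have r0 := H.hR₀
  have hp : Par (fun j => (q j).natDegree) R C := ⟨H.hd, H.hC, by linarith⟩
  have hRR : R₀ ≤ R := by linarith
  have hev : ∀ m, ‖X m x‖ < R → ∀ᶠ z in 𝓝 x, ‖X m z‖ < R := fun m hm =>
    ((H.diff m).continuousOn.continuousAt (isOpen_unitDisk.mem_nhds hx)).norm.eventually (gt_mem_nhds hm)
  obtain ⟨δ, hδ, hδ'⟩ := Metric.eventually_nhds_iff_ball.mp
    ((hev 0 (by linarith)).and ((hev 1 (by linarith)).and (isOpen_unitDisk.mem_nhds hx)))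
  refine ⟨R, hp, hRR, δ, hδ, fun z hz => (hδ' z hz).2.2, fun z hz => ?_⟩
  obtain ⟨h0, h1, h2⟩ := hδ' z hz
  have hadm : Adm (fun j => (q j).natDegree) R C (fun m => X m z) :=
    adm_of_rec (C1 := C1) hp (q := q) (a := a) (fun _ => rfl)
      (fun j => (H.hHC j).mono le_rfl le_rfl hRR (by linarith)) (fun j => H.recu j z) h0.le h1.le
  refine ⟨hadm, ?_⟩
  rw [H.mem z h2]
  exact ⟨fun h m => hadm.bdd hp h m, fun h => ⟨R, h⟩⟩

lemma Red.closed (H : Red S q a N dm C C1 R₀ X) : unitDisk ∩ closure S ⊆ S := by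
  rintro x ⟨hx, hxc⟩
  obtain ⟨R, hp, -, δ, hδ, hsub, hloc⟩ := H.loc hx
  rw [(hloc x (mem_ball_self hδ)).2]
  intro m
  by_contra hcon
  push Not at hcon
  have h1 : ∀ᶠ z in 𝓝 x, R < ‖X m z‖ :=
    ((H.diff m).continuousOn.continuousAt (isOpen_unitDisk.mem_nhds hx)).norm.eventually (lt_mem_nhds hcon)
  have h2 := mem_closure_iff_frequently.mp hxc
  obtain ⟨z, hz, hz1, hz2⟩ := (h2.and_eventually (h1.and (ball_mem_nhds x hδ))).exists
  have := ((hloc z hz2).2.mp hz) m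
  linarith

lemma Red.final (H : Red S q a N dm C C1 R₀ X) (hSD : S ⊆ unitDisk) {x v : ℂ} (hx : x ∈ S) (hv : v ≠ 0)
    (out : ConeIn Sᶜ x v) (low : ConeIn S x (-v) ∨ ConeIn Sᶜ x (-v))
    (fill : ∀ s : ℝ, ∃ e : ℝ → ℂ, Tendsto e (𝓝[>] 0) (𝓝 (s : ℂ)) ∧
      ∀ᶠ r in 𝓝[>] (0 : ℝ), x + v * (r * e r) ∈ S) : False := by
  obtain ⟨R, hp, hRR, δ, hδ, hsub, hloc⟩ := H.loc (hSD hx)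
  have hvn : 0 < ‖v‖ := norm_pos_iff.mpr hv
  set δ₀ := δ / ‖v‖ with hδ₀
  have hδ₀0 : 0 < δ₀ := by positivity
  have hin : ∀ ζ : ℂ, ‖ζ‖ < δ₀ → x + v * ζ ∈ ball x δ := by
    intro ζ hζ
    rw [hδ₀, lt_div_iff₀ hvn] at hζ
    rw [mem_ball, dist_eq_norm, add_sub_cancel_left, norm_mul]
    linarith
  have r0 := H.hR₀
  have hHC := fun j => (H.hHC j).mono le_rfl le_rfl hRR (by linarith)
  have hescape : ∀ ζ : ℂ, ‖ζ‖ < δ₀ → x + v * ζ ∈ Sᶜ → ∃ m, R < ‖X m (x + v * ζ)‖ := by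
    intro ζ hζ h
    rw [mem_compl_iff, (hloc _ (hin ζ hζ)).2] at h
    push Not at h
    exact h
  have hbound : ∀ ζ : ℂ, ‖ζ‖ < δ₀ → x + v * ζ ∈ S → ∀ m, ‖X m (x + v * ζ)‖ ≤ R :=
    fun ζ hζ h => (hloc _ (hin ζ hζ)).2.mp h
  have hL : Loc (fun j => (q j).natDegree) R C C1 q a (fun m ζ => X m (x + v * ζ)) δ₀ N dm := by
    refine ⟨hp, H.hC1, H.hN, fun j => by simp only [H.qper j], H.qper, H.aper, H.hdm,
      fun j y hy => (hHC j).2.2.1 y hy.le, fun j => ⟨H.ha j, (hHC j).2.2.2⟩, hδ₀0, ?_, ?_, ?_, ?_, ?_, ?_, ?_⟩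
    · intro m
      refine (H.diff m).comp (by fun_prop) (fun ζ hζ => hsub (hin ζ ?_))
      simpa using hζ
    · intro ζ hζ
      exact (hloc _ (hin ζ (by simpa using hζ))).1
    · intro j ζ _
      exact H.recu j _
    · intro m
      exact hbound 0 (by simpa using hδ₀0) (by simpa using hx) m
    · intro ε hε
      obtain ⟨δ', hδ', h⟩ := out ε hε
      refine ⟨min δ' δ₀, by positivity, fun ζ h1 h2 => ?_⟩
      exact hescape ζ (h1.trans_le (min_le_right _ _)) (h ζ (h1.trans_le (min_le_left _ _)) h2)
    · rcases low with low | low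
      · right
        intro ε hε
        obtain ⟨δ', hδ', h⟩ := low ε hε
        refine ⟨min δ' δ₀, by positivity, fun ζ h1 h2 => ?_⟩
        have h3 := h (-ζ) (by simpa using h1.trans_le (min_le_left _ _)) (by simpa using h2)
        exact hbound ζ (h1.trans_le (min_le_right _ _)) (by simpa using h3)
      · left
        intro ε hε
        obtain ⟨δ', hδ', h⟩ := low ε hε
        refine ⟨min δ' δ₀, by positivity, fun ζ h1 h2 => ?_⟩
        have h3 := h (-ζ) (by simpa using h1.trans_le (min_le_left _ _)) (by simpa using h2)
        exact hescape ζ (h1.trans_le (min_le_right _ _)) (by simpa using h3)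
    · intro s
      obtain ⟨e, he, hf⟩ := fill s
      refine ⟨e, he, ?_⟩
      have h1 : Tendsto (fun r : ℝ => (r : ℂ) * e r) (𝓝[>] 0) (𝓝 0) := by
        have h2 : Tendsto (fun r : ℝ => (r : ℂ)) (𝓝[>] 0) (𝓝 0) := by
          have : Tendsto (fun r : ℝ => (r : ℂ)) (𝓝 0) (𝓝 ((0 : ℝ) : ℂ)) :=
            Complex.continuous_ofReal.tendsto 0
          simpa using this.mono_left nhdsWithin_le_nhds
        simpa using h2.mul he
      have h3 : ∀ᶠ r : ℝ in 𝓝[>] (0 : ℝ), ‖(r : ℂ) * e r‖ < δ₀ := by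
        have := h1.norm
        rw [norm_zero] at this
        exact this.eventually (gt_mem_nhds hδ₀0)
      filter_upwards [hf, h3] with r hr1 hr2
      exact hbound _ hr2 hr1
  exact hL.absurd

lemma fill_of_deriv {η : ℝ → ℂ} {t : ℝ} (ht : t ∈ Ioo (0 : ℝ) 1) {v : ℂ} (hv : HasDerivAt η v t)
    (hv0 : v ≠ 0) (hS : η '' Icc 0 1 ⊆ S) (s : ℝ) : ∃ e : ℝ → ℂ, Tendsto e (𝓝[>] 0) (𝓝 (s : ℂ)) ∧
      ∀ᶠ r in 𝓝[>] (0 : ℝ), η t + v * (r * e r) ∈ S := by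
  refine ⟨fun r => (η (t + r * s) - η t) / (r * v), ?_, ?_⟩
  · have h1 : HasDerivAt (fun r : ℝ => η (t + r * s)) (s • v) 0 := by
      have h2 : HasDerivAt (fun r : ℝ => t + r * s) s 0 := by
        simpa using ((hasDerivAt_id (0 : ℝ)).mul_const s).const_add t
      have h3 : HasDerivAt η v (t + 0 * s) := by simpa using hv
      exact HasDerivAt.scomp (0 : ℝ) h3 h2
    have h4 := h1.tendsto_slope_zero_right
    have h5 := h4.div_const v
    have h6 : s • v / v = (s : ℂ) := by rw [Complex.real_smul, mul_div_cancel_right₀ _ hv0]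
    rw [h6] at h5
    refine h5.congr fun r => ?_
    simp only [zero_add, zero_mul, add_zero, Complex.real_smul, Complex.ofReal_inv]
    rw [div_mul_eq_div_div, div_eq_mul_inv (_ - _) (r : ℂ), mul_comm (_ - _)]
  · have h1 : Tendsto (fun r : ℝ => t + r * s) (𝓝[>] 0) (𝓝 t) := by
      have : ContinuousAt (fun r : ℝ => t + r * s) 0 := by fun_prop
      have h2 : Tendsto (fun r : ℝ => t + r * s) (𝓝 0) (𝓝 t) := by
        simpa using this.tendsto
      exact h2.mono_left nhdsWithin_le_nhds
    filter_upwards [h1.eventually (Icc_mem_nhds ht.1 ht.2), self_mem_nhdsWithin] with r hr hr0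
    have hr1 : (r : ℂ) ≠ 0 := by
      have : (0 : ℝ) < r := hr0
      exact_mod_cast this.ne'
    have : η t + v * (r * ((η (t + r * s) - η t) / (r * v))) = η (t + r * s) := by
      field_simp
      ring
    rw [this]
    exact hS ⟨_, hr, rfl⟩

lemma Red.good (H : Red S q a N dm C C1 R₀ X) (hSD : S ⊆ unitDisk) {η : ℝ → ℂ} {K : NNReal}
    (hinj : InjOn η (Icc 0 1)) (hLip : LipschitzOnWith K η (Icc 0 1))
    (him : η '' Icc 0 1 = unitDisk ∩ frontier S) {t : ℝ} (ht : t ∈ Ioo (0 : ℝ) 1) {v : ℂ}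
    (hv : HasDerivAt η v t) (hv0 : v ≠ 0) (hnot : ¬ ConeIn S (η t) v ∨ ¬ ConeIn S (η t) (-v)) : False := by
  have htI : t ∈ Icc (0 : ℝ) 1 := Ioo_subset_Icc_self ht
  have hES : η '' Icc 0 1 ⊆ S := by
    rw [him]
    exact (inter_subset_inter_right _ frontier_subset_closure).trans H.closed
  have hxS : η t ∈ S := hES ⟨t, htI, rfl⟩
  have hav := avoid_curve hinj hLip.continuousOn htI hv hv0
  rw [him] at hav
  have c1 := cone_dichotomy isOpen_unitDisk (hSD hxS) hav
  have c2 := cone_dichotomy isOpen_unitDisk (hSD hxS) (avoid_neg hav)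
  have hfill := fill_of_deriv ht hv hv0 hES
  rcases hnot with h | h
  · exact H.final hSD hxS hv0 (c1.resolve_left h) c2 hfill
  · refine H.final hSD hxS (neg_ne_zero.mpr hv0) (c2.resolve_left h) (by rwa [neg_neg]) fun s => ?_
    obtain ⟨e, he, hf⟩ := hfill (-s)
    refine ⟨fun r => -e r, by simpa using he.neg, ?_⟩
    filter_upwards [hf] with r hr
    simpa using hr

end

end JS

namespace JS
open Metric ComplexConjugate

lemma cone_ray {S : Set ℂ} {x v k : ℂ} (h : ConeIn S x v) (hk : 0 < k.im) :
    ∃ δ > 0, ∀ r : ℝ, 0 < r → r < δ → x + v * (r * k) ∈ S := by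
  have hk0 : k ≠ 0 := by
    rintro rfl
    simp at hk
  have hn : 0 < ‖k‖ := norm_pos_iff.2 hk0
  obtain ⟨δ, hδ, h⟩ := h (k.im / (2 * ‖k‖)) (by positivity)
  refine ⟨δ / ‖k‖, by positivity, fun r hr hr2 => h _ ?_ ?_⟩
  · rw [norm_mul, Complex.norm_real, Real.norm_eq_abs, abs_of_pos hr]
    exact (lt_div_iff₀ hn).1 hr2
  · rw [norm_mul, Complex.norm_real, Real.norm_eq_abs, abs_of_pos hr, Complex.im_ofReal_mul]
    have : k.im / (2 * ‖k‖) * (r * ‖k‖) = r * k.im / 2 := by field_simp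
    rw [this]
    have := mul_pos hr hk
    linarith

lemma cone_interior {S : Set ℂ} {x v : ℂ} (h : ConeIn S x v) (hv : v ≠ 0) :
    (interior S).Nonempty := by
  obtain ⟨δ, hδ, h⟩ := h (1 / 2) (by norm_num)
  refine ⟨x + v * ((δ / 2 : ℝ) * Complex.I), mem_interior.2
    ⟨{z | ‖(z - x) / v‖ < δ ∧ 1 / 2 * ‖(z - x) / v‖ < ((z - x) / v).im}, ?_, ?_, ?_⟩⟩
  · rintro z ⟨h1, h2⟩
    have := h _ h1 h2
    rwa [mul_div_cancel₀ _ hv, add_sub_cancel] at this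
  · have hc : Continuous fun z : ℂ => (z - x) / v := by fun_prop
    exact (isOpen_lt hc.norm continuous_const).inter
      (isOpen_lt (continuous_const.mul hc.norm) (Complex.continuous_im.comp hc))
  · simp only [mem_setOf_eq, add_sub_cancel_left, mul_div_cancel_left₀ _ hv]
    simp [abs_of_pos hδ]
    constructor <;> linarith

lemma exists_good {P : ℝ → Prop} (h : ∀ᵐ s, P s) {U : Set ℝ} (hU : IsOpen U) (hne : U.Nonempty) :
    ∃ s ∈ U, P s := by
  obtain ⟨s, hs, hs'⟩ := (MeasureTheory.Measure.dense_of_ae h).exists_mem_open hU hne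
  exact ⟨s, hs', hs⟩

lemma caseA_level {η : ℝ → ℂ} {K : NNReal} (hLip : LipschitzOnWith K η (Icc 0 1))
    (ℓ : ℂ →L[ℝ] ℝ) (hne : ℓ (η 0) ≠ ℓ (η 1)) :
    ∃ t ∈ Ioo (0 : ℝ) 1, ∃ v, HasDerivAt η v t ∧ v ≠ 0 := by
  have hc : ContinuousOn (fun t => ℓ (η t)) (Icc 0 1) := ℓ.continuous.comp_continuousOn hLip.continuousOn
  have key : ∃ s, (∃ t ∈ Icc (0 : ℝ) 1, ℓ (η t) = s) ∧
      (∀ t ∈ Icc 0 1, ℓ (η t) = s → t ∈ Ioo 0 1 ∧ ∃ v, HasDerivAt η v t ∧ ℓ v ≠ 0) := by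
    rcases lt_or_gt_of_ne hne with h | h
    · obtain ⟨s, hs, hP⟩ := exists_good (sard_level hLip ℓ) isOpen_Ioo (nonempty_Ioo.2 h)
      exact ⟨s, intermediate_value_Icc zero_le_one hc ⟨hs.1.le, hs.2.le⟩, hP⟩
    · obtain ⟨s, hs, hP⟩ := exists_good (sard_level hLip ℓ) isOpen_Ioo (nonempty_Ioo.2 h)
      exact ⟨s, intermediate_value_Icc' zero_le_one hc ⟨hs.1.le, hs.2.le⟩, hP⟩
  obtain ⟨s, ⟨t, ht, hts⟩, hP⟩ := key
  obtain ⟨h1, v, hv, hv0⟩ := hP t ht hts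
  refine ⟨t, h1, v, hv, ?_⟩
  rintro rfl
  simp at hv0

lemma caseA {η : ℝ → ℂ} {K : NNReal} (hinj : InjOn η (Icc 0 1))
    (hLip : LipschitzOnWith K η (Icc 0 1)) :
    ∃ t ∈ Ioo (0 : ℝ) 1, ∃ v, HasDerivAt η v t ∧ v ≠ 0 := by
  have hne : η 0 ≠ η 1 := fun h => by
    have := hinj (by simp) (by simp) h
    norm_num at this
  by_cases hre : (η 0).re = (η 1).re
  · exact caseA_level hLip Complex.imCLM (fun h => hne (Complex.ext hre h))
  · exact caseA_level hLip Complex.reCLM hre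

lemma caseB {S : Set ℂ} (hcl : unitDisk ∩ closure S ⊆ S) (hSD : S ⊆ unitDisk)
    {η : ℝ → ℂ} {K : NNReal}
    (hLip : LipschitzOnWith K η (Icc 0 1)) (him : η '' Icc 0 1 = unitDisk ∩ frontier S)
    {a b : ℂ} (ha : a ∈ unitDisk) (haS : a ∉ S) (hb : b ∈ interior S) :
    ∃ t ∈ Ioo (0 : ℝ) 1, ∃ v, HasDerivAt η v t ∧ v ≠ 0 ∧
      (¬ ConeIn S (η t) v ∨ ¬ ConeIn S (η t) (-v)) := by
  have hab : b - a ≠ 0 := by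
    rw [sub_ne_zero]
    rintro rfl
    exact haS (interior_subset hb)
  obtain ⟨e, he⟩ : ∃ e, e = b - a := ⟨_, rfl⟩
  rw [← he] at hab
  set ℓ : ℂ →L[ℝ] ℝ := Complex.imCLM.comp ((ContinuousLinearMap.mul ℝ ℂ) e⁻¹) with hℓ
  have hℓv : ∀ z, ℓ z = (z / e).im := fun z => by
    simp only [hℓ, ContinuousLinearMap.comp_apply, ContinuousLinearMap.mul_apply', Complex.imCLM_apply]
    rw [div_eq_mul_inv, mul_comm]
  have haC : a ∈ unitDisk ∩ (closure S)ᶜ := ⟨ha, fun h => haS (hcl ⟨ha, h⟩)⟩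
  have hoA : IsOpen (unitDisk ∩ (closure S)ᶜ) := isOpen_unitDisk.inter isClosed_closure.isOpen_compl
  let φ : ℝ → ℝ → ℂ := fun s τ => a + ((s - (a / e).im : ℝ) * Complex.I + τ) * e
  have hℓφ : ∀ s τ, ℓ (φ s τ) = s := fun s τ => by
    rw [hℓv]
    simp only [φ]
    rw [add_div, mul_div_cancel_right₀ _ hab]
    simp
  have hφs : ∀ τ, Continuous fun s => φ s τ := fun τ => by
    simp only [φ]; fun_prop
  have hφτ : ∀ s, Continuous fun τ => φ s τ := fun s => by
    simp only [φ]; fun_prop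
  have hU : IsOpen {s | φ s 0 ∈ unitDisk ∩ (closure S)ᶜ ∧ φ s 1 ∈ interior S} :=
    (hoA.preimage (hφs 0)).inter (isOpen_interior.preimage (hφs 1))
  obtain ⟨s, ⟨hs0, hs1⟩, hP⟩ := exists_good (sard_level hLip ℓ) hU ⟨(a / e).im, by
    simp only [φ, mem_setOf_eq]
    refine ⟨by simpa using haC, ?_⟩
    simpa [he] using hb⟩
  have hφD : ∀ τ ∈ Icc (0 : ℝ) 1, φ s τ ∈ unitDisk := fun τ hτ => by
    have hcv : Convex ℝ unitDisk := convex_ball 0 1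
    have := hcv hs0.1 (hSD (interior_subset hs1)) (sub_nonneg.2 hτ.2) hτ.1 (by ring)
    convert this using 1
    simp only [φ, Complex.real_smul]
    push_cast
    ring
  set T : Set ℝ := {τ | τ ∈ Icc (0 : ℝ) 1 ∧ φ s τ ∉ S} with hT
  have h0T : (0 : ℝ) ∈ T := ⟨by simp, fun h => hs0.2 (subset_closure h)⟩
  have hbdd : BddAbove T := ⟨1, fun τ h => h.1.2⟩
  obtain ⟨m, hm⟩ : ∃ m, m = sSup T := ⟨_, rfl⟩
  have hm0 : 0 ≤ m := hm ▸ le_csSup hbdd h0T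
  have hm1 : m ≤ 1 := hm ▸ csSup_le ⟨0, h0T⟩ (fun τ h => h.1.2)
  have hmT : m ∈ closure T := hm ▸ csSup_mem_closure ⟨0, h0T⟩ hbdd
  have hmc : φ s m ∉ interior S := by
    have : φ s m ∈ closure Sᶜ :=
      map_mem_closure (hφτ s) hmT (fun τ h => h.2)
    rwa [closure_compl] at this
  have hmlt : m < 1 := lt_of_le_of_ne hm1 (by rintro rfl; exact hmc hs1)
  have habove : ∀ τ ∈ Ioo m 1, φ s τ ∈ S := fun τ hτ => by
    by_contra h
    have : τ ≤ sSup T := le_csSup hbdd ⟨⟨hm0.trans hτ.1.le, hτ.2.le⟩, h⟩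
    linarith [hτ.1]
  have hmcl : φ s m ∈ closure S := by
    have h1 : m ∈ closure (Ioo m 1) := by
      rw [closure_Ioo hmlt.ne]; exact ⟨le_rfl, hm1⟩
    exact map_mem_closure (hφτ s) h1 habove
  have hmD := hφD m ⟨hm0, hm1⟩
  have hmS : φ s m ∈ S := hcl ⟨hmD, hmcl⟩
  have hfr : φ s m ∈ η '' Icc 0 1 := by
    rw [him]; exact ⟨hmD, hmcl, hmc⟩
  obtain ⟨t, ht, hts⟩ := hfr
  obtain ⟨ht', v, hv, hℓ0⟩ := hP t ht (by rw [hts, hℓφ])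
  have hv0 : v ≠ 0 := by
    rintro rfl
    simp at hℓ0
  refine ⟨t, ht', v, hv, hv0, ?_⟩
  have hkim : (-(e / v)).im ≠ 0 := by
    intro h
    apply hℓ0
    rw [hℓv, ← inv_div e v, Complex.inv_im]
    rw [Complex.neg_im] at h
    rw [h]; simp
  have hnear : ∀ δ > 0, ∃ r : ℝ, 0 < r ∧ r < δ ∧ φ s (m - r) ∉ S := fun δ hδ => by
    obtain ⟨τ, hτ, hlt⟩ := exists_lt_of_lt_csSup ⟨0, h0T⟩ (show m - δ < sSup T by linarith)
    have h1 : τ ≤ m := hm ▸ le_csSup hbdd hτ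
    have h2 : τ ≠ m := by
      rintro rfl
      exact hτ.2 hmS
    refine ⟨m - τ, sub_pos.2 (lt_of_le_of_ne h1 h2), by linarith, ?_⟩
    rw [sub_sub_cancel]; exact hτ.2
  have hform : ∀ r : ℝ, φ s (m - r) = η t + v * (r * (-(e / v))) := fun r => by
    rw [hts]
    simp only [φ]
    push_cast
    field_simp
    ring
  rcases lt_or_gt_of_ne hkim with h | h
  · right
    intro hC
    obtain ⟨δ, hδ, hr⟩ := cone_ray hC (k := e / v) (by simpa using h)
    obtain ⟨r, h0, h1, h2⟩ := hnear δ hδ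
    apply h2
    have := hr r h0 h1
    rw [hform]
    convert this using 1
    ring
  · left
    intro hC
    obtain ⟨δ, hδ, hr⟩ := cone_ray hC h
    obtain ⟨r, h0, h1, h2⟩ := hnear δ hδ
    apply h2
    rw [hform]
    exact hr r h0 h1

end JS

/-- the Julia slice of a transversal to `J⁺` is never a rectifiable curve. -/
theorem julia_slice_not_rectifiable_curve (f : ℂ × ℂ → ℂ × ℂ) (γ : ℂ → ℂ × ℂ)
    (hf : IsLoxodromic f) (hγ : IsTransversal f γ) :
    ¬ ∃ (η : ℝ → ℂ) (K : NNReal), Set.InjOn η (Set.Icc 0 1) ∧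
        LipschitzOnWith K η (Set.Icc 0 1) ∧ η '' Set.Icc 0 1 = juliaSlice f γ := by
  rintro ⟨η, K, hinj, hLip, him⟩
  obtain ⟨-, hd, -, hout⟩ := hγ
  push Not at hout
  obtain ⟨a, ha, haK⟩ := hout
  obtain ⟨q, a', N, dm, C, C1, R₀, X, H⟩ := JS.reduction hf hd
  have hSD : {z | z ∈ unitDisk ∧ γ z ∈ Kplus f} ⊆ unitDisk := fun z h => h.1
  rcases (interior {z | z ∈ unitDisk ∧ γ z ∈ Kplus f}).eq_empty_or_nonempty with h | ⟨b, hb⟩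
  · obtain ⟨t, ht, v, hv, hv0⟩ := JS.caseA hinj hLip
    refine H.good hSD hinj hLip him ht hv hv0 (Or.inl fun hC => ?_)
    have := JS.cone_interior hC hv0
    rw [h] at this
    exact Set.not_nonempty_empty this
  · obtain ⟨t, ht, v, hv, hv0, hn⟩ :=
      JS.caseB H.closed hSD hLip him ha (fun h => haK h.2) hb
    exact H.good hSD hinj hLip him ht hv hv0 hn
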